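/- arXiv:1402.4520 — 4 statements merged into one kernel-verified Lean document; each statement's English description precedes it below -/
import Mathlib

section
/- Let n ≥ m ≥ 1. For every measurable function f from m×m real symmetric matrices to [0, ∞], one has ∫_{X ∈ ℝ^{n×m}} f(XᵀX) dX = (π^{mn/2} / Γ_m(n/2)) · ∫_{S positive definite} f(S) · det(S)^{(n−m−1)/2} dS, where the left integral is with respect to Lebesgue measure on n×m real matrices and the right integral is with respect to Lebesgue measure on m×m real symmetric matrices restricted to the open cone of positive definite matrices. -/
open MeasureTheory Matrix Real

/-- Lebesgue (product) measure on `n × m` real matrices, via the identification with `ℝ^{nm}`. -/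
noncomputable instance matMeasureSpace (n m : ℕ) : MeasureSpace (Matrix (Fin n) (Fin m) ℝ) :=
  (inferInstance : MeasureSpace (Fin n → Fin m → ℝ))

/-- Determinant of the leading principal `(i+1) × (i+1)` submatrix. -/
noncomputable def princMinor {m : ℕ} (A : Matrix (Fin m) (Fin m) ℝ) (i : Fin m) : ℝ :=
  (A.submatrix (fun j : Fin (i.1 + 1) => Fin.castLE i.isLt j)
    (fun j : Fin (i.1 + 1) => Fin.castLE i.isLt j)).det

/-- The highest weight vector (generalized power)
`q_κ(A) = det(A)^{k_m} ∏_{i=1}^{m-1} det(A_i)^{k_i - k_{i+1}}`. -/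
noncomputable def hwv {m : ℕ} (κ : Fin m → ℝ) (A : Matrix (Fin m) (Fin m) ℝ) : ℝ :=
  ∏ i : Fin m, princMinor A i ^ (if h : i.1 + 1 < m then κ i - κ ⟨i.1 + 1, h⟩ else κ i)

/-- The real multivariate gamma function `Γ_m(a) = π^{m(m-1)/4} ∏ Γ(a - (i-1)/2)`. -/
noncomputable def mvGamma (m : ℕ) (a : ℝ) : ℝ :=
  Real.pi ^ (((m * (m - 1) : ℕ) : ℝ) / 4) * ∏ i : Fin m, Real.Gamma (a - (i : ℝ) / 2)

/-- The generalized gamma function of weight `τ`: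
`Γ_m(a, τ) = π^{m(m-1)/4} ∏ Γ(a + t_i - (i-1)/2)`. -/
noncomputable def mvGammaI (m : ℕ) (a : ℝ) (τ : Fin m → ℝ) : ℝ :=
  Real.pi ^ (((m * (m - 1) : ℕ) : ℝ) / 4) * ∏ i : Fin m, Real.Gamma (a + τ i - (i : ℝ) / 2)

/-- The generalized gamma function of weight `-τ`:
`Γ_m(a, -τ) = π^{m(m-1)/4} ∏ Γ(a - t_i - (m-i)/2)`. -/
noncomputable def mvGammaII (m : ℕ) (a : ℝ) (τ : Fin m → ℝ) : ℝ :=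
  Real.pi ^ (((m * (m - 1) : ℕ) : ℝ) / 4) *
    ∏ i : Fin m, Real.Gamma (a - τ i - ((m : ℝ) - 1 - (i : ℝ)) / 2)

/-- Lebesgue measure on `m × m` real symmetric matrices: the pushforward of the product
Lebesgue measure in the coordinates `(x_{ij})_{i ≤ j}` under the obvious parametrization. -/
noncomputable def symmVol (m : ℕ) : Measure (Matrix (Fin m) (Fin m) ℝ) :=
  Measure.map (fun f : {p : Fin m × Fin m // p.1 ≤ p.2} → ℝ =>
    Matrix.of fun i j => if h : i ≤ j then f ⟨(i, j), h⟩ else f ⟨(j, i), le_of_not_ge h⟩) volume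

/-- The eigenvalues of `XᵀX`, arranged in decreasing order. -/
noncomputable def sortedEigs {n m : ℕ} (X : Matrix (Fin n) (Fin m) ℝ) : Fin m → ℝ :=
  fun i =>
    ((Matrix.isHermitian_conjTranspose_mul_self X).eigenvalues ∘
      Tuple.sort (Matrix.isHermitian_conjTranspose_mul_self X).eigenvalues) (Fin.rev i)

/-- The singular values of an `n × m` real matrix, in decreasing order. -/
noncomputable def svalues {n m : ℕ} (X : Matrix (Fin n) (Fin m) ℝ) : Fin m → ℝ :=
  fun i => Real.sqrt (sortedEigs X i)

theorem lintegral_fun_norm_addHaar {E : Type*} [NormedAddCommGroup E] [NormedSpace ℝ E]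
    [MeasurableSpace E] [Nontrivial E] (μ : Measure E) [FiniteDimensional ℝ E] [BorelSpace E]
    [μ.IsAddHaarMeasure] {f : ℝ → ENNReal} (hf : Measurable f) :
    ∫⁻ x, f ‖x‖ ∂μ = Module.finrank ℝ E * μ (Metric.ball 0 1) *
      ∫⁻ y in Set.Ioi (0 : ℝ), ENNReal.ofReal (y ^ (Module.finrank ℝ E - 1)) * f y := by
  calc
    ∫⁻ x, f ‖x‖ ∂μ = ∫⁻ x : ({(0)}ᶜ : Set E), f ‖x.1‖ ∂(μ.comap (↑)) := by
      rw [lintegral_subtype_comap (measurableSet_singleton _).compl fun x ↦ f ‖x‖,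
        restrict_compl_singleton]
    _ = ∫⁻ x, f x.2 ∂μ.toSphere.prod (.volumeIoiPow (Module.finrank ℝ E - 1)) := by
      simpa using μ.measurePreserving_homeomorphUnitSphereProd.lintegral_comp_emb
        (Homeomorph.measurableEmbedding _) (f ∘ Subtype.val ∘ Prod.snd)
    _ = μ.toSphere Set.univ *
        ∫⁻ x : Set.Ioi (0 : ℝ), f x ∂.volumeIoiPow (Module.finrank ℝ E - 1) := by
      rw [lintegral_prod _ (by fun_prop)]
      simp [mul_comm]
    _ = _ := by
      rw [Measure.volumeIoiPow, lintegral_withDensity_eq_lintegral_mul _ (by fun_prop)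
        (by fun_prop), μ.toSphere_apply_univ]
      congr 1
      exact lintegral_subtype_comap measurableSet_Ioi
        fun y : ℝ ↦ ENNReal.ofReal (y ^ (Module.finrank ℝ E - 1)) * f y

/-- Squaring as a substitution on the positive half-line. -/
theorem lintegral_Ioi_comp_sq (f : ℝ → ENNReal) :
    ∫⁻ r in Set.Ioi (0 : ℝ), f r =
      ∫⁻ y in Set.Ioi (0 : ℝ), ENNReal.ofReal (2 * y) * f (y ^ 2) := by
  have himage : (fun y : ℝ ↦ y ^ 2) '' Set.Ioi 0 = Set.Ioi 0 := by
    ext r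
    refine ⟨?_, fun hr ↦ ⟨√r, Real.sqrt_pos.2 hr, Real.sq_sqrt (le_of_lt hr)⟩⟩
    rintro ⟨y, hy, rfl⟩
    exact pow_pos (Set.mem_Ioi.1 hy) 2
  conv_lhs => rw [← himage]
  rw [lintegral_image_eq_lintegral_abs_deriv_mul (f' := fun y ↦ 2 * y) measurableSet_Ioi]
  · refine setLIntegral_congr_fun measurableSet_Ioi fun y hy ↦ ?_
    rw [Set.mem_Ioi] at hy
    simp only [abs_of_pos (mul_pos two_pos hy)]
  · intro y _
    simpa using (hasDerivAt_pow 2 y).hasDerivWithinAt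
  · intro a ha b hb hab
    exact (pow_left_inj₀ (le_of_lt ha) (le_of_lt hb) two_ne_zero).1 hab

/-- The squared Euclidean norm on `ℝᵏ` has density `π^{k/2} / Γ(k/2) · r^{k/2 - 1}`. -/
theorem lintegral_comp_dotProduct_self {k : ℕ} (hk : 0 < k) {h : ℝ → ENNReal}
    (hh : Measurable h) :
    ∫⁻ y : Fin k → ℝ, h (y ⬝ᵥ y) =
      ENNReal.ofReal (Real.pi ^ ((k : ℝ) / 2) / Real.Gamma ((k : ℝ) / 2)) *
        ∫⁻ r in Set.Ioi (0 : ℝ), ENNReal.ofReal (r ^ ((k : ℝ) / 2 - 1)) * h r := by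
  have : Nonempty (Fin k) := ⟨⟨0, hk⟩⟩
  have hk' : (0 : ℝ) < k := by exact_mod_cast hk
  have hnorm : ∀ x : EuclideanSpace ℝ (Fin k), x.ofLp ⬝ᵥ x.ofLp = ‖x‖ ^ 2 := fun x ↦ by
    simp [EuclideanSpace.real_norm_sq_eq, dotProduct, ← pow_two]
  have hconst : (k : ENNReal) *
      ENNReal.ofReal (√Real.pi ^ k / Real.Gamma ((k : ℝ) / 2 + 1)) =
      ENNReal.ofReal (Real.pi ^ ((k : ℝ) / 2) / Real.Gamma ((k : ℝ) / 2)) * 2 := by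
    rw [← ENNReal.ofReal_natCast, ← ENNReal.ofReal_ofNat 2, ← ENNReal.ofReal_mul hk'.le,
      ← ENNReal.ofReal_mul (div_nonneg (by positivity) (Real.Gamma_pos_of_pos (by positivity)).le),
      Real.Gamma_add_one (by positivity), Real.sqrt_eq_rpow, ← Real.rpow_mul_natCast pi_pos.le,
      one_div_mul_eq_div]
    congr 1
    have := (Real.Gamma_pos_of_pos (half_pos hk')).ne'
    field_simp
  calc
    ∫⁻ y : Fin k → ℝ, h (y ⬝ᵥ y) = ∫⁻ x : EuclideanSpace ℝ (Fin k), h (‖x‖ ^ 2) := by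
      rw [← (EuclideanSpace.volume_preserving_symm_measurableEquiv_toLp
        (Fin k)).lintegral_comp_emb (MeasurableEquiv.measurableEmbedding _)]
      exact lintegral_congr fun x ↦ by rw [← hnorm]; rfl
    _ = k * ENNReal.ofReal (√Real.pi ^ k / Real.Gamma ((k : ℝ) / 2 + 1)) *
        ∫⁻ y in Set.Ioi (0 : ℝ), ENNReal.ofReal (y ^ (k - 1)) * h (y ^ 2) := by
      rw [lintegral_fun_norm_addHaar (f := fun y ↦ h (y ^ 2)) _ (by fun_prop),
        EuclideanSpace.volume_ball]
      simp
    _ = _ := by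
      rw [hconst, mul_assoc,
        lintegral_Ioi_comp_sq fun r ↦ ENNReal.ofReal (r ^ ((k : ℝ) / 2 - 1)) * h r,
        ← lintegral_const_mul _ (by fun_prop)]
      congr 1
      refine setLIntegral_congr_fun measurableSet_Ioi fun y (hy : 0 < y) ↦ ?_
      have hpow : y * (y ^ 2) ^ ((k : ℝ) / 2 - 1) = y ^ (k - 1) := by
        rw [← Real.rpow_natCast y 2, ← Real.rpow_mul hy.le, ← Real.rpow_natCast y (k - 1),
          Nat.cast_pred hk]
        nth_rewrite 1 [← Real.rpow_one y]
        rw [← Real.rpow_add hy]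
        congr 1
        push_cast
        ring
      rw [← mul_assoc, ← mul_assoc, ← ENNReal.ofReal_ofNat 2, ← ENNReal.ofReal_mul two_pos.le,
        ← ENNReal.ofReal_mul (by positivity), mul_assoc, hpow]

/-- Fubini for a product of lines along a splitting of the index set. -/
theorem lintegral_pi_sum {ι ι₁ ι₂ : Type*} [Fintype ι] [Fintype ι₁] [Fintype ι₂]
    (e : ι₁ ⊕ ι₂ ≃ ι) {F : (ι → ℝ) → ENNReal} (hF : Measurable F) :
    ∫⁻ z, F z = ∫⁻ u : ι₁ → ℝ, ∫⁻ y : ι₂ → ℝ, F (Sum.elim u y ∘ e.symm) := by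
  have hmp := (volume_measurePreserving_piCongrLeft (fun _ : ι ↦ ℝ) e).comp
    (volume_measurePreserving_sumPiEquivProdPi_symm fun _ : ι₁ ⊕ ι₂ ↦ ℝ)
  have heq : ∀ q : (ι₁ → ℝ) × (ι₂ → ℝ),
      (MeasurableEquiv.piCongrLeft (fun _ : ι ↦ ℝ) e)
        ((MeasurableEquiv.sumPiEquivProdPi fun _ : ι₁ ⊕ ι₂ ↦ ℝ).symm q) =
      Sum.elim q.1 q.2 ∘ e.symm := fun q ↦ by
    ext i
    obtain ⟨j, rfl⟩ := e.surjective i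
    rw [MeasurableEquiv.coe_piCongrLeft, Equiv.piCongrLeft_apply_apply]
    cases j <;> simp [MeasurableEquiv.coe_sumPiEquivProdPi_symm, Equiv.sumPiEquivProdPi]
  have hmeas : Measurable fun q : (ι₁ → ℝ) × (ι₂ → ℝ) ↦ F (Sum.elim q.1 q.2 ∘ e.symm) := by
    simp_rw [← heq]
    exact hF.comp hmp.measurable
  rw [← hmp.lintegral_comp hF, Measure.volume_eq_prod]
  simp only [Function.comp_apply, heq]
  exact lintegral_prod _ hmeas.aemeasurable

theorem lintegral_comp_mulVec {ι : Type*} [Fintype ι] [DecidableEq ι] {M : Matrix ι ι ℝ}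
    (hM : M.det ≠ 0) {F : (ι → ℝ) → ENNReal} (hF : Measurable F) :
    ∫⁻ x, F x = ENNReal.ofReal |M.det| * ∫⁻ z, F (M *ᵥ z) := by
  have h : ∫⁻ z, F (M *ᵥ z) = ENNReal.ofReal |M.det⁻¹| * ∫⁻ x, F x := by
    rw [← smul_eq_mul, ← lintegral_smul_measure, ← Real.map_matrix_volume_pi_eq_smul_volume_pi hM,
      lintegral_map hF (by fun_prop)]
    simp
  rw [h, ← mul_assoc, ← ENNReal.ofReal_mul (abs_nonneg _), ← abs_mul, mul_inv_cancel₀ hM]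
  simp

theorem exists_orthonormal_cols_transpose_mul_eq_zero {n p k : ℕ} (hn : n = p + k)
    (A : Matrix (Fin n) (Fin p) ℝ) :
    ∃ B : Matrix (Fin n) (Fin k) ℝ, Aᵀ * B = 0 ∧ Bᵀ * B = 1 := by
  let L : EuclideanSpace ℝ (Fin n) →ₗ[ℝ] (Fin p → ℝ) :=
    (Matrix.toLin' Aᵀ).comp (WithLp.linearEquiv 2 ℝ (Fin n → ℝ)).toLinearMap
  have hk : k ≤ Module.finrank ℝ L.ker := by
    have h1 := L.finrank_range_add_finrank_ker
    have h2 := L.range.finrank_le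
    simp only [finrank_euclideanSpace, Fintype.card_fin, Module.finrank_fin_fun] at h1 h2
    omega
  let b := stdOrthonormalBasis ℝ L.ker
  refine ⟨.of fun i j ↦ (b (Fin.castLE hk j) : EuclideanSpace ℝ (Fin n)) i, ?_, ?_⟩
  · ext i j
    exact congrFun (LinearMap.mem_ker.1 (b (Fin.castLE hk j)).2) i
  · ext i j
    have h := orthonormal_iff_ite.1 b.orthonormal (Fin.castLE hk j) (Fin.castLE hk i)
    simp only [Submodule.coe_inner, PiLp.inner_apply, (Fin.castLE_injective hk).eq_iff] at h
    simpa [mul_apply, one_apply, eq_comm] using h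

/-- Disintegration of Lebesgue measure on `ℝⁿ` along `x ↦ (Aᵀ x, x ⬝ᵥ x)`, for `A` of full column
rank, in the coordinates given by the columns of `A` and an orthonormal basis of the complement. -/
theorem lintegral_comp_transpose_mulVec_dotProduct {n p k : ℕ} (hn : n = p + k) (hk : 0 < k)
    (A : Matrix (Fin n) (Fin p) ℝ) (hA : (Aᵀ * A).PosDef)
    {g : (Fin p → ℝ) → ℝ → ENNReal} (hg : Measurable (Function.uncurry g)) :
    ∫⁻ x : Fin n → ℝ, g (Aᵀ *ᵥ x) (x ⬝ᵥ x) =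
      ENNReal.ofReal √(Aᵀ * A).det *
      (ENNReal.ofReal (Real.pi ^ ((k : ℝ) / 2) / Real.Gamma ((k : ℝ) / 2)) *
      ∫⁻ u : Fin p → ℝ, ∫⁻ r in Set.Ioi (0 : ℝ), ENNReal.ofReal (r ^ ((k : ℝ) / 2 - 1)) *
        g ((Aᵀ * A) *ᵥ u) (u ⬝ᵥ (Aᵀ * A) *ᵥ u + r)) := by
  subst hn
  obtain ⟨B, hAB, hBB⟩ := exists_orthonormal_cols_transpose_mul_eq_zero rfl A
  have hBA : Bᵀ * A = 0 := by simpa using congrArg transpose hAB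
  let e : Fin p ⊕ Fin k ≃ Fin (p + k) := finSumFinEquiv
  let N : Matrix (Fin (p + k)) (Fin (p + k)) ℝ := (fromCols A B).submatrix id e.symm
  have hNN : Nᵀ * N = (fromBlocks (Aᵀ * A) 0 0 1).submatrix e.symm e.symm := by
    have : (fromCols A B)ᵀ * fromCols A B = fromBlocks (Aᵀ * A) 0 0 1 := by
      rw [transpose_fromCols, fromRows_mul_fromCols, hAB, hBA, hBB]
    rw [← this, transpose_submatrix, ← submatrix_mul _ _ _ id _ Function.bijective_id]
  have hdet : N.det ^ 2 = (Aᵀ * A).det := by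
    have := congrArg det hNN
    rw [det_mul, det_transpose, det_submatrix_equiv_self, det_fromBlocks_zero₂₁, det_one,
      mul_one] at this
    rw [pow_two, this]
  have habs : |N.det| = √(Aᵀ * A).det := by rw [← hdet, Real.sqrt_sq_eq_abs]
  have hN0 : N.det ≠ 0 := fun h ↦ by
    have := hA.det_pos
    simp [← hdet, h] at this
  have hmul : ∀ u y, N *ᵥ (Sum.elim u y ∘ e.symm) = A *ᵥ u + B *ᵥ y := fun u y ↦ by
    rw [submatrix_mulVec_equiv, Function.comp_assoc]
    simp
  have hv : ∀ u y, Aᵀ *ᵥ (A *ᵥ u + B *ᵥ y) = (Aᵀ * A) *ᵥ u := fun u y ↦ by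
    simp [mulVec_add, mulVec_mulVec, hAB]
  have hs : ∀ u y, (A *ᵥ u + B *ᵥ y) ⬝ᵥ (A *ᵥ u + B *ᵥ y) =
      u ⬝ᵥ (Aᵀ * A) *ᵥ u + y ⬝ᵥ y := fun u y ↦ by
    have h : ∀ {q r : ℕ} (P : Matrix (Fin (p + k)) (Fin q) ℝ) (Q : Matrix (Fin (p + k)) (Fin r) ℝ)
        a b, (P *ᵥ a) ⬝ᵥ (Q *ᵥ b) = a ⬝ᵥ (Pᵀ * Q) *ᵥ b := fun P Q a b ↦ by
      rw [← mulVec_mulVec, dotProduct_mulVec a, vecMul_transpose]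
    simp only [add_dotProduct, dotProduct_add, h, hAB, hBA, hBB]
    simp
  have hF : Measurable fun x : Fin (p + k) → ℝ ↦ g (Aᵀ *ᵥ x) (x ⬝ᵥ x) := by
    refine hg.comp (.prodMk ?_ ?_)
    · exact (Continuous.matrix_mulVec continuous_const continuous_id).measurable
    · exact (Continuous.dotProduct continuous_id continuous_id).measurable
  rw [lintegral_comp_mulVec hN0 hF, habs, lintegral_pi_sum e]
  · simp only [hmul, hv, hs]
    congr 1
    rw [← lintegral_const_mul']
    · refine lintegral_congr fun u ↦ ?_
      exact lintegral_comp_dotProduct_self hk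
        (h := fun r ↦ g ((Aᵀ * A) *ᵥ u) (u ⬝ᵥ (Aᵀ * A) *ᵥ u + r))
        (hg.comp (measurable_const.prodMk (measurable_const.add measurable_id)))
    · exact ENNReal.ofReal_ne_top
  · exact hF.comp (Continuous.matrix_mulVec continuous_const continuous_id).measurable

instance matBorelSpace (n m : ℕ) : BorelSpace (Matrix (Fin n) (Fin m) ℝ) :=
  inferInstanceAs (BorelSpace (Fin n → Fin m → ℝ))

instance matSecondCountableTopology (n m : ℕ) :
    SecondCountableTopology (Matrix (Fin n) (Fin m) ℝ) :=
  inferInstanceAs (SecondCountableTopology (Fin n → Fin m → ℝ))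

instance matSigmaFinite (n m : ℕ) : SigmaFinite (volume : Measure (Matrix (Fin n) (Fin m) ℝ)) :=
  inferInstanceAs (SigmaFinite (volume : Measure (Fin n → Fin m → ℝ)))

/-- Append a last column to a matrix. -/
def snocCol {n m : ℕ} (X : Matrix (Fin n) (Fin m) ℝ) (x : Fin n → ℝ) :
    Matrix (Fin n) (Fin (m + 1)) ℝ :=
  .of fun i ↦ Fin.snoc (X i) (x i)

/-- The symmetric bordering `[[G, v], [vᵀ, s]]` of a square matrix. -/
def bordered {m : ℕ} (G : Matrix (Fin m) (Fin m) ℝ) (v : Fin m → ℝ) (s : ℝ) :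
    Matrix (Fin (m + 1)) (Fin (m + 1)) ℝ :=
  (fromBlocks G (replicateCol (Fin 1) v) (replicateRow (Fin 1) v)
    (.of fun _ _ ↦ s)).submatrix finSumFinEquiv.symm finSumFinEquiv.symm

section bordered

variable {m : ℕ} (G : Matrix (Fin m) (Fin m) ℝ) (v : Fin m → ℝ) (s : ℝ)

@[simp]
theorem bordered_castSucc_castSucc (i j : Fin m) :
    bordered G v s i.castSucc j.castSucc = G i j := by
  simp [bordered]

@[simp]
theorem bordered_castSucc_last (i : Fin m) : bordered G v s i.castSucc (Fin.last m) = v i := by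
  simp [bordered]

@[simp]
theorem bordered_last_castSucc (i : Fin m) : bordered G v s (Fin.last m) i.castSucc = v i := by
  simp [bordered]

@[simp]
theorem bordered_last_last : bordered G v s (Fin.last m) (Fin.last m) = s := by
  simp [bordered]

end bordered

theorem continuous_bordered {α : Type*} [TopologicalSpace α] {m : ℕ}
    {G : α → Matrix (Fin m) (Fin m) ℝ} {v : α → Fin m → ℝ} {s : α → ℝ} (hG : Continuous G)
    (hv : Continuous v) (hs : Continuous s) : Continuous fun a ↦ bordered (G a) (v a) (s a) :=
  (hG.matrix_fromBlocks hv.matrix_replicateCol hv.matrix_replicateRow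
    (continuous_matrix fun _ _ ↦ hs)).matrix_submatrix _ _

theorem continuous_snocCol {n m : ℕ} : Continuous
    fun q : Matrix (Fin n) (Fin m) ℝ × (Fin n → ℝ) ↦ snocCol q.1 q.2 := by
  refine continuous_matrix fun i j ↦ ?_
  refine Fin.lastCases ?_ (fun j ↦ ?_) j
  · simpa [snocCol] using (continuous_apply i).comp' continuous_snd
  · simpa [snocCol] using continuous_fst.matrix_elem i j

theorem transpose_snocCol_mul_self {n m : ℕ} (X : Matrix (Fin n) (Fin m) ℝ) (x : Fin n → ℝ) :
    (snocCol X x)ᵀ * snocCol X x = bordered (Xᵀ * X) (Xᵀ *ᵥ x) (x ⬝ᵥ x) := by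
  ext i j
  refine Fin.lastCases ?_ (fun i ↦ ?_) i <;> refine Fin.lastCases ?_ (fun j ↦ ?_) j <;>
    simp [mul_apply, snocCol, dotProduct, mulVec, mul_comm]

theorem lintegral_matrix_succ {n m : ℕ} {F : Matrix (Fin n) (Fin (m + 1)) ℝ → ENNReal}
    (hF : Measurable F) :
    ∫⁻ X, F X = ∫⁻ X : Matrix (Fin n) (Fin m) ℝ, ∫⁻ x : Fin n → ℝ, F (snocCol X x) := by
  have hmp := ((volume_measurePreserving_arrowProdEquivProdArrow ℝ (Fin m → ℝ) (Fin n)).comp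
    (volume_preserving_pi fun _ : Fin n ↦
      volume_preserving_piFinSuccAbove (fun _ : Fin (m + 1) ↦ ℝ) (Fin.last m)))
  have hmeas : Measurable fun q : (Fin n → ℝ) × Matrix (Fin n) (Fin m) ℝ ↦
      F (snocCol q.2 q.1) :=
    hF.comp (continuous_snocCol.comp continuous_swap).measurable
  have h := hmp.lintegral_comp hmeas
  rw [Measure.volume_eq_prod] at h
  refine Eq.trans ?_ (h.trans (lintegral_prod_symm' _ hmeas))
  refine lintegral_congr fun X ↦ congrArg F ?_
  ext i j
  refine Fin.lastCases ?_ (fun j ↦ ?_) j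
  · simp only [snocCol, of_apply, Fin.snoc_last]
    rfl
  · simp only [snocCol, of_apply, Fin.snoc_castSucc]
    exact congrArg (X i) (Fin.succAbove_last_apply j).symm

/-- The symmetric matrix with prescribed entries on and above the diagonal. -/
def symmOfUpper {m : ℕ} (f : {p : Fin m × Fin m // p.1 ≤ p.2} → ℝ) : Matrix (Fin m) (Fin m) ℝ :=
  .of fun i j ↦ if h : i ≤ j then f ⟨(i, j), h⟩ else f ⟨(j, i), le_of_not_ge h⟩

theorem symmVol_eq_map (m : ℕ) : symmVol m = Measure.map symmOfUpper volume := rfl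

theorem continuous_symmOfUpper {m : ℕ} : Continuous (symmOfUpper (m := m)) := by
  refine continuous_matrix fun i j ↦ ?_
  by_cases h : i ≤ j <;> simpa [symmOfUpper, h] using continuous_apply _

instance symmVol_sFinite (m : ℕ) : SFinite (symmVol m) := by
  rw [symmVol_eq_map]
  infer_instance

/-- The upper triangular positions of size `m + 1`: those of size `m`, and the last column. -/
noncomputable def upperSuccEquiv (m : ℕ) :
    {p : Fin m × Fin m // p.1 ≤ p.2} ⊕ (Fin m ⊕ Unit) ≃
      {p : Fin (m + 1) × Fin (m + 1) // p.1 ≤ p.2} :=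
  Equiv.ofBijective
    (Sum.elim (fun p ↦ ⟨(p.1.1.castSucc, p.1.2.castSucc), Fin.castSucc_le_castSucc_iff.2 p.2⟩)
      (Sum.elim (fun i ↦ ⟨(i.castSucc, Fin.last m), Fin.le_last _⟩)
        fun _ ↦ ⟨(Fin.last m, Fin.last m), le_rfl⟩)) <| by
    constructor
    · rintro (⟨⟨i, j⟩, h⟩ | i | _) (⟨⟨i', j'⟩, h'⟩ | i' | _) <;>
        simp +contextual [(Fin.castSucc_lt_last _).ne']
    · rintro ⟨⟨i, j⟩, h⟩
      induction i using Fin.lastCases with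
      | last =>
        obtain rfl := Fin.last_le_iff.1 h
        exact ⟨.inr (.inr ()), rfl⟩
      | cast i =>
        induction j using Fin.lastCases with
        | last => exact ⟨.inr (.inl i), rfl⟩
        | cast j => exact ⟨.inl ⟨(i, j), Fin.castSucc_le_castSucc_iff.1 h⟩, rfl⟩

theorem symmOfUpper_sumElim {m : ℕ} (w : {p : Fin m × Fin m // p.1 ≤ p.2} → ℝ) (v : Fin m → ℝ)
    (s : Unit → ℝ) :
    symmOfUpper (Sum.elim w (Sum.elim v s) ∘ (upperSuccEquiv m).symm) =
      bordered (symmOfUpper w) v (s ()) := by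
  have hw (p) : (upperSuccEquiv m).symm
      ⟨(p.1.1.castSucc, p.1.2.castSucc), Fin.castSucc_le_castSucc_iff.2 p.2⟩ = .inl p :=
    (Equiv.symm_apply_eq _).2 rfl
  have hv (i : Fin m) : (upperSuccEquiv m).symm ⟨(i.castSucc, Fin.last m), Fin.le_last _⟩ =
      .inr (.inl i) := (Equiv.symm_apply_eq _).2 rfl
  have hs : (upperSuccEquiv m).symm ⟨(Fin.last m, Fin.last m), le_rfl⟩ = .inr (.inr ()) :=
    (Equiv.symm_apply_eq _).2 rfl
  ext i j
  induction i using Fin.lastCases with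
  | last =>
    induction j using Fin.lastCases with
    | last => simp [symmOfUpper, hs]
    | cast j => simp [symmOfUpper, hv, Fin.last_le_iff, Fin.castSucc_ne_last]
  | cast i =>
    induction j using Fin.lastCases with
    | last => simp [symmOfUpper, hv, Fin.le_last]
    | cast j =>
      by_cases h : i ≤ j
      · simpa [symmOfUpper, h] using congrArg (Sum.elim w (Sum.elim v s)) (hw ⟨(i, j), h⟩)
      · simpa [symmOfUpper, h] using
          congrArg (Sum.elim w (Sum.elim v s)) (hw ⟨(j, i), le_of_not_ge h⟩)

theorem lintegral_symmVol_succ {m : ℕ} {F : Matrix (Fin (m + 1)) (Fin (m + 1)) ℝ → ENNReal}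
    (hF : Measurable F) :
    ∫⁻ S, F S ∂symmVol (m + 1) =
      ∫⁻ G, (∫⁻ v : Fin m → ℝ, ∫⁻ s : ℝ, F (bordered G v s)) ∂symmVol m := by
  have hcont : Continuous fun q : (Matrix (Fin m) (Fin m) ℝ × (Fin m → ℝ)) × ℝ ↦
      bordered q.1.1 q.1.2 q.2 :=
    continuous_bordered (by fun_prop) (by fun_prop) (by fun_prop)
  have hmeas : Measurable fun G : Matrix (Fin m) (Fin m) ℝ ↦
      ∫⁻ v : Fin m → ℝ, ∫⁻ s : ℝ, F (bordered G v s) := by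
    have h := hF.comp hcont.measurable
    exact h.lintegral_prod_right'.lintegral_prod_right'
  rw [symmVol_eq_map, symmVol_eq_map, lintegral_map hF continuous_symmOfUpper.measurable,
    lintegral_map hmeas continuous_symmOfUpper.measurable, lintegral_pi_sum (upperSuccEquiv m)
      (F := fun z ↦ F (symmOfUpper z)) (hF.comp continuous_symmOfUpper.measurable)]
  refine lintegral_congr fun w ↦ ?_
  rw [lintegral_pi_sum (Equiv.refl (Fin m ⊕ Unit))]
  · refine lintegral_congr fun v ↦ ?_
    rw [← (volume_preserving_funUnique Unit ℝ).lintegral_comp]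
    · refine lintegral_congr fun s ↦ ?_
      exact congrArg F (symmOfUpper_sumElim w v s)
    · exact hF.comp (continuous_bordered (by fun_prop) (by fun_prop) (by fun_prop)).measurable
  · refine hF.comp (continuous_symmOfUpper.measurable.comp (measurable_pi_iff.2 fun p ↦ ?_))
    rcases h : (upperSuccEquiv m).symm p with q | q <;>
      simp [h, measurable_pi_apply]

theorem isClosed_setOf_posSemidef (m : ℕ) :
    IsClosed {S : Matrix (Fin m) (Fin m) ℝ | S.PosSemidef} := by
  simp only [posSemidef_iff_dotProduct_mulVec, Set.ofPred_and, Set.ofPred_forall]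
  refine .inter (isClosed_eq (by fun_prop) continuous_id) (isClosed_iInter fun x ↦ ?_)
  exact isClosed_le continuous_const (by fun_prop)

theorem measurableSet_setOf_posDef (m : ℕ) :
    MeasurableSet {S : Matrix (Fin m) (Fin m) ℝ | S.PosDef} := by
  have : {S : Matrix (Fin m) (Fin m) ℝ | S.PosDef} =
      {S | S.PosSemidef} ∩ {S | S.det ≠ 0} := by
    ext S
    exact ⟨fun h ↦ ⟨h.posSemidef, h.det_pos.ne'⟩, fun h ↦ h.1.posDef_iff_det_ne_zero.2 h.2⟩
  rw [this]
  exact (isClosed_setOf_posSemidef m).measurableSet.inter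
    (isOpen_ne_fun continuous_id.matrix_det continuous_const).measurableSet

theorem measurable_indicator_posDef_mul_det_rpow {m : ℕ} {f : Matrix (Fin m) (Fin m) ℝ → ENNReal}
    (hf : Measurable f) (a : ℝ) :
    Measurable ({S : Matrix (Fin m) (Fin m) ℝ | S.PosDef}.indicator
      fun S ↦ f S * ENNReal.ofReal (S.det ^ a)) :=
  (hf.mul (continuous_id.matrix_det.measurable.pow_const a).ennreal_ofReal).indicator
    (measurableSet_setOf_posDef m)

theorem measurable_transpose_mul_self {n m : ℕ} :
    Measurable fun X : Matrix (Fin n) (Fin m) ℝ ↦ Xᵀ * X :=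
  (continuous_id.matrix_transpose.matrix_mul continuous_id).measurable

theorem Matrix.PosDef.of_bordered {m : ℕ} {G : Matrix (Fin m) (Fin m) ℝ} {v : Fin m → ℝ} {s : ℝ}
    (h : (bordered G v s).PosDef) : G.PosDef := by
  convert h.submatrix (Fin.castSucc_injective m)
  ext i j
  simp

section posDef

variable {m : ℕ} {G : Matrix (Fin m) (Fin m) ℝ}

theorem schur_complement_bordered_mulVec (hG : G.PosDef) (u : Fin m → ℝ) (r : ℝ) :
    (Matrix.of fun _ _ ↦ u ⬝ᵥ G *ᵥ u + r : Matrix (Fin 1) (Fin 1) ℝ) -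
      replicateRow (Fin 1) (G *ᵥ u) * G⁻¹ * replicateCol (Fin 1) (G *ᵥ u) =
      .of fun _ _ ↦ r := by
  have hu : IsUnit G.det := hG.det_pos.ne'.isUnit
  rw [replicateCol_mulVec, Matrix.mul_assoc, nonsing_inv_mul_cancel_left _ _ hu]
  ext i j
  simp [mul_apply, dotProduct, mul_comm]

theorem det_bordered_mulVec (hG : G.PosDef) (u : Fin m → ℝ) (r : ℝ) :
    (bordered G (G *ᵥ u) (u ⬝ᵥ G *ᵥ u + r)).det = G.det * r := by
  let _ := invertibleOfIsUnitDet G hG.det_pos.ne'.isUnit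
  rw [bordered, det_submatrix_equiv_self, det_fromBlocks₁₁, invOf_eq_nonsing_inv,
    schur_complement_bordered_mulVec hG, det_fin_one, of_apply]

theorem posDef_bordered_mulVec_iff (hG : G.PosDef) (u : Fin m → ℝ) (r : ℝ) :
    (bordered G (G *ᵥ u) (u ⬝ᵥ G *ᵥ u + r)).PosDef ↔ 0 < r := by
  refine ⟨fun h ↦ ?_, fun hr ↦ ?_⟩
  · have := h.det_pos
    rw [det_bordered_mulVec hG] at this
    exact pos_of_mul_pos_right this hG.det_pos.le
  · let _ := invertibleOfIsUnitDet G hG.det_pos.ne'.isUnit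
    refine (PosSemidef.posDef_iff_det_ne_zero ?_).2 ?_
    · refine PosSemidef.submatrix ?_ _
      have h := PosDef.fromBlocks₁₁ (replicateCol (Fin 1) (G *ᵥ u))
        (.of fun _ _ ↦ u ⬝ᵥ G *ᵥ u + r) hG
      rw [conjTranspose_replicateCol, star_trivial, schur_complement_bordered_mulVec hG] at h
      refine h.2 (PosSemidef.of_dotProduct_mulVec_nonneg ?_ fun x ↦ ?_)
      · ext i j
        simp
      · simp only [dotProduct, mulVec, Fin.sum_univ_one, of_apply, star_trivial]
        nlinarith [mul_nonneg hr.le (mul_self_nonneg (x 0))]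
    · rw [det_bordered_mulVec hG]
      exact (mul_pos hG.det_pos hr).ne'

theorem lintegral_posDef_bordered (hG : G.PosDef) {a : ℝ}
    {f : Matrix (Fin (m + 1)) (Fin (m + 1)) ℝ → ENNReal} (hf : Measurable f) :
    ∫⁻ v : Fin m → ℝ, ∫⁻ s : ℝ, {S : Matrix (Fin (m + 1)) (Fin (m + 1)) ℝ | S.PosDef}.indicator
        (fun S ↦ f S * ENNReal.ofReal (S.det ^ a)) (bordered G v s) =
      ENNReal.ofReal (G.det ^ (1 + a)) * ∫⁻ u : Fin m → ℝ, ∫⁻ r in Set.Ioi (0 : ℝ),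
        ENNReal.ofReal (r ^ a) * f (bordered G (G *ᵥ u) (u ⬝ᵥ G *ᵥ u + r)) := by
  have hdet := hG.det_pos
  have hmeas := measurable_indicator_posDef_mul_det_rpow hf a
  have hcont : Continuous fun q : (Fin m → ℝ) × ℝ ↦ bordered G q.1 q.2 :=
    continuous_bordered (by fun_prop) (by fun_prop) (by fun_prop)
  have hinner := (hmeas.comp hcont.measurable).lintegral_prod_right' (ν := volume)
  simp only [Function.comp_def] at hinner
  rw [lintegral_comp_mulVec hdet.ne' hinner,
    abs_of_pos hdet, Real.rpow_add hdet, Real.rpow_one, ENNReal.ofReal_mul hdet.le, mul_assoc]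
  congr 1
  rw [← lintegral_const_mul' _ _ ENNReal.ofReal_ne_top]
  refine lintegral_congr fun u ↦ ?_
  rw [← lintegral_const_mul' _ _ ENNReal.ofReal_ne_top, ← lintegral_indicator measurableSet_Ioi,
    ← lintegral_add_left_eq_self _ (u ⬝ᵥ G *ᵥ u)]
  refine lintegral_congr fun r ↦ ?_
  have hmem : bordered G (G *ᵥ u) (u ⬝ᵥ G *ᵥ u + r) ∈
      {S : Matrix (Fin (m + 1)) (Fin (m + 1)) ℝ | S.PosDef} ↔ r ∈ Set.Ioi 0 :=
    posDef_bordered_mulVec_iff hG u r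
  by_cases hr : r ∈ Set.Ioi 0
  · rw [Set.indicator_of_mem hr, Set.indicator_of_mem (hmem.2 hr), det_bordered_mulVec hG,
      Real.mul_rpow hdet.le (le_of_lt hr), ENNReal.ofReal_mul (by positivity)]
    ring
  · rw [Set.indicator_of_notMem hr, Set.indicator_of_notMem (mt hmem.1 hr)]

end posDef

theorem mvGamma_pos {m : ℕ} {a : ℝ} (ha : ((m : ℝ) - 1) / 2 < a) : 0 < mvGamma m a := by
  refine mul_pos (Real.rpow_pos_of_pos pi_pos _)
    (Finset.prod_pos fun i _ ↦ Real.Gamma_pos_of_pos ?_)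
  have : ((i : ℕ) : ℝ) + 1 ≤ m := by exact_mod_cast i.2
  linarith

/-- Adding a column multiplies `π^{mn/2} / Γ_m(n/2)` by `π^{k/2} / Γ(k/2)`, where `k = n - m`. -/
theorem pi_rpow_div_mvGamma_succ {m k : ℕ} (hk : 0 < k) :
    π ^ (((m * (m + k) : ℕ) : ℝ) / 2) / mvGamma m (((m + k : ℕ) : ℝ) / 2) *
        (π ^ ((k : ℝ) / 2) / Real.Gamma ((k : ℝ) / 2)) =
      π ^ ((((m + 1) * (m + k) : ℕ) : ℝ) / 2) / mvGamma (m + 1) (((m + k : ℕ) : ℝ) / 2) := by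
  have hexp : π ^ ((((m + 1) * (m + k) : ℕ) : ℝ) / 2) * π ^ (((m * (m - 1) : ℕ) : ℝ) / 4) =
      π ^ (((m * (m + k) : ℕ) : ℝ) / 2) * π ^ ((k : ℝ) / 2) *
        π ^ ((((m + 1) * (m + 1 - 1) : ℕ) : ℝ) / 4) := by
    simp only [← Real.rpow_add pi_pos]
    congr 1
    rcases m with _ | m
    · simp
    · push_cast [Nat.add_sub_cancel]
      ring
  have hlast : ((m + k : ℕ) : ℝ) / 2 - ((Fin.last m : ℕ) : ℝ) / 2 = (k : ℝ) / 2 := by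
    push_cast [Fin.val_last]
    ring
  have hk' : (0 : ℝ) < k := by exact_mod_cast hk
  have hΓ : Real.Gamma ((k : ℝ) / 2) ≠ 0 := (Real.Gamma_pos_of_pos (by positivity)).ne'
  have hprod : ∏ i : Fin m, Real.Gamma (((m + k : ℕ) : ℝ) / 2 - (i : ℝ) / 2) ≠ 0 := by
    refine Finset.prod_ne_zero_iff.2 fun i _ ↦ (Real.Gamma_pos_of_pos ?_).ne'
    have : ((i : ℕ) : ℝ) < m := by exact_mod_cast i.2
    push_cast
    linarith
  rw [mvGamma, mvGamma, Fin.prod_univ_castSucc, hlast, div_mul_div_comm, div_eq_div_iff]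
  · simp only [Fin.val_castSucc]
    linear_combination -(∏ i : Fin m, Real.Gamma (((m + k : ℕ) : ℝ) / 2 - (i : ℝ) / 2)) *
      Real.Gamma ((k : ℝ) / 2) * hexp
  · positivity
  · simp only [Fin.val_castSucc]
    positivity

/-- The pushforward of Lebesgue measure on `n × m` matrices under `X ↦ Xᵀ X`. -/
theorem lintegral_transpose_mul_self {n m : ℕ} (hmn : m ≤ n)
    {f : Matrix (Fin m) (Fin m) ℝ → ENNReal} (hf : Measurable f) :
    ∫⁻ X : Matrix (Fin n) (Fin m) ℝ, f (Xᵀ * X) =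
      ENNReal.ofReal (π ^ (((m * n : ℕ) : ℝ) / 2) / mvGamma m ((n : ℝ) / 2)) *
        ∫⁻ S in {S : Matrix (Fin m) (Fin m) ℝ | S.PosDef},
          f S * ENNReal.ofReal (S.det ^ (((n : ℝ) - (m : ℝ) - 1) / 2)) ∂(symmVol m) := by
  induction m with
  | zero =>
    have hvol : volume (Set.univ : Set (Matrix (Fin n) (Fin 0) ℝ)) = 1 := by
      change volume (Set.univ : Set (Fin n → Fin 0 → ℝ)) = 1
      simp [volume_pi, Measure.pi_univ]
    have hsymm : symmVol 0 Set.univ = 1 := by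
      rw [symmVol_eq_map, Measure.map_apply continuous_symmOfUpper.measurable .univ]
      simp [volume_pi]
    have hpos : {S : Matrix (Fin 0) (Fin 0) ℝ | S.PosDef} = Set.univ :=
      Set.eq_univ_of_forall fun S ↦ Subsingleton.elim (1 : Matrix (Fin 0) (Fin 0) ℝ) S ▸ .one
    have hconst (S : Matrix (Fin 0) (Fin 0) ℝ) : f S = f 0 := congrArg f (Subsingleton.elim _ _)
    simp [hpos, hconst, hvol, hsymm, mvGamma]
  | succ m ih =>
    obtain ⟨k, rfl⟩ := Nat.exists_eq_add_of_le ((Nat.le_succ m).trans hmn)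
    have hk : 0 < k := by omega
    have hk' : (0 : ℝ) < k := by exact_mod_cast hk
    have hae : ∀ᵐ X : Matrix (Fin (m + k)) (Fin m) ℝ, (Xᵀ * X).PosDef := by
      have hmeas : Measurable ({S : Matrix (Fin m) (Fin m) ℝ | S.PosDef}ᶜ.indicator
          (1 : Matrix (Fin m) (Fin m) ℝ → ENNReal)) :=
        measurable_one.indicator (measurableSet_setOf_posDef m).compl
      have h := ih (by omega) hmeas
      rw [setLIntegral_congr_fun (g := 0) (measurableSet_setOf_posDef m) fun S hS ↦ by
          simp [Set.indicator_of_notMem (Set.notMem_compl_iff.2 hS)]] at h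
      simp only [Pi.zero_apply, lintegral_zero, mul_zero] at h
      replace h := (lintegral_eq_zero_iff (hmeas.comp measurable_transpose_mul_self)).1 h
      filter_upwards [h] with X hX
      by_contra hX'
      simp [hX'] at hX
    have hcont : Continuous fun q : (Matrix (Fin m) (Fin m) ℝ × (Fin m → ℝ)) × ℝ ↦
        bordered q.1.1 (q.1.1 *ᵥ q.1.2) (q.1.2 ⬝ᵥ q.1.1 *ᵥ q.1.2 + q.2) :=
      continuous_bordered (by fun_prop) (by fun_prop) (by fun_prop)
    let I : Matrix (Fin m) (Fin m) ℝ → ENNReal := fun G ↦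
      ∫⁻ u : Fin m → ℝ, ∫⁻ r in Set.Ioi (0 : ℝ), ENNReal.ofReal (r ^ ((k : ℝ) / 2 - 1)) *
        f (bordered G (G *ᵥ u) (u ⬝ᵥ G *ᵥ u + r))
    have hI : Measurable I := by
      have h : Measurable fun q : (Matrix (Fin m) (Fin m) ℝ × (Fin m → ℝ)) × ℝ ↦
          ENNReal.ofReal (q.2 ^ ((k : ℝ) / 2 - 1)) *
            f (bordered q.1.1 (q.1.1 *ᵥ q.1.2) (q.1.2 ⬝ᵥ q.1.1 *ᵥ q.1.2 + q.2)) :=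
        (by fun_prop : Measurable _).mul (hf.comp hcont.measurable)
      exact h.lintegral_prod_right'.lintegral_prod_right'
    let c : ENNReal := ENNReal.ofReal (π ^ ((k : ℝ) / 2) / Real.Gamma ((k : ℝ) / 2))
    have hH : Measurable fun G : Matrix (Fin m) (Fin m) ℝ ↦ ENNReal.ofReal √G.det * (c * I G) :=
      (continuous_id.matrix_det.measurable.sqrt.ennreal_ofReal).mul (hI.const_mul c)
    have hLHS : ∫⁻ X : Matrix (Fin (m + k)) (Fin (m + 1)) ℝ, f (Xᵀ * X) =
        ∫⁻ X : Matrix (Fin (m + k)) (Fin m) ℝ, ENNReal.ofReal √(Xᵀ * X).det * (c * I (Xᵀ * X)) := by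
      rw [lintegral_matrix_succ (F := fun X ↦ f (Xᵀ * X)) (hf.comp measurable_transpose_mul_self)]
      refine lintegral_congr_ae (hae.mono fun X hX ↦ ?_)
      simp only [transpose_snocCol_mul_self]
      refine lintegral_comp_transpose_mulVec_dotProduct rfl hk X hX
        (g := fun v s ↦ f (bordered (Xᵀ * X) v s)) (hf.comp (Continuous.measurable ?_))
      exact continuous_bordered continuous_const continuous_fst continuous_snd
    have hexp : ((m + k : ℕ) - (m + 1 : ℕ) - 1 : ℝ) / 2 = k / 2 - 1 := by
      push_cast
      ring
    have hexp' : ((m + k : ℕ) - m - 1 : ℝ) / 2 + 1 / 2 = 1 + (k / 2 - 1 : ℝ) := by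
      push_cast
      ring
    have hmeas : Measurable ({S : Matrix (Fin (m + 1)) (Fin (m + 1)) ℝ | S.PosDef}.indicator
        fun S ↦ f S * ENNReal.ofReal (S.det ^ ((k : ℝ) / 2 - 1))) :=
      measurable_indicator_posDef_mul_det_rpow hf _
    rw [hLHS, ih (by omega) hH, ← pi_rpow_div_mvGamma_succ hk, hexp,
      ENNReal.ofReal_mul (div_nonneg (by positivity) (mvGamma_pos (by push_cast; linarith only [hk'])).le),
      mul_assoc, ← lintegral_indicator (measurableSet_setOf_posDef _),
      ← lintegral_indicator (measurableSet_setOf_posDef _), lintegral_symmVol_succ hmeas]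
    congr 1
    rw [← lintegral_const_mul' _ _ ENNReal.ofReal_ne_top]
    refine lintegral_congr fun G ↦ ?_
    by_cases hG : G.PosDef
    · rw [Set.indicator_of_mem (by exact hG), lintegral_posDef_bordered hG hf, ← hexp',
        Real.rpow_add hG.det_pos, ← Real.sqrt_eq_rpow,
        ENNReal.ofReal_mul (Real.rpow_nonneg hG.det_pos.le _)]
      ring
    · rw [Set.indicator_of_notMem (by exact hG)]
      have hnot (v s) : bordered G v s ∉
          {S : Matrix (Fin (m + 1)) (Fin (m + 1)) ℝ | S.PosDef} := fun h ↦ hG h.of_bordered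
      simp [Set.indicator_of_notMem (hnot _ _)]

/-- for every measurable `f : Sym_m(ℝ) → [0,∞]`,
`∫ f(XᵀX) dX = (π^{mn/2}/Γ_m(n/2)) ∫_{S > 0} f(S) det(S)^{(n-m-1)/2} dS`. -/
theorem stmt_2 (n m : ℕ) (hm : 1 ≤ m) (hmn : m ≤ n)
    (f : Matrix (Fin m) (Fin m) ℝ → ENNReal) (hf : Measurable f) :
    ∫⁻ X : Matrix (Fin n) (Fin m) ℝ, f (Xᵀ * X) =
      ENNReal.ofReal (Real.pi ^ (((m * n : ℕ) : ℝ) / 2) / mvGamma m ((n : ℝ) / 2)) *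
        ∫⁻ S in {S : Matrix (Fin m) (Fin m) ℝ | S.PosDef},
          f S * ENNReal.ofReal (S.det ^ (((n : ℝ) - (m : ℝ) - 1) / 2)) ∂(symmVol m) := by
  exact lintegral_transpose_mul_self hmn hf
end

section
/- Let n ≥ m ≥ 1. For every measurable function h : ℝ^m → [0, ∞], one has ∫_{X ∈ ℝ^{n×m}} h(σ₁(X), …, σ_m(X)) dX = c · ∫_{α₁ > α₂ > ⋯ > α_m > 0} h(α₁, …, α_m) · ∏_{i=1}^m α_i^{n−m} · ∏_{1 ≤ i < j ≤ m} (α_i² − α_j²) dα₁ ⋯ dα_m, where c = 2^m π^{(mn+m²)/2} / (Γ_m(n/2) Γ_m(m/2)). -/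
open MeasureTheory Matrix Real

/-- The eigenvalues of a real symmetric matrix in decreasing order (zero for other matrices). -/
noncomputable def eigs {m : ℕ} (A : Matrix (Fin m) (Fin m) ℝ) : Fin m → ℝ :=
  open Classical in
  if h : A.IsHermitian then fun i => (h.eigenvalues ∘ Tuple.sort h.eigenvalues) (Fin.rev i) else 0

theorem sortedEigs_eq_eigs {n m : ℕ} (X : Matrix (Fin n) (Fin m) ℝ) :
    sortedEigs X = eigs (Xᵀ * X) := by
  have h : (Xᵀ * X).IsHermitian := by
    rw [← conjTranspose_eq_transpose_of_trivial]; exact isHermitian_conjTranspose_mul_self X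
  simp only [eigs, h, dif_pos]
  rfl

theorem eigs_antitone {m : ℕ} (A : Matrix (Fin m) (Fin m) ℝ) : Antitone (eigs A) := by
  unfold eigs
  split_ifs with h
  · exact fun i j hij => Tuple.monotone_sort h.eigenvalues (Fin.rev_le_rev.2 hij)
  · exact fun _ _ _ => le_rfl

theorem charpoly_eq_prod_eigs {m : ℕ} {A : Matrix (Fin m) (Fin m) ℝ} (h : A.IsHermitian) :
    A.charpoly = ∏ i, (Polynomial.X - Polynomial.C (eigs A i)) := by
  rw [h.charpoly_eq]
  simp only [eigs, h, dif_pos]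
  exact (Equiv.prod_comp (Fin.revPerm.trans (Tuple.sort h.eigenvalues))
    fun i => Polynomial.X - Polynomial.C (h.eigenvalues i)).symm

theorem eq_of_antitone_of_prod_eq {m : ℕ} {a b : Fin m → ℝ} (ha : Antitone a) (hb : Antitone b)
    (h : ∏ i, (Polynomial.X - Polynomial.C (a i)) = ∏ i, (Polynomial.X - Polynomial.C (b i))) :
    a = b := by
  have key : Multiset.map a Finset.univ.val = Multiset.map b Finset.univ.val := by
    have hmap : ∀ c : Fin m → ℝ,
        Finset.univ.val.map (fun i => Polynomial.X - Polynomial.C (c i)) =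
          (Finset.univ.val.map c).map (fun x => Polynomial.X - Polynomial.C x) := fun c => by
      rw [Multiset.map_map]; rfl
    have := congrArg Polynomial.roots h
    simpa only [Finset.prod_eq_multiset_prod, hmap,
      Polynomial.roots_multiset_prod_X_sub_C] using this
  rw [Fin.univ_val_map, Fin.univ_val_map, Multiset.coe_eq_coe] at key
  have ha' : (List.ofFn a).Pairwise (· ≥ ·) := List.pairwise_ofFn.2 fun i j hij => ha hij.le
  have hb' : (List.ofFn b).Pairwise (· ≥ ·) := List.pairwise_ofFn.2 fun i j hij => hb hij.le
  exact List.ofFn_injective (key.eq_of_pairwise' ha' hb')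

theorem eigs_eq_of_charpoly {m : ℕ} {A : Matrix (Fin m) (Fin m) ℝ} (hA : A.IsHermitian)
    {a : Fin m → ℝ} (ha : Antitone a)
    (h : A.charpoly = ∏ i, (Polynomial.X - Polynomial.C (a i))) : eigs A = a :=
  eq_of_antitone_of_prod_eq (eigs_antitone A) ha (by rw [← charpoly_eq_prod_eigs hA, h])

theorem eigs_congr {m : ℕ} {A B : Matrix (Fin m) (Fin m) ℝ} (hA : A.IsHermitian)
    (hB : B.IsHermitian) (h : A.charpoly = B.charpoly) : eigs A = eigs B :=
  eigs_eq_of_charpoly hA (eigs_antitone B) (by rw [h, charpoly_eq_prod_eigs hB])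

theorem det_eq_prod_eigs {m : ℕ} {A : Matrix (Fin m) (Fin m) ℝ} (h : A.IsHermitian) :
    A.det = ∏ i, eigs A i := by
  rw [h.det_eq_prod_eigenvalues]
  simp only [eigs, h, dif_pos]
  exact (Equiv.prod_comp (Fin.revPerm.trans (Tuple.sort h.eigenvalues)) h.eigenvalues).symm

theorem exists_orthogonal_diagonal_eigs {m : ℕ} {A : Matrix (Fin m) (Fin m) ℝ}
    (h : A.IsHermitian) :
    ∃ Q : Matrix (Fin m) (Fin m) ℝ, Qᵀ * Q = 1 ∧ A = Q * diagonal (eigs A) * Qᵀ := by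
  set e := Fin.revPerm.trans (Tuple.sort h.eigenvalues)
  set U : Matrix (Fin m) (Fin m) ℝ := h.eigenvectorUnitary.1
  have hU : Uᵀ * U = 1 := by
    have := Unitary.coe_star_mul_self h.eigenvectorUnitary
    rwa [star_eq_conjTranspose, conjTranspose_eq_transpose_of_trivial] at this
  have hd : diagonal (eigs A) = (diagonal h.eigenvalues).submatrix e e := by
    rw [submatrix_diagonal_equiv]
    simp only [eigs, h, dif_pos]
    rfl
  refine ⟨U.submatrix id e, ?_, ?_⟩
  · rw [transpose_submatrix, submatrix_mul _ _ _ id _ Function.bijective_id |>.symm, hU,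
      submatrix_one_equiv]
  · rw [hd, transpose_submatrix, submatrix_mul_equiv, submatrix_mul_equiv]
    have := h.spectral_theorem
    rw [Unitary.conjStarAlgAut_apply, star_eq_conjTranspose,
      conjTranspose_eq_transpose_of_trivial] at this
    exact this

theorem eval_charpoly_eq_det {m : ℕ} (A : Matrix (Fin m) (Fin m) ℝ) (t : ℝ) :
    A.charpoly.eval t = (scalar (Fin m) t - A).det := eval_charpoly A t

/-- Monic polynomials of degree `m` are determined by `m` values. -/
theorem prod_X_sub_C_eq_of_eval {m : ℕ} {p q : Polynomial ℝ} (hp : p.Monic) (hq : q.Monic)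
    (hpm : p.natDegree = m) (hqm : q.natDegree = m) {x : Fin m → ℝ} (hx : Function.Injective x)
    (h : ∀ i, p.eval (x i) = q.eval (x i)) : p = q := by
  have hd : (p - q).degree < m := by
    rcases Nat.eq_zero_or_pos m with rfl | hm
    · rw [hp.natDegree_eq_zero.1 hpm, hq.natDegree_eq_zero.1 hqm]; simp
    · rw [← hpm, ← Polynomial.degree_eq_natDegree hp.ne_zero]
      exact Polynomial.degree_sub_lt_left (by
        rw [Polynomial.degree_eq_natDegree hp.ne_zero, Polynomial.degree_eq_natDegree hq.ne_zero,
          hpm, hqm]) hp.ne_zero (by rw [hp.leadingCoeff, hq.leadingCoeff])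
  refine sub_eq_zero.1 (Polynomial.eq_zero_of_degree_lt_of_eval_finset_eq_zero
    (Finset.univ.image x) ?_ ?_)
  · rwa [Finset.card_image_of_injective _ hx, Finset.card_univ, Fintype.card_fin]
  · simp [h]

theorem monic_prod_X_sub_C' {m : ℕ} (a : Fin m → ℝ) :
    (∏ i, (Polynomial.X - Polynomial.C (a i))).Monic :=
  Polynomial.monic_prod_of_monic _ _ fun _ _ => Polynomial.monic_X_sub_C _

theorem natDegree_prod_X_sub_C' {m : ℕ} (a : Fin m → ℝ) :
    (∏ i, (Polynomial.X - Polynomial.C (a i))).natDegree = m := by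
  simp

theorem measurable_eigs_comp {α : Type*} [MeasurableSpace α] {m : ℕ}
    {A : α → Matrix (Fin m) (Fin m) ℝ} (hA : ∀ i j, Measurable fun x => A x i j)
    (hH : ∀ x, (A x).IsHermitian) : Measurable fun x => eigs (A x) := by
  set S : Set (Fin m → ℝ) := {a | Antitone a}
  have hS : IsClosed S := by
    have : S = ⋂ i, ⋂ j, ⋂ (_ : i ≤ j), {a : Fin m → ℝ | a j ≤ a i} := by
      ext a; simp [S, Antitone]
    rw [this]
    exact isClosed_iInter fun i => isClosed_iInter fun j => isClosed_iInter fun _ =>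
      isClosed_le (continuous_apply j) (continuous_apply i)
  have : PolishSpace S := hS.polishSpace
  let P : S → (Fin m → ℝ) := fun a k => ∏ i, ((k : ℝ) - a.1 i)
  have hP : Continuous P := by
    exact continuous_pi fun k => continuous_finsetProd _ fun i _ =>
      continuous_const.sub ((continuous_apply i).comp continuous_subtype_val)
  have hinj : Function.Injective P := by
    intro a b hab
    apply Subtype.ext
    apply eq_of_antitone_of_prod_eq a.2 b.2
    refine prod_X_sub_C_eq_of_eval (monic_prod_X_sub_C' _) (monic_prod_X_sub_C' _)
      (natDegree_prod_X_sub_C' _) (natDegree_prod_X_sub_C' _) (x := fun k : Fin m => (k : ℝ))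
      (fun i j h => Fin.ext (Nat.cast_injective (R := ℝ) h)) fun k => ?_
    simpa [Polynomial.eval_prod] using congrFun hab k
  have hemb := hP.measurable.measurableEmbedding hinj
  have : Measurable fun x => (⟨eigs (A x), eigs_antitone _⟩ : S) := by
    rw [← hemb.measurable_comp_iff]
    refine measurable_pi_lambda _ fun k => ?_
    have : ∀ x, (P ∘ fun x => (⟨eigs (A x), eigs_antitone _⟩ : S)) x k
        = (scalar (Fin m) (k : ℝ) - A x).det := fun x => by
      rw [← eval_charpoly_eq_det, charpoly_eq_prod_eigs (hH x)]
      simp [P, Polynomial.eval_prod]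
    simp only [this, det_apply]
    refine Finset.measurable_sum _ fun σ _ => ?_
    refine Measurable.const_smul (Finset.measurable_prod _ fun i _ => ?_) _
    simp only [Matrix.sub_apply]
    exact measurable_const.sub (hA _ _)
  exact measurable_subtype_coe.comp this

theorem isHermitian_add_vecMulVec {m : ℕ} {A : Matrix (Fin m) (Fin m) ℝ}
    (hA : A.IsHermitian) (v : Fin m → ℝ) : (A + vecMulVec v v).IsHermitian := by
  refine hA.add ?_
  ext i j
  simp [vecMulVec_apply, mul_comm]

theorem isHermitian_diagonal_real {m : ℕ} (a : Fin m → ℝ) : (diagonal a).IsHermitian :=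
  isHermitian_diagonal a

theorem measurePreserving_mulVec {m : ℕ} {Q : Matrix (Fin m) (Fin m) ℝ} (hQ : |Q.det| = 1) :
    MeasurePreserving (fun v : Fin m → ℝ => Q *ᵥ v) volume volume := by
  refine ⟨by fun_prop, ?_⟩
  have h := Real.map_matrix_volume_pi_eq_smul_volume_pi (M := Q)
    (fun h0 => by rw [h0, abs_zero] at hQ; exact zero_ne_one hQ)
  rw [abs_inv, hQ, inv_one, ENNReal.ofReal_one, one_smul] at h
  exact h

theorem measurable_eigs_add_vecMulVec {α : Type*} [MeasurableSpace α] {m : ℕ}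
    {A : α → Matrix (Fin m) (Fin m) ℝ} {v : α → Fin m → ℝ} (hA : ∀ i j, Measurable fun x => A x i j)
    (hH : ∀ x, (A x).IsHermitian) (hv : Measurable v) :
    Measurable fun x => eigs (A x + vecMulVec (v x) (v x)) := by
  refine measurable_eigs_comp (fun i j => ?_)
    fun x => isHermitian_add_vecMulVec (hH x) _
  simp only [Matrix.add_apply, vecMulVec_apply]
  exact (hA i j).add (((measurable_pi_apply i).comp hv).mul ((measurable_pi_apply j).comp hv))

/-- By rotation invariance, integrating over a random rank-one perturbation of a symmetric matrix
only depends on the eigenvalues of this matrix. -/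
theorem lintegral_eigs_add_vecMulVec {m : ℕ} {A : Matrix (Fin m) (Fin m) ℝ} (hA : A.IsHermitian)
    {f : (Fin m → ℝ) → ENNReal} (hf : Measurable f) :
    ∫⁻ v : Fin m → ℝ, f (eigs (A + vecMulVec v v)) =
      ∫⁻ v : Fin m → ℝ, f (eigs (diagonal (eigs A) + vecMulVec v v)) := by
  obtain ⟨Q, hQ, hAQ⟩ := exists_orthogonal_diagonal_eigs hA
  have hdet : |Q.det| = 1 := by
    have := congrArg Matrix.det hQ
    rw [det_mul, det_transpose, det_one, ← sq] at this
    rw [← abs_one, ← sq_eq_sq_iff_abs_eq_abs, this, one_pow]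
  have hm : Measurable fun v : Fin m → ℝ => f (eigs (A + vecMulVec v v)) :=
    hf.comp (measurable_eigs_add_vecMulVec (fun _ _ => measurable_const) (fun _ => hA)
      measurable_id)
  rw [← (measurePreserving_mulVec hdet).lintegral_comp hm]
  refine lintegral_congr fun v => congrArg f (eigs_congr
    (isHermitian_add_vecMulVec hA _)
    (isHermitian_add_vecMulVec (isHermitian_diagonal_real _) _) ?_)
  have h1 : A + vecMulVec (Q *ᵥ v) (Q *ᵥ v) =
      Q * ((diagonal (eigs A) + vecMulVec v v) * Qᵀ) := by
    conv_lhs => rw [hAQ]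
    rw [Matrix.add_mul, Matrix.mul_add, Matrix.mul_assoc, vecMulVec_mul, mul_vecMulVec,
      vecMul_transpose]
  rw [h1, charpoly_mul_comm, Matrix.mul_assoc, hQ, Matrix.mul_one]

/-- The product of differences `∏_{i<j} (a_i - a_j)`. -/
noncomputable def vdm {m : ℕ} (a : Fin m → ℝ) : ℝ := ∏ i, ∏ j ∈ Finset.Ioi i, (a i - a j)

theorem abs_vdm {m : ℕ} (a : Fin m → ℝ) : |vdm a| = |(vandermonde a).det| := by
  simp only [vdm, det_vandermonde, Finset.abs_prod]
  exact Finset.prod_congr rfl fun i _ => Finset.prod_congr rfl fun j _ => abs_sub_comm _ _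

theorem vdm_pos {m : ℕ} {a : Fin m → ℝ} (ha : StrictAnti a) : 0 < vdm a :=
  Finset.prod_pos fun _ _ => Finset.prod_pos fun _ hj => sub_pos.2 (ha (Finset.mem_Ioi.1 hj))

theorem vdm_ne_zero {m : ℕ} {a : Fin m → ℝ} (ha : Function.Injective a) : vdm a ≠ 0 := by
  rw [← abs_pos, abs_vdm, abs_pos]
  exact det_vandermonde_ne_zero_iff.2 ha

theorem prod_prod_erase_abs_sub {m : ℕ} (a : Fin m → ℝ) :
    ∏ i, ∏ j ∈ Finset.univ.erase i, |a i - a j| = |vdm a| ^ 2 := by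
  have h := Finset.prod_prod_Ioi_mul_eq_prod_prod_off_diag fun i j => |a j - a i|
  have he : ∀ i : Fin m, Finset.univ.erase i = {i}ᶜ := fun i => by ext; simp
  simp only [he, vdm, Finset.abs_prod, ← h, ← Finset.prod_pow]
  exact Finset.prod_congr rfl fun i _ => Finset.prod_congr rfl fun j _ => by
    rw [abs_sub_comm (a j), sq]

theorem abs_det_cauchy {m : ℕ} {a b : Fin m → ℝ} (hb : Function.Injective b)
    (hab : ∀ i j, a i ≠ b j) :
    |(Matrix.of fun i j => (a i - b j)⁻¹).det| * ∏ i, ∏ j, |a i - b j| = |vdm a| * |vdm b| := by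
  let L : Fin m → Polynomial ℝ := fun j =>
    ∏ k ∈ Finset.univ.erase j, (Polynomial.X - Polynomial.C (b k))
  have hdeg : ∀ j, (L j).natDegree < m := fun j => by
    have : 0 < m := j.pos
    simp only [L, Polynomial.natDegree_finsetProd_X_sub_C_eq_card]
    rw [Finset.card_erase_of_mem (Finset.mem_univ _), Finset.card_univ, Fintype.card_fin]
    omega
  let C : Matrix (Fin m) (Fin m) ℝ := Matrix.of fun k j => (L j).coeff k
  have hC : ∀ c : Fin m → ℝ, (vandermonde c) * C = Matrix.of fun i j => (L j).eval (c i) := by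
    intro c
    ext i j
    rw [mul_apply, of_apply, Polynomial.eval_eq_sum_range' (hdeg j), ← Fin.sum_univ_eq_sum_range
      (fun k => (L j).coeff k * c i ^ k)]
    exact Finset.sum_congr rfl fun k _ => mul_comm _ _
  have h1 : |C.det| = |vdm b| := by
    have h2 : (Matrix.of fun i j => (L j).eval (b i)) = diagonal fun j => (L j).eval (b j) := by
      ext i j
      by_cases hij : i = j
      · subst hij; simp
      · rw [diagonal_apply_ne _ hij, of_apply]
        simp only [L, Polynomial.eval_prod]
        exact Finset.prod_eq_zero (Finset.mem_erase.2 ⟨hij, Finset.mem_univ _⟩) (by simp)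
    have h3 := congrArg (fun M => |Matrix.det M|) ((hC b).trans h2)
    simp only [det_mul, det_diagonal, abs_mul, ← abs_vdm, Finset.abs_prod, L,
      Polynomial.eval_prod, Polynomial.eval_sub, Polynomial.eval_X, Polynomial.eval_C,
      prod_prod_erase_abs_sub, sq] at h3
    exact mul_left_cancel₀ (abs_ne_zero.2 (vdm_ne_zero hb)) h3
  have h4 : (Matrix.of fun i j => (L j).eval (a i)) =
      diagonal (fun i => ∏ j, (a i - b j)) * Matrix.of fun i j => (a i - b j)⁻¹ := by
    ext i j
    rw [diagonal_mul, of_apply, of_apply]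
    simp only [L, Polynomial.eval_prod, Polynomial.eval_sub, Polynomial.eval_X, Polynomial.eval_C]
    rw [← Finset.mul_prod_erase _ _ (Finset.mem_univ j)]
    field_simp [sub_ne_zero.2 (hab i j)]
  have h5 := congrArg (fun M => |Matrix.det M|) ((hC a).trans h4)
  simp only [det_mul, det_diagonal, abs_mul, ← abs_vdm, Finset.abs_prod, h1] at h5
  rw [h5, mul_comm]

/-- The entries of `b` interlace those of `a` from above: `b₀ > a₀ > b₁ > a₁ > ⋯`. -/
def Interlace {m : ℕ} (a b : Fin m → ℝ) : Prop :=
  (∀ i j, i ≤ j → a j < b i) ∧ ∀ i j, i < j → b j < a i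

theorem Interlace.ne {m : ℕ} {a b : Fin m → ℝ} (h : Interlace a b) (i j : Fin m) : a i ≠ b j := by
  rcases le_or_gt j i with hij | hij
  · exact (h.1 j i hij).ne
  · exact (h.2 i j hij).ne'

theorem Interlace.strictAnti_left {m : ℕ} {a b : Fin m → ℝ} (h : Interlace a b) : StrictAnti a :=
  fun i j hij => (h.1 j j le_rfl).trans (h.2 i j hij)

theorem Interlace.strictAnti_right {m : ℕ} {a b : Fin m → ℝ} (h : Interlace a b) : StrictAnti b :=
  fun i j hij => (h.2 i j hij).trans (h.1 i i le_rfl)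

theorem det_diagonal_add_vecMulVec {m : ℕ} {d : Fin m → ℝ} (hd : ∀ i, d i ≠ 0)
    (u w : Fin m → ℝ) :
    (diagonal d + vecMulVec u w).det = (∏ i, d i) * (1 + ∑ i, u i * w i / d i) := by
  have h1 : diagonal d + vecMulVec u w =
      diagonal d * (1 + vecMulVec (fun i => u i / d i) w) := by
    rw [Matrix.mul_add, Matrix.mul_one]
    congr 1
    ext i j
    rw [diagonal_mul, vecMulVec_apply, vecMulVec_apply]
    field_simp [hd i]
  rw [h1, det_mul, det_diagonal, vecMulVec_eq Unit, det_one_add_replicateCol_mul_replicateRow]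
  congr 2
  exact Finset.sum_congr rfl fun i _ => by ring

open Polynomial in
theorem charpoly_diagonal_add_vecMulVec {m : ℕ} (a v : Fin m → ℝ) :
    (diagonal a + vecMulVec v v).charpoly =
      ∏ j, (X - C (a j)) - ∑ j, C (v j ^ 2) * ∏ k ∈ Finset.univ.erase j, (X - C (a k)) := by
  refine Polynomial.eq_of_infinite_eval_eq _ _ ((Set.finite_range a).infinite_compl.mono ?_)
  intro t ht
  have hd : ∀ i, t - a i ≠ 0 := fun i h => ht ⟨i, (sub_eq_zero.1 h).symm⟩
  have h1 : scalar (Fin m) t - (diagonal a + vecMulVec v v) =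
      diagonal (fun i => t - a i) + vecMulVec (-v) v := by
    rw [neg_vecMulVec, ← sub_sub, ← sub_eq_add_neg, scalar_apply, diagonal_sub]
  rw [Set.mem_ofPred_eq, eval_charpoly_eq_det, h1, det_diagonal_add_vecMulVec hd]
  simp only [eval_sub, eval_prod, eval_X, eval_C, eval_finsetSum, eval_mul]
  rw [mul_add, mul_one, sub_eq_add_neg, ← Finset.sum_neg_distrib, Finset.mul_sum]
  congr 1
  refine Finset.sum_congr rfl fun i _ => ?_
  rw [← Finset.mul_prod_erase _ _ (Finset.mem_univ i), Pi.neg_apply]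
  have := hd i
  field_simp

theorem eval_charpoly_diagonal_add_vecMulVec {m : ℕ} (a v : Fin m → ℝ) (i : Fin m) :
    (diagonal a + vecMulVec v v).charpoly.eval (a i) =
      -(v i ^ 2 * ∏ j ∈ Finset.univ.erase i, (a i - a j)) := by
  rw [charpoly_diagonal_add_vecMulVec]
  simp only [Polynomial.eval_sub, Polynomial.eval_prod, Polynomial.eval_X, Polynomial.eval_C,
    Polynomial.eval_finsetSum, Polynomial.eval_mul]
  rw [Finset.prod_eq_zero (Finset.mem_univ i) (sub_self _), zero_sub,
    Finset.sum_eq_single_of_mem i (Finset.mem_univ i)]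
  intro j _ hj
  rw [Finset.prod_eq_zero (Finset.mem_erase.2 ⟨hj.symm, Finset.mem_univ i⟩) (sub_self _), mul_zero]

theorem prod_eigs_diagonal_add_vecMulVec {m : ℕ} (a v : Fin m → ℝ) (i : Fin m) :
    ∏ j, (a i - eigs (diagonal a + vecMulVec v v) j) =
      -(v i ^ 2 * ∏ j ∈ Finset.univ.erase i, (a i - a j)) := by
  rw [← eval_charpoly_diagonal_add_vecMulVec, charpoly_eq_prod_eigs
    (isHermitian_add_vecMulVec (isHermitian_diagonal_real a) v)]
  simp [Polynomial.eval_prod]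

theorem prod_eq_neg_one_pow_mul_prod_abs {ι : Type*} (s : Finset ι) (x : ι → ℝ) :
    ∏ j ∈ s, x j = (-1) ^ (s.filter fun j => x j < 0).card * ∏ j ∈ s, |x j| := by
  rw [← Finset.prod_const, Finset.prod_filter, ← Finset.prod_mul_distrib]
  refine Finset.prod_congr rfl fun j _ => ?_
  split_ifs with h
  · rw [abs_of_neg h]; ring
  · rw [abs_of_nonneg (not_lt.1 h), one_mul]

theorem interlace_of_card {m : ℕ} {a b : Fin m → ℝ} (hb : Antitone b) (hab : ∀ i j, a i ≠ b j)
    (h : ∀ i, (Finset.univ.filter fun j => a i - b j < 0).card = i.1 + 1) : Interlace a b := by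
  constructor
  · intro i j hij
    by_contra hlt
    have hsub : (Finset.univ.filter fun k => a j - b k < 0) ⊆ Finset.Iio i := fun k hk => by
      rw [Finset.mem_filter_univ] at hk
      rw [Finset.mem_Iio]
      by_contra hk'
      linarith [hb (not_lt.1 hk')]
    have := Finset.card_le_card hsub
    rw [h, Fin.card_Iio] at this
    have := Fin.le_def.1 hij
    omega
  · intro i j hij
    by_contra hlt
    have hlt := lt_of_le_of_ne (not_lt.1 hlt) (hab i j)
    have hsub : Finset.Iic j ⊆ (Finset.univ.filter fun k => a i - b k < 0) := fun k hk => by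
      rw [Finset.mem_filter_univ]
      linarith [hb (Finset.mem_Iic.1 hk)]
    have := Finset.card_le_card hsub
    rw [h, Fin.card_Iic] at this
    have := Fin.lt_def.1 hij
    omega

/-- Strict Cauchy interlacing for rank-one perturbations. -/
theorem interlace_eigs {m : ℕ} {a v : Fin m → ℝ} (ha : StrictAnti a) (hv : ∀ i, v i ≠ 0) :
    Interlace a (eigs (diagonal a + vecMulVec v v)) := by
  set b := eigs (diagonal a + vecMulVec v v) with hbdef
  have hb : Antitone b := eigs_antitone _
  have hprod : ∀ i, ∏ j, (a i - b j) = -(v i ^ 2 * ∏ j ∈ Finset.univ.erase i, (a i - a j)) :=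
    prod_eigs_diagonal_add_vecMulVec a v
  have hne : ∀ i, ∏ j ∈ Finset.univ.erase i, (a i - a j) ≠ 0 := fun i =>
    Finset.prod_ne_zero_iff.2 fun j hj => sub_ne_zero.2 fun h =>
      (Finset.mem_erase.1 hj).1 (ha.injective h).symm
  have hab : ∀ i j, a i ≠ b j := fun i j h => by
    have h0 := hprod i
    rw [Finset.prod_eq_zero (Finset.mem_univ j) (sub_eq_zero.2 h)] at h0
    exact mul_ne_zero (pow_ne_zero 2 (hv i)) (hne i) (neg_eq_zero.1 h0.symm)
  set N : Fin m → ℕ := fun i => (Finset.univ.filter fun j => a i - b j < 0).card with hN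
  have hpar : ∀ i, (-1 : ℝ) ^ N i = (-1) ^ (i.1 + 1) := by
    intro i
    have hc : ((Finset.univ.erase i).filter fun j => a i - a j < 0) = Finset.Iio i := by
      ext j
      simp only [Finset.mem_filter, Finset.mem_erase, Finset.mem_univ, and_true, sub_neg,
        ha.lt_iff_gt, Finset.mem_Iio]
      exact ⟨fun h => h.2, fun h => ⟨h.ne, h⟩⟩
    have h0 := hprod i
    rw [prod_eq_neg_one_pow_mul_prod_abs, prod_eq_neg_one_pow_mul_prod_abs (Finset.univ.erase i), hc,
      Fin.card_Iio] at h0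
    have p1 : 0 < ∏ j, |a i - b j| := Finset.prod_pos fun j _ => abs_pos.2 (sub_ne_zero.2 (hab i j))
    have p2 : 0 < v i ^ 2 * ∏ j ∈ Finset.univ.erase i, |a i - a j| := by
      rw [← Finset.abs_prod]
      exact mul_pos (sq_pos_of_ne_zero (hv i)) (abs_pos.2 (hne i))
    rw [pow_succ]
    change (-1 : ℝ) ^ N i * _ = _ at h0
    rcases neg_one_pow_eq_or ℝ (N i) with e1 | e1 <;>
      rcases neg_one_pow_eq_or ℝ (i.1) with e2 | e2 <;> rw [e1, e2] at h0 ⊢ <;> 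
      first | (exfalso; linarith) | norm_num
  have hpar' : ∀ i, N i % 2 = (i.1 + 1) % 2 := fun i => by
    have := hpar i
    rcases Nat.even_or_odd (N i) with h1 | h1 <;> rcases Nat.even_or_odd (i.1 + 1) with h2 | h2 <;>
      rw [h1.neg_one_pow, h2.neg_one_pow] at this
    · rw [Nat.even_iff.1 h1, Nat.even_iff.1 h2]
    · norm_num at this
    · norm_num at this
    · rw [Nat.odd_iff.1 h1, Nat.odd_iff.1 h2]
  have hmono : Monotone N := fun i j hij => Finset.card_le_card fun k hk => by
    rw [Finset.mem_filter_univ] at hk ⊢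
    linarith [ha.antitone hij]
  refine interlace_of_card hb hab fun i => ?_
  have hstrict : ∀ k (hk : k < m), k + 1 ≤ N ⟨k, hk⟩ := by
    intro k
    induction k with
    | zero => intro hk; have := hpar' ⟨0, hk⟩; simp only at this; omega
    | succ k ih =>
      intro hk
      have h1 := ih (by omega)
      have h2 : N ⟨k, by omega⟩ ≤ N ⟨k + 1, hk⟩ := hmono (Fin.le_def.2 (by simp))
      have h3 := hpar' ⟨k + 1, hk⟩
      simp only at h3
      omega
  have hupper : ∀ k (hk : k < m), N ⟨m - 1 - k, by omega⟩ ≤ m - k := by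
    intro k
    induction k with
    | zero =>
      intro hk
      exact (Finset.card_le_univ _).trans (by simp)
    | succ k ih =>
      intro hk
      have h1 := ih (by omega)
      have h2 : N ⟨m - 1 - (k + 1), by omega⟩ ≤ N ⟨m - 1 - k, by omega⟩ :=
        hmono (Fin.le_def.2 (by simp only; omega))
      have h3 := hpar' ⟨m - 1 - (k + 1), by omega⟩
      simp only at h3
      omega
  have h1 := hstrict i.1 i.2
  have h2 := hupper (m - 1 - i.1) (by omega)
  have h3 : (⟨m - 1 - (m - 1 - i.1), by omega⟩ : Fin m) = i := Fin.ext (by simp only; omega)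
  rw [h3] at h2
  change N i = _
  change i.1 + 1 ≤ N i at h1
  omega

/-- The positive vector `v` such that `diag(a) + vvᵀ` has eigenvalues `b`, for interlacing `a`
and `b`. -/
noncomputable def rankOneVec {m : ℕ} (a b : Fin m → ℝ) (i : Fin m) : ℝ :=
  exp ((∑ j, log (a i - b j) - ∑ j ∈ Finset.univ.erase i, log (a i - a j)) / 2)

theorem rankOneVec_pos {m : ℕ} (a b : Fin m → ℝ) (i : Fin m) : 0 < rankOneVec a b i := exp_pos _

theorem rankOneVec_sq_mul {m : ℕ} {a b : Fin m → ℝ} (h : Interlace a b) (i : Fin m) :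
    rankOneVec a b i ^ 2 * ∏ j ∈ Finset.univ.erase i, (a i - a j) = -∏ j, (a i - b j) := by
  have ha := h.strictAnti_left
  have hne : ∀ j ∈ Finset.univ.erase i, a i - a j ≠ 0 := fun j hj =>
    sub_ne_zero.2 fun h => (Finset.mem_erase.1 hj).1 (ha.injective h).symm
  have h1 : rankOneVec a b i ^ 2 =
      (∏ j, |a i - b j|) / ∏ j ∈ Finset.univ.erase i, |a i - a j| := by
    rw [rankOneVec, ← exp_nat_mul, Nat.cast_ofNat, mul_div_cancel₀ _ (two_ne_zero' ℝ), exp_sub,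
      exp_sum, exp_sum]
    congr 1
    · exact Finset.prod_congr rfl fun j _ => exp_log_eq_abs (sub_ne_zero.2 (h.ne i j))
    · exact Finset.prod_congr rfl fun j hj => exp_log_eq_abs (hne j hj)
  rw [h1, ← Finset.mul_prod_erase _ _ (Finset.mem_univ i),
    ← Finset.mul_prod_erase _ (fun j => a i - b j) (Finset.mem_univ i),
    abs_of_neg (sub_neg.2 (h.1 i i le_rfl)), mul_div_assoc, ← Finset.prod_div_distrib, mul_assoc,
    ← Finset.prod_mul_distrib, neg_mul]
  congr 2
  refine Finset.prod_congr rfl fun j hj => ?_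
  rcases lt_or_gt_of_ne (Finset.mem_erase.1 hj).1 with hji | hij
  · have h2 := sub_neg.2 (ha hji)
    rw [abs_of_neg (sub_neg.2 (h.1 j i hji.le)), abs_of_neg h2, neg_div_neg_eq,
      div_mul_cancel₀ _ h2.ne]
  · have h2 := sub_pos.2 (ha hij)
    rw [abs_of_pos (sub_pos.2 (h.2 i j hij)), abs_of_pos h2, div_mul_cancel₀ _ h2.ne']

theorem eigs_rankOneVec {m : ℕ} {a b : Fin m → ℝ} (h : Interlace a b) :
    eigs (diagonal a + vecMulVec (rankOneVec a b) (rankOneVec a b)) = b := by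
  refine eigs_eq_of_charpoly (isHermitian_add_vecMulVec (isHermitian_diagonal_real a) _)
    h.strictAnti_right.antitone ?_
  refine prod_X_sub_C_eq_of_eval (charpoly_monic _) (monic_prod_X_sub_C' b)
    (by simp) (natDegree_prod_X_sub_C' b)
    h.strictAnti_left.injective fun i => ?_
  rw [eval_charpoly_diagonal_add_vecMulVec, rankOneVec_sq_mul h, neg_neg]
  simp [Polynomial.eval_prod]

theorem rankOneVec_eigs {m : ℕ} {a v : Fin m → ℝ} (ha : StrictAnti a) (hv : ∀ i, 0 < v i) :
    rankOneVec a (eigs (diagonal a + vecMulVec v v)) = v := by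
  have h := interlace_eigs ha fun i => (hv i).ne'
  funext i
  have h1 := rankOneVec_sq_mul h i
  rw [prod_eigs_diagonal_add_vecMulVec, neg_neg] at h1
  have hne : ∏ j ∈ Finset.univ.erase i, (a i - a j) ≠ 0 :=
    Finset.prod_ne_zero_iff.2 fun j hj => sub_ne_zero.2 fun h =>
      (Finset.mem_erase.1 hj).1 (ha.injective h).symm
  exact (pow_left_inj₀ (rankOneVec_pos _ _ _).le (hv i).le two_ne_zero).1 (mul_right_cancel₀ hne h1)

/-- The Jacobian matrix of `b ↦ rankOneVec a b`. -/
noncomputable def rankOneJac {m : ℕ} (a b : Fin m → ℝ) : Matrix (Fin m) (Fin m) ℝ :=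
  diagonal (fun i => -(rankOneVec a b i / 2)) * Matrix.of fun i j => (a i - b j)⁻¹

theorem hasFDerivAt_rankOneVec {m : ℕ} {a b : Fin m → ℝ} (h : Interlace a b) :
    HasFDerivAt (rankOneVec a) (Matrix.toLin' (rankOneJac a b)).toContinuousLinearMap b := by
  rw [hasFDerivAt_pi']
  intro i
  have h1 : ∀ j ∈ Finset.univ, HasFDerivAt (fun b : Fin m → ℝ => log (a i - b j))
      ((a i - b j)⁻¹ • -(ContinuousLinearMap.proj (R := ℝ) (φ := fun _ : Fin m => ℝ) j)) b :=
    fun j _ => ((hasFDerivAt_apply j b).const_sub (a i)).log (sub_ne_zero.2 (h.ne i j))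
  have h2 := (((HasFDerivAt.fun_sum h1).sub_const
    (∑ j ∈ Finset.univ.erase i, log (a i - a j))).mul_const (2⁻¹ : ℝ)).exp
  simp only [← div_eq_mul_inv] at h2
  refine h2.congr_fderiv ?_
  ext w
  simp only [rankOneJac, _root_.smul_apply, _root_.sum_apply,
    _root_.neg_apply, ContinuousLinearMap.proj_apply, smul_eq_mul,
    ContinuousLinearMap.comp_apply, LinearMap.coe_toContinuousLinearMap', toLin'_apply,
    ← mulVec_mulVec, mulVec_diagonal]
  simp only [mulVec, dotProduct, of_apply, mul_neg, Finset.sum_neg_distrib]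
  change -(rankOneVec a b i * _) = _
  ring

/-- The density appearing in the conditional law of `b` given `a` for rank-one perturbations. -/
noncomputable def interKernel {m : ℕ} (a b : Fin m → ℝ) : ℝ :=
  (∏ i, ∏ j, |a i - b j|) ^ (-(1 / 2) : ℝ)

theorem prod_rankOneVec {m : ℕ} {a b : Fin m → ℝ} (h : Interlace a b) :
    (∏ i, rankOneVec a b i) * vdm a = (∏ i, ∏ j, |a i - b j|) ^ (1 / 2 : ℝ) := by
  have ha := vdm_pos h.strictAnti_left
  have h0 : 0 ≤ ∏ i, ∏ j, |a i - b j| :=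
    Finset.prod_nonneg fun _ _ => Finset.prod_nonneg fun _ _ => abs_nonneg _
  have hp : 0 ≤ ∏ i, rankOneVec a b i := Finset.prod_nonneg fun _ _ => (rankOneVec_pos _ _ _).le
  rw [← sqrt_eq_rpow, eq_comm, sqrt_eq_iff_mul_self_eq h0 (mul_nonneg hp ha.le), ← sq, mul_pow,
    ← Finset.prod_pow, ← abs_of_pos ha, ← prod_prod_erase_abs_sub, ← Finset.prod_mul_distrib]
  refine Finset.prod_congr rfl fun i _ => ?_
  have := congrArg abs (rankOneVec_sq_mul h i)
  rw [abs_mul, abs_neg, abs_of_nonneg (sq_nonneg _), Finset.abs_prod, Finset.abs_prod] at this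
  exact this.symm

theorem abs_det_rankOneJac {m : ℕ} {a b : Fin m → ℝ} (h : Interlace a b) :
    2 ^ m * |(rankOneJac a b).det| = vdm b * interKernel a b := by
  have ha := vdm_pos h.strictAnti_left
  have hb := vdm_pos h.strictAnti_right
  have hP : 0 < ∏ i, ∏ j, |a i - b j| :=
    Finset.prod_pos fun i _ => Finset.prod_pos fun j _ => abs_pos.2 (sub_ne_zero.2 (h.ne i j))
  have h1 := abs_det_cauchy h.strictAnti_right.injective h.ne
  rw [abs_of_pos ha, abs_of_pos hb] at h1
  have h2 := prod_rankOneVec h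
  have h3 : |∏ i, -(rankOneVec a b i / 2)| = (∏ i, rankOneVec a b i) / 2 ^ m := by
    rw [Finset.abs_prod]
    have : ∀ i, |-(rankOneVec a b i / 2)| = rankOneVec a b i / 2 := fun i => by
      rw [abs_neg, abs_of_pos (div_pos (rankOneVec_pos a b i) two_pos)]
    simp only [this, Finset.prod_div_distrib, Finset.prod_const, Finset.card_univ, Fintype.card_fin]
  rw [rankOneJac, det_mul, det_diagonal, abs_mul, h3, interKernel]
  set P := ∏ i, ∏ j, |a i - b j|
  have h4 : P ^ (-(1 / 2) : ℝ) * P = P ^ (1 / 2 : ℝ) := by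
    rw [← rpow_add_one hP.ne']; norm_num
  set c := |(of fun i j => (a i - b j)⁻¹).det|
  rw [← mul_left_inj' hP.ne', ← mul_left_inj' ha.ne']
  calc _ = ((∏ i, rankOneVec a b i) * vdm a) * (c * P) := by field_simp
    _ = P ^ (1 / 2 : ℝ) * (vdm a * vdm b) := by rw [h1, h2]
    _ = _ := by rw [← h4]; ring

theorem measurableSet_interlace {α : Type*} [MeasurableSpace α] {m : ℕ} {a b : α → Fin m → ℝ}
    (ha : Measurable a) (hb : Measurable b) : MeasurableSet {x | Interlace (a x) (b x)} := by
  simp only [Interlace]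
  have ha' := fun i => (measurable_pi_apply i).comp ha
  have hb' := fun i => (measurable_pi_apply i).comp hb
  have h : {x | (∀ i j, i ≤ j → a x j < b x i) ∧ ∀ i j, i < j → b x j < a x i} =
      (⋂ i, ⋂ j, ⋂ (_ : i ≤ j), {x | a x j < b x i}) ∩
        ⋂ i, ⋂ j, ⋂ (_ : i < j), {x | b x j < a x i} := by
    ext x; simp
  rw [h]
  exact (MeasurableSet.iInter fun i => MeasurableSet.iInter fun j => MeasurableSet.iInter fun _ =>
    measurableSet_lt (ha' j) (hb' i)).inter
    (MeasurableSet.iInter fun i => MeasurableSet.iInter fun j => MeasurableSet.iInter fun _ =>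
      measurableSet_lt (hb' j) (ha' i))

theorem map_abs_volume :
    (volume : Measure ℝ).map (fun x => |x|) = (2 : ENNReal) • volume.restrict (Set.Ioi 0) := by
  ext s hs
  rw [Measure.map_apply (by fun_prop) hs, Measure.smul_apply, Measure.restrict_apply hs]
  have h1 : (fun x : ℝ => |x|) ⁻¹' s =ᵐ[volume] (s ∩ Set.Ioi 0 ∪ -(s ∩ Set.Ioi 0) : Set ℝ) := by
    filter_upwards [Measure.ae_ne volume (0 : ℝ)] with x hx
    refine propext ?_
    change |x| ∈ s ↔ (x ∈ s ∧ 0 < x) ∨ (-x ∈ s ∧ 0 < -x)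
    rcases lt_or_gt_of_ne hx with h | h
    · rw [abs_of_neg h]; simp [h, h.le]
    · rw [abs_of_pos h]; simp [h, h.le]
  have hm : MeasurableSet (s ∩ Set.Ioi 0) := hs.inter measurableSet_Ioi
  rw [measure_congr h1, measure_union ?_ hm.neg, Measure.measure_neg, smul_eq_mul, two_mul]
  rw [Set.disjoint_left]
  rintro x ⟨_, h2⟩ ⟨_, h3⟩
  exact lt_asymm (Set.mem_Ioi.1 h2) (neg_pos.1 (Set.mem_Ioi.1 h3))

theorem map_abs_volume_pi (m : ℕ) :
    (volume : Measure (Fin m → ℝ)).map (fun v i => |v i|) =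
      (2 : ENNReal) ^ m • volume.restrict {v | ∀ i, 0 < v i} := by
  have hσ : SigmaFinite ((volume : Measure ℝ).map (fun x => |x|)) := by
    rw [map_abs_volume]
    exact SMul.sigmaFinite (μ := (volume : Measure ℝ).restrict (Set.Ioi 0)) (2 : NNReal)
  have h1 : {v : Fin m → ℝ | ∀ i, 0 < v i} = Set.univ.pi fun _ => Set.Ioi 0 := by
    ext; simp
  have h2 : Measure.pi (fun _ : Fin m => (volume : Measure ℝ).map (fun x => |x|)) =
      (2 : ENNReal) ^ m • volume.restrict {v | ∀ i, 0 < v i} := by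
    refine Measure.pi_eq fun s hs => ?_
    rw [Measure.smul_apply, Measure.restrict_apply (MeasurableSet.univ_pi hs), h1,
      ← Set.pi_inter_distrib, volume_pi, Measure.pi_pi]
    simp only [map_abs_volume, Measure.smul_apply, Measure.restrict_apply (hs _), smul_eq_mul,
      Finset.prod_mul_distrib, Finset.prod_const, Finset.card_univ, Fintype.card_fin]
  rw [← h2, volume_pi]
  exact Measure.pi_map_pi (f := fun _ x => |x|) (hμ := fun _ => hσ) fun _ => by fun_prop

theorem lintegral_eq_two_pow_mul_of_abs {m : ℕ} {g : (Fin m → ℝ) → ENNReal} (hg : Measurable g)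
    (h : ∀ v, g v = g fun i => |v i|) :
    ∫⁻ v, g v = 2 ^ m * ∫⁻ v in {v | ∀ i, 0 < v i}, g v := by
  rw [← smul_eq_mul, ← lintegral_smul_measure, ← map_abs_volume_pi, lintegral_map hg (by fun_prop)]
  exact lintegral_congr h

/-- Integration over all rank-one perturbations of a diagonal matrix. -/
theorem lintegral_eigs_diagonal_add_vecMulVec {m : ℕ} {a : Fin m → ℝ} (ha : StrictAnti a)
    {f : (Fin m → ℝ) → ENNReal} (hf : Measurable f) :
    ∫⁻ v : Fin m → ℝ, f (eigs (diagonal a + vecMulVec v v)) =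
      ∫⁻ b in {b | Interlace a b}, f b * ENNReal.ofReal (vdm b * interKernel a b) := by
  rw [lintegral_eq_two_pow_mul_of_abs]
  · have himg : rankOneVec a '' {b | Interlace a b} = {v | ∀ i, 0 < v i} := by
      ext v
      constructor
      · rintro ⟨b, _, rfl⟩ i
        exact rankOneVec_pos a b i
      · exact fun hv => ⟨_, interlace_eigs ha fun i => (hv i).ne', rankOneVec_eigs ha hv⟩
    have hms : MeasurableSet {b : Fin m → ℝ | Interlace a b} :=
      measurableSet_interlace measurable_const measurable_id
    have hinj : Set.InjOn (rankOneVec a) {b | Interlace a b} :=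
      Set.LeftInvOn.injOn (f₁' := fun v => eigs (diagonal a + vecMulVec v v))
        fun b hb => eigs_rankOneVec hb
    rw [← himg, lintegral_image_eq_lintegral_abs_det_fderiv_mul volume hms
      (fun b hb => (hasFDerivAt_rankOneVec hb).hasFDerivWithinAt) hinj,
      ← lintegral_const_mul' _ _ (by finiteness)]
    refine setLIntegral_congr_fun hms fun b hb => ?_
    rw [eigs_rankOneVec hb, ← abs_det_rankOneJac hb, ENNReal.ofReal_mul (by positivity),
      ENNReal.ofReal_pow zero_le_two, ENNReal.ofReal_ofNat, LinearMap.det_toContinuousLinearMap,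
      LinearMap.det_toLin']
    ring
  · exact hf.comp (measurable_eigs_add_vecMulVec (fun _ _ => measurable_const)
      (fun _ => isHermitian_diagonal_real a) measurable_id)
  · intro v
    refine congrArg f (eigs_congr (isHermitian_add_vecMulVec (isHermitian_diagonal_real _) _)
      (isHermitian_add_vecMulVec (isHermitian_diagonal_real _) _) ?_)
    simp only [charpoly_diagonal_add_vecMulVec, sq_abs]

/-- The function `x ↦ x₊ ^ (s - 1)` with values in `[0, ∞]`. -/
noncomputable def posPow (s x : ℝ) : ENNReal :=
  (Set.Ioi (0 : ℝ)).indicator (fun x => ENNReal.ofReal (x ^ (s - 1))) x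

theorem measurable_posPow (s : ℝ) : Measurable (posPow s) :=
  Measurable.indicator (by fun_prop) measurableSet_Ioi

theorem posPow_of_pos {x : ℝ} (s : ℝ) (hx : 0 < x) : posPow s x = ENNReal.ofReal (x ^ (s - 1)) :=
  Set.indicator_of_mem (Set.mem_Ioi.2 hx) _

theorem posPow_of_nonpos {x : ℝ} (s : ℝ) (hx : x ≤ 0) : posPow s x = 0 :=
  Set.indicator_of_notMem (fun h => not_lt.2 hx (Set.mem_Ioi.1 h)) _

theorem posPow_mul {c : ℝ} (hc : 0 < c) (s x : ℝ) :
    posPow s (c * x) = ENNReal.ofReal (c ^ (s - 1)) * posPow s x := by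
  rcases le_or_gt x 0 with hx | hx
  · rw [posPow_of_nonpos s hx, posPow_of_nonpos s (mul_nonpos_of_nonneg_of_nonpos hc.le hx),
      mul_zero]
  · rw [posPow_of_pos s hx, posPow_of_pos s (mul_pos hc hx), mul_rpow hc.le hx.le,
      ENNReal.ofReal_mul (by positivity)]

theorem lintegral_posPow_mul_exp {s : ℝ} (hs : 0 < s) :
    ∫⁻ x, posPow s x * ENNReal.ofReal (exp (-x)) = ENNReal.ofReal (Gamma s) := by
  have h1 : ∀ x, posPow s x * ENNReal.ofReal (exp (-x)) =
      (Set.Ioi (0 : ℝ)).indicator (fun x => ENNReal.ofReal (exp (-x) * x ^ (s - 1))) x := by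
    intro x
    rcases le_or_gt x 0 with hx | hx
    · rw [posPow_of_nonpos s hx, zero_mul, Set.indicator_of_notMem (s := Set.Ioi (0 : ℝ)) fun h =>
        not_lt.2 hx (Set.mem_Ioi.1 h)]
    · rw [posPow_of_pos s hx, Set.indicator_of_mem (Set.mem_Ioi.2 hx), mul_comm,
        ENNReal.ofReal_mul (exp_pos _).le]
  simp only [h1]
  rw [lintegral_indicator measurableSet_Ioi, Gamma_eq_integral hs,
    ofReal_integral_eq_lintegral_ofReal (GammaIntegral_convergent hs)]
  exact (ae_restrict_mem measurableSet_Ioi).mono fun x hx =>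
    mul_nonneg (exp_pos _).le (rpow_nonneg (le_of_lt hx) _)

theorem lintegral_exp_neg_sum_sq (m : ℕ) :
    ∫⁻ x : Fin m → ℝ, ENNReal.ofReal (exp (-∑ i, x i ^ 2)) =
      ENNReal.ofReal (π ^ ((m : ℝ) / 2)) := by
  have h1 : ∀ x : Fin m → ℝ, exp (-∑ i, x i ^ 2) = ∏ i, exp (-1 * x i ^ 2) := fun x => by
    rw [← exp_sum, ← Finset.mul_sum, neg_one_mul]
  simp only [h1]
  have hi : Integrable (fun x : Fin m → ℝ => ∏ i, exp (-1 * x i ^ 2)) volume :=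
    Integrable.fintype_prod (f := fun _ y => exp (-1 * y ^ 2))
      fun _ => integrable_exp_neg_mul_sq one_pos
  rw [← ofReal_integral_eq_lintegral_ofReal hi
    (ae_of_all _ fun x => Finset.prod_nonneg fun _ _ => (exp_pos _).le),
    integral_fintype_prod_volume_eq_pow (fun x : ℝ => exp (-1 * x ^ 2)), integral_gaussian, div_one,
    Fintype.card_fin, sqrt_eq_rpow, ← rpow_natCast, ← rpow_mul pi_pos.le]
  congr 2
  ring

theorem lintegral_diagonal_mul {m : ℕ} {c : Fin m → ℝ} (hc : ∀ i, 0 < c i)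
    {F : (Fin m → ℝ) → ENNReal} (hF : Measurable F) :
    ∫⁻ x, F x = ENNReal.ofReal (∏ i, c i) * ∫⁻ x : Fin m → ℝ, F (fun i => c i * x i) := by
  have h0 : (diagonal c).det = ∏ i, c i := det_diagonal
  have hp : 0 < ∏ i, c i := Finset.prod_pos fun i _ => hc i
  conv_lhs => rw [← Real.smul_map_diagonal_volume_pi (D := c) (by rw [h0]; exact hp.ne')]
  rw [lintegral_smul_measure, h0, abs_of_pos hp, smul_eq_mul, lintegral_map hF (by
    simp only [toLin'_apply']; fun_prop)]
  congr 1
  refine lintegral_congr fun x => congrArg F ?_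
  funext i
  rw [toLin'_apply, mulVec_diagonal]

theorem lintegral_posPow_one_sub_sum_sq (m : ℕ) {s : ℝ} (hs : 0 < s) :
    ∫⁻ u : Fin m → ℝ, posPow s (1 - ∑ i, u i ^ 2) =
      ENNReal.ofReal (π ^ ((m : ℝ) / 2) * Gamma s / Gamma (s + m / 2)) := by
  have hs' : 0 < s + m / 2 := by positivity
  have hG := Gamma_pos_of_pos hs'
  set B := ∫⁻ u : Fin m → ℝ, posPow s (1 - ∑ i, u i ^ 2) with hB
  have hmeas := measurable_posPow s
  have h1 : ∀ r : ℝ, posPow (s + m / 2) r * ENNReal.ofReal (exp (-r)) * B =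
      ∫⁻ x : Fin m → ℝ, ENNReal.ofReal (exp (-r)) * posPow s (r - ∑ i, x i ^ 2) := by
    intro r
    rw [lintegral_const_mul _ (by fun_prop)]
    rcases le_or_gt r 0 with hr | hr
    · rw [posPow_of_nonpos _ hr, zero_mul, zero_mul]
      have : ∀ x : Fin m → ℝ, posPow s (r - ∑ i, x i ^ 2) = 0 := fun x =>
        posPow_of_nonpos s (sub_nonpos.2 (hr.trans (Finset.sum_nonneg fun _ _ => sq_nonneg _)))
      simp [this]
    · rw [lintegral_diagonal_mul (c := fun _ => √r) (fun _ => sqrt_pos.2 hr) (by fun_prop)]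
      have h2 : ∀ x : Fin m → ℝ, posPow s (r - ∑ i, (√r * x i) ^ 2) =
          ENNReal.ofReal (r ^ (s - 1)) * posPow s (1 - ∑ i, x i ^ 2) := fun x => by
        rw [← posPow_mul hr, mul_sub, mul_one, Finset.mul_sum]
        simp only [mul_pow, sq_sqrt hr.le]
      simp only [h2]
      rw [lintegral_const_mul _ (by fun_prop), ← hB, posPow_of_pos _ hr, Finset.prod_const,
        Finset.card_univ, Fintype.card_fin]
      have h3 : r ^ (s + m / 2 - 1) = √r ^ m * r ^ (s - 1) := by
        rw [sqrt_eq_rpow, ← rpow_natCast, ← rpow_mul hr.le, ← rpow_add hr]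
        congr 1; ring
      rw [h3, ENNReal.ofReal_mul (by positivity)]
      ring
  have h2 : ENNReal.ofReal (Gamma (s + m / 2)) * B =
      ENNReal.ofReal (π ^ ((m : ℝ) / 2)) * ENNReal.ofReal (Gamma s) := by
    rw [← lintegral_posPow_mul_exp hs', ← lintegral_mul_const _ (by
      have := measurable_posPow (s + m / 2); fun_prop)]
    simp only [h1]
    rw [lintegral_lintegral_swap (by unfold Function.uncurry; fun_prop),
      ← lintegral_exp_neg_sum_sq m, ← lintegral_mul_const _ (by fun_prop)]
    refine lintegral_congr fun x => ?_
    rw [← lintegral_posPow_mul_exp hs, ← lintegral_const_mul _ (by fun_prop),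
      ← lintegral_add_right_eq_self _ (∑ i, x i ^ 2)]
    refine lintegral_congr fun y => ?_
    rw [add_sub_cancel_right, neg_add, exp_add, ENNReal.ofReal_mul (exp_pos _).le]
    ring
  rw [ENNReal.ofReal_div_of_pos hG, ENNReal.ofReal_mul (by positivity), ← h2,
    ENNReal.eq_div_iff (by simpa using hG) ENNReal.ofReal_ne_top]

/-- Negation and reversal of a vector. -/
def negRev {m : ℕ} (a : Fin m → ℝ) (i : Fin m) : ℝ := -a (Fin.rev i)

theorem measurePreserving_negRev (m : ℕ) :
    MeasurePreserving (negRev : (Fin m → ℝ) → Fin m → ℝ) volume volume := by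
  have h1 := volume_preserving_arrowCongr' (Fin.revPerm (n := m)) (MeasurableEquiv.refl ℝ)
    (MeasurePreserving.id _)
  exact (Measure.measurePreserving_neg (volume : Measure (Fin m → ℝ))).comp h1

theorem interlace_negRev_left {m : ℕ} {a b : Fin m → ℝ} :
    Interlace (negRev a) b ↔ Interlace (negRev b) a := by
  have key : ∀ a b : Fin m → ℝ, Interlace (negRev a) b → Interlace (negRev b) a := by
    refine fun a b h => ⟨fun i j hij => ?_, fun i j hij => ?_⟩
    · have := h.1 (Fin.rev j) (Fin.rev i) (Fin.rev_le_rev.2 hij)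
      simp only [negRev, Fin.rev_rev] at this ⊢
      linarith
    · have := h.2 (Fin.rev j) (Fin.rev i) (Fin.rev_lt_rev.2 hij)
      simp only [negRev, Fin.rev_rev] at this ⊢
      linarith
  exact ⟨key a b, key b a⟩

theorem vdm_negRev {m : ℕ} (a : Fin m → ℝ) : vdm (negRev a) = vdm a := by
  rw [vdm, vdm, Finset.prod_sigma', Finset.prod_sigma']
  refine Finset.prod_nbij' (fun p => ⟨Fin.rev p.2, Fin.rev p.1⟩)
    (fun p => ⟨Fin.rev p.2, Fin.rev p.1⟩) ?_ ?_ ?_ ?_ ?_ <;> simp [negRev, Fin.rev_lt_rev]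
  intros; ring

theorem interKernel_negRev_left {m : ℕ} (a b : Fin m → ℝ) :
    interKernel (negRev a) b = interKernel (negRev b) a := by
  have h : ∀ a b : Fin m → ℝ, ∏ i, ∏ j, |negRev a i - b j| = ∏ i, ∏ j, |a i + b j| := by
    intro a b
    rw [← Equiv.prod_comp Fin.revPerm]
    refine Finset.prod_congr rfl fun i _ => Finset.prod_congr rfl fun j _ => ?_
    rw [negRev, Fin.revPerm_apply, Fin.rev_rev, ← abs_neg]
    congr 1; ring
  rw [interKernel, interKernel, h, h, Finset.prod_comm]
  simp only [add_comm]

theorem interlace_prod_pos_iff {m : ℕ} {a b : Fin m → ℝ} (h : Interlace a b) (hb : ∀ i, 0 < b i) :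
    0 < ∏ i, a i ↔ ∀ i, 0 < a i := by
  refine ⟨fun hp i => ?_, fun ha => Finset.prod_pos fun i _ => ha i⟩
  by_contra hi
  rw [← Finset.mul_prod_erase _ _ (Finset.mem_univ i)] at hp
  refine not_lt.2 (mul_nonpos_of_nonpos_of_nonneg (not_lt.1 hi)
    (Finset.prod_nonneg fun j hj => ?_)) hp
  rcases lt_or_gt_of_ne (Finset.mem_erase.1 hj).1 with hji | hij
  · exact ((hb i).trans (h.2 j i hji)).le
  · exact absurd ((hb j).trans (h.2 i j hij)) hi

theorem measurable_vdm {m : ℕ} : Measurable (vdm : (Fin m → ℝ) → ℝ) := by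
  unfold vdm; fun_prop

theorem measurable_interKernel {m : ℕ} :
    Measurable fun p : (Fin m → ℝ) × (Fin m → ℝ) => interKernel p.1 p.2 := by
  unfold interKernel; fun_prop

theorem measurableSet_forall_pos {m : ℕ} : MeasurableSet {a : Fin m → ℝ | ∀ i, 0 < a i} := by
  have : {a : Fin m → ℝ | ∀ i, 0 < a i} = Set.univ.pi fun _ => Set.Ioi 0 := by ext; simp
  rw [this]; exact MeasurableSet.univ_pi fun _ => measurableSet_Ioi

theorem measurableSet_interlace_left {m : ℕ} (b : Fin m → ℝ) :
    MeasurableSet {a | Interlace a b} :=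
  measurableSet_interlace measurable_id measurable_const

theorem measurableSet_interlace_right {m : ℕ} (a : Fin m → ℝ) :
    MeasurableSet {b | Interlace a b} :=
  measurableSet_interlace measurable_const measurable_id

theorem setLIntegral_interlace_pos_eq {m : ℕ} {b : Fin m → ℝ} (hb : ∀ i, 0 < b i) (s : ℝ) :
    ∫⁻ a in {a | Interlace a b ∧ ∀ i, 0 < a i},
      ENNReal.ofReal (vdm a * interKernel a b * (∏ i, a i) ^ (s - 1)) =
    ∫⁻ a in {a | Interlace a b},
      posPow s (∏ i, a i) * ENNReal.ofReal (vdm a * interKernel a b) := by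
  have hS : MeasurableSet {a | Interlace a b ∧ ∀ i, 0 < a i} :=
    (measurableSet_interlace_left b).inter measurableSet_forall_pos
  rw [← lintegral_indicator hS, ← lintegral_indicator (measurableSet_interlace_left b)]
  refine lintegral_congr fun a => ?_
  classical
  simp only [Set.indicator_apply, Set.mem_ofPred_eq]
  by_cases h : Interlace a b
  · by_cases hp : ∀ i, 0 < a i
    · have h' := (interlace_prod_pos_iff h hb).2 hp
      rw [if_pos ⟨h, hp⟩, if_pos h, posPow_of_pos s h', mul_comm,
        ENNReal.ofReal_mul (rpow_nonneg h'.le _)]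
    · rw [if_neg fun h' => hp h'.2, if_pos h, posPow_of_nonpos s
        (not_lt.1 fun h' => hp ((interlace_prod_pos_iff h hb).1 h')), zero_mul]
  · rw [if_neg fun h' => h h'.1, if_neg h]

theorem setLIntegral_interlace_negRev {m : ℕ} (b : Fin m → ℝ) {F : ℝ → ENNReal}
    (hF : Measurable F) :
    ∫⁻ a in {a | Interlace a b}, F (∏ i, a i) * ENNReal.ofReal (vdm a * interKernel a b) =
    ∫⁻ k in {k | Interlace (negRev b) k},
      F (∏ i, -k i) * ENNReal.ofReal (vdm k * interKernel (negRev b) k) := by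
  have hV := measurable_vdm (m := m)
  have hK : Measurable fun a => interKernel a b := by unfold interKernel; fun_prop
  have hG : Measurable fun a : Fin m → ℝ =>
      F (∏ i, a i) * ENNReal.ofReal (vdm a * interKernel a b) := by fun_prop
  have h : ∀ k : Fin m → ℝ, ∏ i, negRev k i = ∏ i, -k i :=
    fun k => Equiv.prod_comp Fin.revPerm (fun i => -k i)
  rw [← lintegral_indicator (measurableSet_interlace_left b),
    ← lintegral_indicator (measurableSet_interlace_right _),
    ← (measurePreserving_negRev m).lintegral_comp
      (hG.indicator (measurableSet_interlace_left b))]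
  refine lintegral_congr fun k => ?_
  classical
  simp only [Set.indicator_apply, Set.mem_ofPred_eq, interlace_negRev_left, vdm_negRev,
    interKernel_negRev_left, h]

theorem prod_neg_eigs_diagonal_negRev_add {m : ℕ} {b : Fin m → ℝ} (hb : ∀ i, 0 < b i)
    (v : Fin m → ℝ) :
    ∏ i, -eigs (diagonal (negRev b) + vecMulVec v v) i =
      (∏ i, b i) * (1 - ∑ i, v i ^ 2 / b (Fin.rev i)) := by
  have h4 : -(diagonal (negRev b) + vecMulVec v v) =
      diagonal (fun i => b (Fin.rev i)) + vecMulVec (-v) v := by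
    rw [neg_add, neg_vecMulVec, diagonal_neg]
    simp [negRev]
  have hprod : ∏ i, b (Fin.rev i) = ∏ i, b i := Equiv.prod_comp Fin.revPerm b
  have h5 := congrArg Matrix.det h4
  rw [det_neg, det_diagonal_add_vecMulVec fun i => (hb (Fin.rev i)).ne', det_eq_prod_eigs
    (isHermitian_add_vecMulVec (isHermitian_diagonal_real _) _), hprod] at h5
  rw [Finset.prod_neg, ← Fintype.card, h5, sub_eq_add_neg, ← Finset.sum_neg_distrib]
  congr 2
  exact Finset.sum_congr rfl fun i _ => by rw [Pi.neg_apply]; ring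

/-- A Dixon–Anderson type integral, where one of the interlacing points is `0`. -/
theorem lintegral_interlace_left {m : ℕ} {b : Fin m → ℝ} (hb : ∀ i, 0 < b i)
    (hb' : StrictAnti b) {s : ℝ} (hs : 0 < s) :
    ∫⁻ a in {a | Interlace a b ∧ ∀ i, 0 < a i},
      ENNReal.ofReal (vdm a * interKernel a b * (∏ i, a i) ^ (s - 1)) =
    ENNReal.ofReal ((∏ i, b i) ^ (s - 1 / 2)) *
      ENNReal.ofReal (π ^ ((m : ℝ) / 2) * Gamma s / Gamma (s + m / 2)) := by
  have hP := measurable_posPow s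
  have hprod : ∏ i, b (Fin.rev i) = ∏ i, b i := Equiv.prod_comp Fin.revPerm b
  have hnr : StrictAnti (negRev b) := fun i j hij => neg_lt_neg (hb' (Fin.rev_lt_rev.2 hij))
  have hbp : 0 < ∏ i, b i := Finset.prod_pos fun i _ => hb i
  have hm1 : Measurable fun k : Fin m → ℝ => posPow s (∏ i, -k i) := by fun_prop
  rw [setLIntegral_interlace_pos_eq hb, setLIntegral_interlace_negRev b hP,
    ← lintegral_eigs_diagonal_add_vecMulVec hnr hm1]
  simp only [prod_neg_eigs_diagonal_negRev_add hb, posPow_mul hbp]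
  rw [lintegral_const_mul _ (by fun_prop), lintegral_diagonal_mul (c := fun i => √(b (Fin.rev i)))
    (fun i => sqrt_pos.2 (hb _)) (by fun_prop), ← mul_assoc]
  have h6 : ∀ x : Fin m → ℝ, ∑ i, (√(b (Fin.rev i)) * x i) ^ 2 / b (Fin.rev i) = ∑ i, x i ^ 2 :=
    fun x => Finset.sum_congr rfl fun i _ => by
      rw [mul_pow, sq_sqrt (hb _).le, mul_div_cancel_left₀ _ (hb _).ne']
  simp only [h6]
  rw [lintegral_posPow_one_sub_sum_sq m hs, ← ENNReal.ofReal_mul (by positivity)]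
  congr 2
  have h7 : ∏ i, √(b (Fin.rev i)) = (∏ i, b i) ^ (1 / 2 : ℝ) := by
    simp only [sqrt_eq_rpow]
    rw [finsetProd_rpow _ _ fun i _ => (hb (Fin.rev i)).le, hprod]
  rw [h7, ← rpow_add hbp]
  congr 1; ring

theorem setLIntegral_setLIntegral_swap {α β : Type*} [MeasurableSpace α] [MeasurableSpace β]
    {μ : Measure α} {ν : Measure β} [SFinite μ] [SFinite ν] {R : Set (α × β)} {S : Set α}
    {T : Set β} (hR : MeasurableSet R) (hS : MeasurableSet S) (hT : MeasurableSet T)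
    (hRST : ∀ a b, (a, b) ∈ R → a ∈ S ∧ b ∈ T) {F : α → β → ENNReal}
    (hF : Measurable (Function.uncurry F)) :
    ∫⁻ a in S, ∫⁻ b in {b | (a, b) ∈ R}, F a b ∂ν ∂μ =
      ∫⁻ b in T, ∫⁻ a in {a | (a, b) ∈ R}, F a b ∂μ ∂ν := by
  have h1 : ∫⁻ a in S, ∫⁻ b in {b | (a, b) ∈ R}, F a b ∂ν ∂μ =
      ∫⁻ a, ∫⁻ b, R.indicator (Function.uncurry F) (a, b) ∂ν ∂μ := by
    rw [← lintegral_indicator hS]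
    refine lintegral_congr fun a => ?_
    by_cases ha : a ∈ S
    · rw [Set.indicator_of_mem ha,
        ← lintegral_indicator (s := {b | (a, b) ∈ R}) (measurable_prodMk_left hR)]
      rfl
    · rw [Set.indicator_of_notMem ha]
      symm
      rw [← lintegral_zero (μ := ν)]
      exact lintegral_congr fun b => Set.indicator_of_notMem (fun h => ha (hRST a b h).1) _
  have h2 : ∫⁻ b in T, ∫⁻ a in {a | (a, b) ∈ R}, F a b ∂μ ∂ν =
      ∫⁻ b, ∫⁻ a, R.indicator (Function.uncurry F) (a, b) ∂μ ∂ν := by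
    rw [← lintegral_indicator hT]
    refine lintegral_congr fun b => ?_
    by_cases hb : b ∈ T
    · rw [Set.indicator_of_mem hb,
        ← lintegral_indicator (s := {a | (a, b) ∈ R}) (measurable_prodMk_right hR)]
      rfl
    · rw [Set.indicator_of_notMem hb]
      symm
      rw [← lintegral_zero (μ := μ)]
      exact lintegral_congr fun a => Set.indicator_of_notMem (fun h => hb (hRST a b h).2) _
  rw [h1, h2]
  exact lintegral_lintegral_swap (hF.indicator hR).aemeasurable

theorem lintegral_pi_fin_succ {β : Type*} [MeasureSpace β] [SigmaFinite (volume : Measure β)]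
    {n : ℕ} {F : (Fin (n + 1) → β) → ENNReal} (hF : Measurable F) :
    ∫⁻ x, F x = ∫⁻ y : Fin n → β, ∫⁻ v, F (Fin.cons v y) := by
  have h := (volume_preserving_piFinSuccAbove (fun _ : Fin (n + 1) => β) 0).symm
  rw [← h.lintegral_comp hF, Measure.volume_eq_prod, lintegral_prod_symm'
    (fun z => F ((MeasurableEquiv.piFinSuccAbove (fun _ => β) 0).symm z)) (hF.comp h.measurable)]
  simp [MeasurableEquiv.piFinSuccAbove, Fin.insertNthEquiv]

theorem transpose_mul_self_cons {n m : ℕ} (v : Fin m → ℝ) (y : Fin n → Fin m → ℝ) :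
    (of (Fin.cons v y : Fin (n + 1) → Fin m → ℝ))ᵀ * of (Fin.cons v y : Fin (n + 1) → Fin m → ℝ) =
      (of y)ᵀ * of y + vecMulVec v v := by
  ext i j
  simp [mul_apply, Fin.sum_univ_succ, vecMulVec_apply, add_comm]

theorem measurable_transpose_mul_self_apply {n m : ℕ} (i j : Fin m) :
    Measurable fun y : Fin n → Fin m → ℝ => ((of y)ᵀ * of y) i j := by
  simp only [mul_apply, transpose_apply, of_apply]
  fun_prop

theorem isHermitian_transpose_mul_self_real {n m : ℕ} (X : Matrix (Fin n) (Fin m) ℝ) :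
    (Xᵀ * X).IsHermitian := by
  simpa using isHermitian_conjTranspose_mul_self X

theorem measurable_lintegral_eigs_diagonal_add {m : ℕ} {f : (Fin m → ℝ) → ENNReal}
    (hf : Measurable f) :
    Measurable fun a : Fin m → ℝ => ∫⁻ v, f (eigs (diagonal a + vecMulVec v v)) := by
  refine Measurable.lintegral_prod_right'
    (f := fun p : (Fin m → ℝ) × (Fin m → ℝ) => f (eigs (diagonal p.1 + vecMulVec p.2 p.2)))
    (hf.comp (measurable_eigs_add_vecMulVec ?_ (fun p => isHermitian_diagonal_real _)
      measurable_snd))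
  intro i j
  by_cases h : i = j
  · subst h; simp only [diagonal_apply_eq]; fun_prop
  · simp only [diagonal_apply_ne _ h]; fun_prop

/-- Splitting off the first row of `X` adds a rank one matrix to `Xᵀ * X`. -/
theorem lintegral_eigs_transpose_mul_self_succ {n m : ℕ} {f : (Fin m → ℝ) → ENNReal}
    (hf : Measurable f) :
    ∫⁻ X : Matrix (Fin (n + 1)) (Fin m) ℝ, f (eigs (Xᵀ * X)) =
      ∫⁻ Y : Matrix (Fin n) (Fin m) ℝ,
        ∫⁻ v, f (eigs (diagonal (eigs (Yᵀ * Y)) + vecMulVec v v)) := by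
  have hm : Measurable fun x : Fin (n + 1) → Fin m → ℝ => f (eigs ((of x)ᵀ * of x)) :=
    hf.comp (measurable_eigs_comp measurable_transpose_mul_self_apply
      fun x => isHermitian_transpose_mul_self_real _)
  refine (lintegral_pi_fin_succ hm).trans (lintegral_congr fun y => ?_)
  simp only [transpose_mul_self_cons]
  exact lintegral_eigs_add_vecMulVec (isHermitian_transpose_mul_self_real _) hf

theorem mvGamma_pos_s3 {n m : ℕ} (h : m ≤ n) : 0 < mvGamma m ((n : ℝ) / 2) := by
  refine mul_pos (rpow_pos_of_pos pi_pos _) (Finset.prod_pos fun i _ => Gamma_pos_of_pos ?_)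
  have : ((i : ℕ) : ℝ) < n := by exact_mod_cast i.isLt.trans_le h
  linarith

theorem mvGamma_succ_half_mul (n m : ℕ) :
    mvGamma m (((n + 1 : ℕ) : ℝ) / 2) * Gamma (((n : ℝ) - m + 1) / 2) =
      mvGamma m ((n : ℝ) / 2) * Gamma (((n : ℝ) + 1) / 2) := by
  have h := Fin.prod_univ_succ (fun i : Fin (m + 1) => Gamma (((n + 1 : ℕ) : ℝ) / 2 - (i : ℝ) / 2))
  rw [Fin.prod_univ_castSucc, mul_comm (Gamma _)] at h
  rw [mvGamma, mvGamma, mul_assoc, mul_assoc]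
  congr 1
  convert h using 2
  · rfl
  · congr 1; rw [Fin.val_last]; push_cast; ring
  · refine Finset.prod_congr rfl fun i _ => ?_
    congr 1; push_cast; simp; ring
  · congr 1; push_cast; simp

/-- The normalizing constant of the eigenvalue density of `Xᵀ * X`. -/
noncomputable def gramConst (n m : ℕ) : ℝ :=
  π ^ (((m * n + m ^ 2 : ℕ) : ℝ) / 2) / (mvGamma m ((n : ℝ) / 2) * mvGamma m ((m : ℝ) / 2))

theorem gramConst_nonneg {n m : ℕ} (h : m ≤ n) : 0 ≤ gramConst n m :=
  div_nonneg (rpow_nonneg pi_pos.le _) (mul_pos (mvGamma_pos_s3 h) (mvGamma_pos_s3 le_rfl)).le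

theorem gramConst_succ_left {n m : ℕ} (h : m ≤ n) :
    gramConst (n + 1) m = gramConst n m *
      (π ^ ((m : ℝ) / 2) * Gamma (((n : ℝ) - m + 1) / 2) / Gamma (((n : ℝ) + 1) / 2)) := by
  have h1 := mvGamma_succ_half_mul n m
  have h2 := (mvGamma_pos_s3 h).ne'
  have h3 := (mvGamma_pos_s3 (h.trans n.le_succ)).ne'
  have h4 := (mvGamma_pos_s3 (le_refl m)).ne'
  have h5 : Gamma (((n : ℝ) + 1) / 2) ≠ 0 := (Gamma_pos_of_pos (by positivity)).ne'
  have h6 : π ^ (((m * (n + 1) + m ^ 2 : ℕ) : ℝ) / 2) =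
      π ^ (((m * n + m ^ 2 : ℕ) : ℝ) / 2) * π ^ ((m : ℝ) / 2) := by
    rw [← rpow_add pi_pos]; congr 1; push_cast; ring
  rw [gramConst, gramConst, h6, div_mul_div_comm, div_eq_div_iff (mul_ne_zero h3 h4)
    (mul_ne_zero (mul_ne_zero h2 h4) h5)]
  linear_combination (-(π ^ (((m * n + m ^ 2 : ℕ) : ℝ) / 2) * π ^ ((m : ℝ) / 2) *
    mvGamma m ((m : ℝ) / 2))) * h1

/-- The eigenvalue density of `Xᵀ * X` for `X` distributed according to Lebesgue measure. -/
def GramFormula (n m : ℕ) : Prop :=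
  ∀ f : (Fin m → ℝ) → ENNReal, Measurable f →
    ∫⁻ X : Matrix (Fin n) (Fin m) ℝ, f (eigs (Xᵀ * X)) =
      ENNReal.ofReal (gramConst n m) * ∫⁻ a in {a : Fin m → ℝ | StrictAnti a ∧ ∀ i, 0 < a i},
        f a * ENNReal.ofReal ((∏ i, a i) ^ (((n : ℝ) - m - 1) / 2) * vdm a)

theorem measurableSet_strictAnti_pos {m : ℕ} :
    MeasurableSet {a : Fin m → ℝ | StrictAnti a ∧ ∀ i, 0 < a i} := by
  suffices h : MeasurableSet {a : Fin m → ℝ | StrictAnti a} from h.inter measurableSet_forall_pos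
  have : {a : Fin m → ℝ | StrictAnti a} =
      ⋂ i, ⋂ j, {a : Fin m → ℝ | i < j → a j < a i} := by
    ext a; simp [StrictAnti]
  rw [this]
  refine MeasurableSet.iInter fun i => MeasurableSet.iInter fun j => ?_
  by_cases h : i < j
  · simp only [h, true_imp_iff]
    exact measurableSet_lt (measurable_pi_apply j) (measurable_pi_apply i)
  · simp [h]

theorem interKernel_nonneg {m : ℕ} (a b : Fin m → ℝ) : 0 ≤ interKernel a b :=
  rpow_nonneg (Finset.prod_nonneg fun _ _ => Finset.prod_nonneg fun _ _ => abs_nonneg _) _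

theorem GramFormula.succ_left {n m : ℕ} (h : GramFormula n m) (hmn : m ≤ n) :
    GramFormula (n + 1) m := by
  intro f hf
  have hs : 0 < ((n : ℝ) - m + 1) / 2 := by
    have : (m : ℝ) ≤ n := by exact_mod_cast hmn
    linarith
  have hV := measurable_vdm (m := m)
  have hK := measurable_interKernel (m := m)
  set w : (Fin m → ℝ) → ENNReal :=
    fun a => ENNReal.ofReal ((∏ i, a i) ^ (((n : ℝ) - m - 1) / 2) * vdm a) with hw
  have hwm : Measurable w := by fun_prop
  set F : (Fin m → ℝ) → (Fin m → ℝ) → ENNReal :=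
    fun a b => f b * ENNReal.ofReal (vdm b * interKernel a b) * w a with hF
  have hFm : Measurable (Function.uncurry F) := by
    simp only [hF, Function.uncurry_def]
    fun_prop
  have hR : MeasurableSet {p : (Fin m → ℝ) × (Fin m → ℝ) | Interlace p.1 p.2 ∧ ∀ i, 0 < p.1 i} :=
    (measurableSet_interlace measurable_fst measurable_snd).inter
      (measurable_fst measurableSet_forall_pos)
  have h1 : ∫⁻ a in {a : Fin m → ℝ | StrictAnti a ∧ ∀ i, 0 < a i},
      (∫⁻ v, f (eigs (diagonal a + vecMulVec v v))) * w a =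
      ∫⁻ a in {a : Fin m → ℝ | StrictAnti a ∧ ∀ i, 0 < a i},
        ∫⁻ b in {b | (a, b) ∈ {p : (Fin m → ℝ) × (Fin m → ℝ) |
          Interlace p.1 p.2 ∧ ∀ i, 0 < p.1 i}}, F a b := by
    refine setLIntegral_congr_fun measurableSet_strictAnti_pos fun a ha => ?_
    have h2 : {b | (a, b) ∈ {p : (Fin m → ℝ) × (Fin m → ℝ) |
        Interlace p.1 p.2 ∧ ∀ i, 0 < p.1 i}} = {b | Interlace a b} :=
      Set.ext fun b => ⟨fun hb => hb.1, fun hb => ⟨hb, ha.2⟩⟩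
    have hKa : Measurable fun b => interKernel a b := by unfold interKernel; fun_prop
    rw [h2, lintegral_eigs_diagonal_add_vecMulVec ha.1 hf, ← lintegral_mul_const _ (by fun_prop)]
  have h3 : ∀ b ∈ {b : Fin m → ℝ | StrictAnti b ∧ ∀ i, 0 < b i},
      ∫⁻ a in {a | (a, b) ∈ {p : (Fin m → ℝ) × (Fin m → ℝ) |
          Interlace p.1 p.2 ∧ ∀ i, 0 < p.1 i}}, F a b =
      ENNReal.ofReal (π ^ ((m : ℝ) / 2) * Gamma (((n : ℝ) - m + 1) / 2) /
        Gamma (((n : ℝ) + 1) / 2)) *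
      (f b * ENNReal.ofReal ((∏ i, b i) ^ ((((n + 1 : ℕ) : ℝ) - m - 1) / 2) * vdm b)) := by
    intro b hb
    have hKb : Measurable fun a => interKernel a b := by unfold interKernel; fun_prop
    have h4 : ∀ a, F a b = f b * ENNReal.ofReal (vdm b) *
        ENNReal.ofReal (vdm a * interKernel a b *
          (∏ i, a i) ^ (((n : ℝ) - m + 1) / 2 - 1)) := by
      intro a
      have h5 : vdm a * interKernel a b * (∏ i, a i) ^ (((n : ℝ) - m + 1) / 2 - 1) =
          interKernel a b * ((∏ i, a i) ^ (((n : ℝ) - m - 1) / 2) * vdm a) := by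
        rw [show ((n : ℝ) - m + 1) / 2 - 1 = ((n : ℝ) - m - 1) / 2 by ring]; ring
      rw [h5, ENNReal.ofReal_mul (interKernel_nonneg a b), hF]
      simp only [hw]
      rw [ENNReal.ofReal_mul (vdm_pos hb.1).le]
      ring
    simp only [h4]
    rw [lintegral_const_mul _ (by fun_prop)]
    have h6 := lintegral_interlace_left hb.2 hb.1 hs
    refine (congrArg _ h6).trans ?_
    rw [show ((n : ℝ) - m + 1) / 2 - 1 / 2 = (((n + 1 : ℕ) : ℝ) - m - 1) / 2 by push_cast; ring,
      show ((n : ℝ) - m + 1) / 2 + m / 2 = ((n : ℝ) + 1) / 2 by ring,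
      ENNReal.ofReal_mul (rpow_nonneg (Finset.prod_nonneg fun i _ => (hb.2 i).le) _)]
    ring
  rw [lintegral_eigs_transpose_mul_self_succ hf, h _ (measurable_lintegral_eigs_diagonal_add hf),
    h1, setLIntegral_setLIntegral_swap hR measurableSet_strictAnti_pos measurableSet_strictAnti_pos
      (fun a b hab => ⟨⟨hab.1.strictAnti_left, hab.2⟩, hab.1.strictAnti_right,
        fun i => (hab.2 i).trans (hab.1.1 i i le_rfl)⟩) hFm,
    setLIntegral_congr_fun measurableSet_strictAnti_pos h3, lintegral_const_mul _ (by fun_prop),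
    ← mul_assoc, ← ENNReal.ofReal_mul (gramConst_nonneg hmn), gramConst_succ_left hmn]

theorem measurePreserving_transpose (n m : ℕ) :
    MeasurePreserving (fun (x : Fin n → Fin m → ℝ) j i => x i j) volume volume := by
  have hT : Measurable fun (x : Fin n → Fin m → ℝ) (j : Fin m) (i : Fin n) => x i j := by fun_prop
  refine ⟨hT, ?_⟩
  symm
  refine Measure.pi_eq_generateFrom
    (C := fun _ => Set.univ.pi '' Set.univ.pi fun _ : Fin n => {s : Set ℝ | MeasurableSet s})
    (fun _ => generateFrom_pi) (fun _ => isPiSystem_pi)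
    (fun _ => Measure.FiniteSpanningSetsIn.pi fun _ => Measure.toFiniteSpanningSetsIn volume)
    fun s hs => ?_
  choose t ht hst using hs
  have ht' : ∀ j i, MeasurableSet (t j i) := fun j i => ht j i (Set.mem_univ i)
  have hs : MeasurableSet (Set.univ.pi s) := MeasurableSet.univ_pi fun j => by
    rw [← hst j]; exact MeasurableSet.univ_pi (ht' j)
  have hpre : (fun (x : Fin n → Fin m → ℝ) (j : Fin m) (i : Fin n) => x i j) ⁻¹' Set.univ.pi s =
      Set.univ.pi fun i => Set.univ.pi fun j => t j i := by
    ext x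
    simp only [Set.mem_preimage, Set.mem_univ_pi, ← hst]
    exact forall_comm
  rw [Measure.map_apply hT hs, hpre]
  simp only [← hst, volume_pi_pi, Measure.pi_pi]
  exact Finset.prod_comm

theorem natCast_mul_pred (m : ℕ) : ((m * (m - 1) : ℕ) : ℝ) = m * (m - 1) := by
  cases m <;> simp

theorem mvGamma_succ (m : ℕ) (a : ℝ) :
    mvGamma (m + 1) a = π ^ ((m : ℝ) / 2) * (mvGamma m a * Gamma (a - m / 2)) := by
  have h : π ^ ((((m + 1) * (m + 1 - 1) : ℕ) : ℝ) / 4) =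
      π ^ ((m : ℝ) / 2) * π ^ (((m * (m - 1) : ℕ) : ℝ) / 4) := by
    rw [← rpow_add pi_pos, natCast_mul_pred, natCast_mul_pred]
    congr 1; push_cast; ring
  rw [mvGamma, mvGamma, h, Fin.prod_univ_castSucc]
  simp only [Fin.val_castSucc, Fin.val_last]
  ring

theorem mvGamma_succ' (m : ℕ) (a : ℝ) :
    mvGamma (m + 1) a = π ^ ((m : ℝ) / 2) * (Gamma a * mvGamma m (a - 1 / 2)) := by
  have h : π ^ ((((m + 1) * (m + 1 - 1) : ℕ) : ℝ) / 4) =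
      π ^ ((m : ℝ) / 2) * π ^ (((m * (m - 1) : ℕ) : ℝ) / 4) := by
    rw [← rpow_add pi_pos, natCast_mul_pred, natCast_mul_pred]
    congr 1; push_cast; ring
  have h' : ∀ i : Fin m, a - ((i.succ : ℕ) : ℝ) / 2 = a - 1 / 2 - (i : ℕ) / 2 := fun i => by
    rw [Fin.val_succ]; push_cast; ring
  rw [mvGamma, mvGamma, h, Fin.prod_univ_succ]
  simp only [h', Fin.val_zero, Nat.cast_zero, zero_div, sub_zero]
  ring

theorem gramConst_succ_succ (m : ℕ) :
    gramConst (m + 1) (m + 1) = gramConst (m + 1) m *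
      (π ^ ((m : ℝ) / 2) * Gamma (1 / 2) / Gamma (1 / 2 + m / 2)) := by
  have h1 := mvGamma_succ m (((m + 1 : ℕ) : ℝ) / 2)
  have h2 := mvGamma_succ' m (((m + 1 : ℕ) : ℝ) / 2)
  rw [show ((m + 1 : ℕ) : ℝ) / 2 - m / 2 = 1 / 2 by push_cast; ring] at h1
  rw [show ((m + 1 : ℕ) : ℝ) / 2 - 1 / 2 = m / 2 by push_cast; ring] at h2
  have h3 := (mvGamma_pos_s3 (m.le_succ)).ne'
  have h4 := (mvGamma_pos_s3 (le_refl m)).ne'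
  have h5 : Gamma (((m + 1 : ℕ) : ℝ) / 2) ≠ 0 := (Gamma_pos_of_pos (by positivity)).ne'
  have h6 : Gamma (1 / 2) ≠ 0 := (Gamma_pos_of_pos (by norm_num)).ne'
  have h7 : π ^ ((m : ℝ) / 2) ≠ 0 := (rpow_pos_of_pos pi_pos _).ne'
  have h8 : Gamma (1 / 2) ^ 2 = π := by rw [Gamma_one_half_eq, sq_sqrt pi_pos.le]
  have h9 : π ^ ((((m + 1) * (m + 1) + (m + 1) ^ 2 : ℕ) : ℝ) / 2) =
      π ^ (((m * (m + 1) + m ^ 2 : ℕ) : ℝ) / 2) * π ^ ((m : ℝ) / 2) * π ^ ((m : ℝ) / 2) *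
        π ^ ((m : ℝ) / 2) * π := by
    nth_rw 6 [← rpow_one π]
    rw [← rpow_add pi_pos, ← rpow_add pi_pos, ← rpow_add pi_pos, ← rpow_add pi_pos]
    congr 1; push_cast; ring
  rw [gramConst, gramConst, h9]
  nth_rw 1 [h1]
  rw [h2, show (1 / 2 + m / 2 : ℝ) = ((m + 1 : ℕ) : ℝ) / 2 by push_cast; ring]
  nth_rw 5 [← h8]
  rw [div_mul_div_comm, div_eq_div_iff (by simp_all) (by simp_all)]
  ring

theorem gramFormula_zero : GramFormula 0 0 := by
  intro f hf
  have h1 : gramConst 0 0 = 1 := by simp [gramConst, mvGamma]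
  have h2 : {a : Fin 0 → ℝ | StrictAnti a ∧ ∀ i, 0 < a i} = Set.univ :=
    Set.eq_univ_of_forall fun a => ⟨Subsingleton.strictAnti a, fun i => i.elim0⟩
  have h3 : (volume : Measure (Fin 0 → ℝ)) = Measure.dirac 0 := Measure.pi_of_empty _ _
  have h4 : (volume : Measure (Matrix (Fin 0) (Fin 0) ℝ)) =
      Measure.dirac (0 : Fin 0 → Fin 0 → ℝ) := Measure.pi_of_empty _ _
  have h5 : ∀ a b : Fin 0 → ℝ, f a = f b := fun a b => congrArg f (Subsingleton.elim _ _)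
  rw [h1, h2, h3, Measure.restrict_univ, lintegral_dirac]
  have h6 : (volume : Measure (Matrix (Fin 0) (Fin 0) ℝ)) Set.univ = 1 := by
    rw [h4]; exact Measure.dirac_apply_of_mem (Set.mem_univ _)
  rw [lintegral_congr fun X => h5 _ 0, lintegral_const, h6]
  simp [vdm]

theorem eigs_nonneg {n m : ℕ} (X : Matrix (Fin n) (Fin m) ℝ) (i : Fin m) :
    0 ≤ eigs (Xᵀ * X) i := by
  rw [← sortedEigs_eq_eigs]
  exact (posSemidef_conjTranspose_mul_self X).eigenvalues_nonneg _

theorem eigs_mul_transpose_self {m : ℕ} (Z : Matrix (Fin (m + 1)) (Fin m) ℝ) :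
    eigs (Z * Zᵀ) = Fin.snoc (α := fun _ => ℝ) (eigs (Zᵀ * Z)) 0 := by
  have hH : (Z * Zᵀ).IsHermitian := by simpa using isHermitian_mul_conjTranspose_self Z
  refine eigs_eq_of_charpoly hH ?_ ?_
  · intro i j hij
    induction j using Fin.lastCases with
    | last =>
      induction i using Fin.lastCases with
      | last => exact le_rfl
      | cast i => simpa using eigs_nonneg Z i
    | cast j =>
      induction i using Fin.lastCases with
      | last => exact absurd (j.castSucc_lt_last) (not_lt.2 hij)
      | cast i => simpa using eigs_antitone _ (Fin.castSucc_le_castSucc_iff.1 hij)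
  · rw [charpoly_mul_comm_of_le _ _ (by simp),
      charpoly_eq_prod_eigs (isHermitian_transpose_mul_self_real Z), Fin.prod_univ_castSucc]
    simp [mul_comm]

theorem interlace_snoc_zero_iff {m : ℕ} {a : Fin m → ℝ} {b : Fin (m + 1) → ℝ}
    (hb : ∀ i, 0 < b i) :
    (Interlace (Fin.snoc (α := fun _ => ℝ) a 0) b ∧ ∀ i, 0 < a i) ↔
      Interlace (fun i => a i - b (Fin.last m)) (fun i => b i.castSucc - b (Fin.last m)) ∧
        ∀ i, 0 < a i - b (Fin.last m) := by
  constructor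
  · rintro ⟨⟨h1, h2⟩, -⟩
    refine ⟨⟨fun i j hij => ?_, fun i j hij => ?_⟩, fun i => ?_⟩
    · have := h1 i.castSucc j.castSucc (Fin.castSucc_le_castSucc_iff.2 hij)
      rw [Fin.snoc_castSucc] at this
      exact sub_lt_sub_right this _
    · have := h2 i.castSucc j.castSucc (Fin.castSucc_lt_castSucc_iff.2 hij)
      rw [Fin.snoc_castSucc] at this
      exact sub_lt_sub_right this _
    · have := h2 i.castSucc (Fin.last m) i.castSucc_lt_last
      rw [Fin.snoc_castSucc] at this
      exact sub_pos.2 this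
  · rintro ⟨⟨h1, h2⟩, h3⟩
    refine ⟨⟨fun i j hij => ?_, fun i j hij => ?_⟩, fun i => (hb _).trans (sub_pos.1 (h3 i))⟩
    · induction j using Fin.lastCases with
      | last => rw [Fin.snoc_last]; exact hb i
      | cast j =>
        induction i using Fin.lastCases with
        | last => exact absurd (j.castSucc_lt_last) (not_lt.2 hij)
        | cast i =>
          rw [Fin.snoc_castSucc]
          exact (sub_lt_sub_iff_right _).1 (h1 i j (Fin.castSucc_le_castSucc_iff.1 hij))
    · induction i using Fin.lastCases with
      | last => exact absurd hij (not_lt.2 (Fin.le_last j))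
      | cast i =>
        rw [Fin.snoc_castSucc]
        induction j using Fin.lastCases with
        | last => exact sub_pos.1 (h3 i)
        | cast j => exact (sub_lt_sub_iff_right _).1 (h2 i j (Fin.castSucc_lt_castSucc_iff.1 hij))

theorem interKernel_snoc_zero {m : ℕ} {a : Fin m → ℝ} {b : Fin (m + 1) → ℝ}
    (hb : ∀ i, 0 < b i) (ha : ∀ i, 0 < a i - b (Fin.last m)) :
    interKernel (Fin.snoc (α := fun _ => ℝ) a 0) b = (∏ i, b i) ^ (-(1 / 2) : ℝ) *
      (interKernel (fun i => a i - b (Fin.last m)) (fun i => b i.castSucc - b (Fin.last m)) *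
        (∏ i, (a i - b (Fin.last m))) ^ ((1 / 2 : ℝ) - 1)) := by
  have h1 : ∀ i j : Fin m, a i - b (Fin.last m) - (b j.castSucc - b (Fin.last m)) =
      a i - b j.castSucc := fun i j => sub_sub_sub_cancel_right _ _ _
  have h2 : ∏ i, ∏ j, |(Fin.snoc (α := fun _ => ℝ) a 0 : Fin (m + 1) → ℝ) i - b j| =
      (∏ i, b i) * ((∏ i, ∏ j : Fin m, |a i - b j.castSucc|) *
        ∏ i, (a i - b (Fin.last m))) := by
    rw [Fin.prod_univ_castSucc, mul_comm]
    simp only [Fin.snoc_last, Fin.snoc_castSucc, zero_sub, abs_neg, abs_of_pos (hb _)]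
    congr 1
    rw [← Finset.prod_mul_distrib]
    refine Finset.prod_congr rfl fun i _ => ?_
    rw [Fin.prod_univ_castSucc, abs_of_pos (ha i)]
  have h3 : 0 ≤ ∏ i, ∏ j : Fin m, |a i - b j.castSucc| :=
    Finset.prod_nonneg fun _ _ => Finset.prod_nonneg fun _ _ => abs_nonneg _
  have h4 : 0 ≤ ∏ i, (a i - b (Fin.last m)) := Finset.prod_nonneg fun i _ => (ha i).le
  rw [interKernel, interKernel, h2, mul_rpow (Finset.prod_nonneg fun i _ => (hb i).le)
    (mul_nonneg h3 h4), mul_rpow h3 h4]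
  simp only [h1]
  norm_num

/-- The Dixon–Anderson integral. -/
theorem lintegral_interlace_snoc_zero {m : ℕ} {b : Fin (m + 1) → ℝ} (hb : ∀ i, 0 < b i)
    (hb' : StrictAnti b) :
    ∫⁻ a in {a : Fin m → ℝ | Interlace (Fin.snoc (α := fun _ => ℝ) a 0) b ∧ ∀ i, 0 < a i},
      ENNReal.ofReal (interKernel (Fin.snoc (α := fun _ => ℝ) a 0) b * vdm a) =
    ENNReal.ofReal ((∏ i, b i) ^ (-(1 / 2) : ℝ)) *
      ENNReal.ofReal (π ^ ((m : ℝ) / 2) * Gamma (1 / 2) / Gamma (1 / 2 + m / 2)) := by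
  set t := b (Fin.last m) with ht
  set c : Fin m → ℝ := fun i => b i.castSucc - t with hc
  have hc0 : ∀ i, 0 < c i := fun i => sub_pos.2 (hb' i.castSucc_lt_last)
  have hc1 : StrictAnti c := fun i j hij =>
    sub_lt_sub_right (hb' (Fin.castSucc_lt_castSucc_iff.2 hij)) t
  have hmc : MeasurableSet {x : Fin m → ℝ | Interlace x c ∧ ∀ i, 0 < x i} :=
    (measurableSet_interlace_left c).inter measurableSet_forall_pos
  have hset : {a : Fin m → ℝ | Interlace (Fin.snoc (α := fun _ => ℝ) a 0) b ∧ ∀ i, 0 < a i} =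
      {a | (fun i => a i - t) ∈ {x : Fin m → ℝ | Interlace x c ∧ ∀ i, 0 < x i}} :=
    Set.ext fun a => interlace_snoc_zero_iff hb
  have hsub : MeasurePreserving (fun (a : Fin m → ℝ) i => a i - t) volume volume := by
    simpa [sub_eq_add_neg, Pi.add_def] using
      measurePreserving_add_right (volume : Measure (Fin m → ℝ)) (fun _ => -t)
  have h0 : (∏ i, b i) ^ (-(1 / 2) : ℝ) ≥ 0 :=
    rpow_nonneg (Finset.prod_nonneg fun i _ => (hb i).le) _
  have hV := measurable_vdm (m := m)
  have hK : Measurable fun x => interKernel x c := by unfold interKernel; fun_prop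
  set G : (Fin m → ℝ) → ENNReal := fun x => ENNReal.ofReal ((∏ i, b i) ^ (-(1 / 2) : ℝ)) *
    ENNReal.ofReal (vdm x * interKernel x c * (∏ i, x i) ^ ((1 / 2 : ℝ) - 1)) with hG
  have hmG : Measurable G := by fun_prop
  have h1 : ∀ a ∈ {a : Fin m → ℝ | Interlace (Fin.snoc (α := fun _ => ℝ) a 0) b ∧ ∀ i, 0 < a i},
      ENNReal.ofReal (interKernel (Fin.snoc (α := fun _ => ℝ) a 0) b * vdm a) = G (fun i => a i - t) := by
    intro a ha
    have h2 : vdm (fun i => a i - t) = vdm a := by simp [vdm]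
    have h3 := ((interlace_snoc_zero_iff hb).1 ha).2
    simp only [hG, h2]
    rw [← ENNReal.ofReal_mul h0, interKernel_snoc_zero hb h3]
    congr 1; ring
  have hmS : MeasurableSet {a : Fin m → ℝ |
      Interlace (Fin.snoc (α := fun _ => ℝ) a 0) b ∧ ∀ i, 0 < a i} := by
    rw [hset]; exact hsub.measurable hmc
  rw [setLIntegral_congr_fun hmS h1, hset]
  refine (hsub.setLIntegral_comp_preimage hmc hmG).trans ?_
  rw [lintegral_const_mul _ (by fun_prop), lintegral_interlace_left hc0 hc1 one_half_pos]
  simp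

theorem measurable_snoc_zero {m : ℕ} :
    Measurable fun a : Fin m → ℝ => (Fin.snoc (α := fun _ => ℝ) a 0 : Fin (m + 1) → ℝ) := by
  refine measurable_pi_lambda _ fun i => ?_
  induction i using Fin.lastCases with
  | last => simp
  | cast i => simpa using measurable_pi_apply i

theorem lintegral_eigs_transpose_mul_self_square {m : ℕ} {f : (Fin (m + 1) → ℝ) → ENNReal}
    (hf : Measurable f) :
    ∫⁻ X : Matrix (Fin (m + 1)) (Fin (m + 1)) ℝ, f (eigs (Xᵀ * X)) =
      ∫⁻ Z : Matrix (Fin (m + 1)) (Fin m) ℝ, ∫⁻ v,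
        f (eigs (diagonal (Fin.snoc (α := fun _ => ℝ) (eigs (Zᵀ * Z)) 0) + vecMulVec v v)) := by
  have hm : Measurable fun Y : Fin m → Fin (m + 1) → ℝ =>
      ∫⁻ v, f (eigs (diagonal (eigs ((of Y)ᵀ * of Y)) + vecMulVec v v)) :=
    (measurable_lintegral_eigs_diagonal_add hf).comp (measurable_eigs_comp
      measurable_transpose_mul_self_apply fun x => isHermitian_transpose_mul_self_real _)
  rw [lintegral_eigs_transpose_mul_self_succ hf]
  refine ((measurePreserving_transpose (m + 1) m).lintegral_comp hm).symm.trans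
    (lintegral_congr fun Z => ?_)
  exact congrArg (fun a => ∫⁻ v, f (eigs (diagonal a + vecMulVec v v)))
    (eigs_mul_transpose_self Z)

theorem GramFormula.succ_right {m : ℕ} (h : GramFormula (m + 1) m) :
    GramFormula (m + 1) (m + 1) := by
  intro f hf
  have hV := measurable_vdm (m := m)
  have hV' := measurable_vdm (m := m + 1)
  have hS := measurable_snoc_zero (m := m)
  have hK : Measurable fun p : (Fin m → ℝ) × (Fin (m + 1) → ℝ) =>
      interKernel (Fin.snoc (α := fun _ => ℝ) p.1 0) p.2 :=
    (measurable_interKernel (m := m + 1)).comp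
      (f := fun p : (Fin m → ℝ) × (Fin (m + 1) → ℝ) =>
        ((Fin.snoc (α := fun _ => ℝ) p.1 0 : Fin (m + 1) → ℝ), p.2)) (by fun_prop)
  set F : (Fin m → ℝ) → (Fin (m + 1) → ℝ) → ENNReal := fun a b =>
    f b * ENNReal.ofReal (vdm b * interKernel (Fin.snoc (α := fun _ => ℝ) a 0) b) *
      ENNReal.ofReal (vdm a) with hF
  have hFm : Measurable (Function.uncurry F) := by
    simp only [hF, Function.uncurry_def]
    fun_prop
  have hR : MeasurableSet {p : (Fin m → ℝ) × (Fin (m + 1) → ℝ) |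
      Interlace (Fin.snoc (α := fun _ => ℝ) p.1 0) p.2 ∧ ∀ i, 0 < p.1 i} :=
    (measurableSet_interlace (hS.comp measurable_fst) measurable_snd).inter
      (measurable_fst measurableSet_forall_pos)
  have hRST : ∀ (a : Fin m → ℝ) (b : Fin (m + 1) → ℝ), (a, b) ∈
      {p : (Fin m → ℝ) × (Fin (m + 1) → ℝ) |
        Interlace (Fin.snoc (α := fun _ => ℝ) p.1 0) p.2 ∧ ∀ i, 0 < p.1 i} →
      a ∈ {a : Fin m → ℝ | StrictAnti a ∧ ∀ i, 0 < a i} ∧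
        b ∈ {b : Fin (m + 1) → ℝ | StrictAnti b ∧ ∀ i, 0 < b i} := by
    rintro a b ⟨h1, h2⟩
    refine ⟨⟨fun i j hij => ?_, h2⟩, h1.strictAnti_right, fun i => ?_⟩
    · simpa using h1.strictAnti_left (Fin.castSucc_lt_castSucc_iff.2 hij)
    · simpa using h1.1 i (Fin.last m) (Fin.le_last i)
  have h1 : ∀ a ∈ {a : Fin m → ℝ | StrictAnti a ∧ ∀ i, 0 < a i},
      (∫⁻ v, f (eigs (diagonal (Fin.snoc (α := fun _ => ℝ) a 0) + vecMulVec v v))) *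
        ENNReal.ofReal ((∏ i, a i) ^ ((((m + 1 : ℕ) : ℝ) - m - 1) / 2) * vdm a) =
      ∫⁻ b in {b | (a, b) ∈ {p : (Fin m → ℝ) × (Fin (m + 1) → ℝ) |
        Interlace (Fin.snoc (α := fun _ => ℝ) p.1 0) p.2 ∧ ∀ i, 0 < p.1 i}}, F a b := by
    intro a ha
    have h2 : {b | (a, b) ∈ {p : (Fin m → ℝ) × (Fin (m + 1) → ℝ) |
        Interlace (Fin.snoc (α := fun _ => ℝ) p.1 0) p.2 ∧ ∀ i, 0 < p.1 i}} =
        {b | Interlace (Fin.snoc (α := fun _ => ℝ) a 0) b} :=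
      Set.ext fun b => ⟨fun hb => hb.1, fun hb => ⟨hb, ha.2⟩⟩
    have hKa : Measurable fun b => interKernel (Fin.snoc (α := fun _ => ℝ) a 0) b := by
      unfold interKernel; fun_prop
    have hsa : StrictAnti (Fin.snoc (α := fun _ => ℝ) a 0 : Fin (m + 1) → ℝ) := by
      intro i j hij
      induction i using Fin.lastCases with
      | last => exact absurd hij (not_lt.2 (Fin.le_last j))
      | cast i =>
        induction j using Fin.lastCases with
        | last => simpa using ha.2 i
        | cast j => simpa using ha.1 (Fin.castSucc_lt_castSucc_iff.1 hij)
    rw [h2, lintegral_eigs_diagonal_add_vecMulVec hsa hf, ← lintegral_mul_const _ (by fun_prop),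
      show (((m + 1 : ℕ) : ℝ) - m - 1) / 2 = 0 by push_cast; ring, rpow_zero, one_mul]
  have h3 : ∀ b ∈ {b : Fin (m + 1) → ℝ | StrictAnti b ∧ ∀ i, 0 < b i},
      ∫⁻ a in {a | (a, b) ∈ {p : (Fin m → ℝ) × (Fin (m + 1) → ℝ) |
        Interlace (Fin.snoc (α := fun _ => ℝ) p.1 0) p.2 ∧ ∀ i, 0 < p.1 i}}, F a b =
      ENNReal.ofReal (π ^ ((m : ℝ) / 2) * Gamma (1 / 2) / Gamma (1 / 2 + m / 2)) *
      (f b * ENNReal.ofReal ((∏ i, b i) ^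
        ((((m + 1 : ℕ) : ℝ) - ((m + 1 : ℕ) : ℝ) - 1) / 2) * vdm b)) := by
    intro b hb
    have hKb : Measurable fun a => interKernel (Fin.snoc (α := fun _ => ℝ) a 0) b :=
      hK.comp (f := fun a => (a, b)) (by fun_prop)
    have h4 : ∀ a, F a b = f b * ENNReal.ofReal (vdm b) *
        ENNReal.ofReal (interKernel (Fin.snoc (α := fun _ => ℝ) a 0) b * vdm a) := by
      intro a
      rw [ENNReal.ofReal_mul (interKernel_nonneg _ b), hF]
      simp only
      rw [ENNReal.ofReal_mul (vdm_pos hb.1).le]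
      ring
    simp only [h4]
    rw [lintegral_const_mul _ (by fun_prop)]
    refine (congrArg _ (lintegral_interlace_snoc_zero hb.2 hb.1)).trans ?_
    rw [show (((m + 1 : ℕ) : ℝ) - ((m + 1 : ℕ) : ℝ) - 1) / 2 = -(1 / 2) by ring,
      ENNReal.ofReal_mul (rpow_nonneg (Finset.prod_nonneg fun i _ => (hb.2 i).le) _)]
    ring
  rw [lintegral_eigs_transpose_mul_self_square hf,
    h (fun a => ∫⁻ v, f (eigs (diagonal (Fin.snoc (α := fun _ => ℝ) a 0) + vecMulVec v v)))
      ((measurable_lintegral_eigs_diagonal_add hf).comp hS),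
    setLIntegral_congr_fun measurableSet_strictAnti_pos h1,
    setLIntegral_setLIntegral_swap hR measurableSet_strictAnti_pos measurableSet_strictAnti_pos
      hRST hFm,
    setLIntegral_congr_fun measurableSet_strictAnti_pos h3, lintegral_const_mul _ (by fun_prop),
    ← mul_assoc, ← ENNReal.ofReal_mul (gramConst_nonneg m.le_succ), ← gramConst_succ_succ]

theorem gramFormula {n m : ℕ} (h : m ≤ n) : GramFormula n m := by
  have hsq : ∀ m, GramFormula m m := fun m => by
    induction m with
    | zero => exact gramFormula_zero
    | succ m ih => exact (ih.succ_left le_rfl).succ_right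
  induction n, h using Nat.le_induction with
  | base => exact hsq m
  | succ n hn ih => exact ih.succ_left hn

theorem hasFDerivAt_sq_pi {m : ℕ} (α : Fin m → ℝ) :
    HasFDerivAt (fun (x : Fin m → ℝ) i => x i ^ 2)
      (Matrix.toLin' (diagonal fun i => 2 * α i)).toContinuousLinearMap α := by
  rw [hasFDerivAt_pi']
  intro i
  have h := (hasFDerivAt_apply (𝕜 := ℝ) (F' := fun _ : Fin m => ℝ) i α).pow 2
  refine h.congr_fderiv ?_
  ext w
  simp [mulVec_diagonal]

theorem image_sq_strictAnti_pos {m : ℕ} :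
    (fun (x : Fin m → ℝ) i => x i ^ 2) '' {α : Fin m → ℝ | StrictAnti α ∧ ∀ i, 0 < α i} =
      {α : Fin m → ℝ | StrictAnti α ∧ ∀ i, 0 < α i} := by
  ext a
  constructor
  · rintro ⟨α, ⟨h1, h2⟩, rfl⟩
    exact ⟨fun i j hij => pow_lt_pow_left₀ (h1 hij) (h2 j).le two_ne_zero, fun i => pow_pos (h2 i) 2⟩
  · rintro ⟨h1, h2⟩
    exact ⟨fun i => √(a i), ⟨fun i j hij => sqrt_lt_sqrt (h2 j).le (h1 hij),
      fun i => sqrt_pos.2 (h2 i)⟩, funext fun i => sq_sqrt (h2 i).le⟩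

theorem setLIntegral_strictAnti_pos_sq {m : ℕ} (g : (Fin m → ℝ) → ENNReal) :
    ∫⁻ a in {a : Fin m → ℝ | StrictAnti a ∧ ∀ i, 0 < a i}, g a =
      ∫⁻ α in {α : Fin m → ℝ | StrictAnti α ∧ ∀ i, 0 < α i},
        ENNReal.ofReal (2 ^ m * ∏ i, α i) * g (fun i => α i ^ 2) := by
  have hinj : Set.InjOn (fun (x : Fin m → ℝ) i => x i ^ 2)
      {α : Fin m → ℝ | StrictAnti α ∧ ∀ i, 0 < α i} := fun x hx y hy hxy =>
    funext fun i => (pow_left_inj₀ (hx.2 i).le (hy.2 i).le two_ne_zero).1 (congrFun hxy i)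
  conv_lhs => rw [← image_sq_strictAnti_pos]
  rw [lintegral_image_eq_lintegral_abs_det_fderiv_mul volume measurableSet_strictAnti_pos
    (fun α _ => (hasFDerivAt_sq_pi α).hasFDerivWithinAt) hinj]
  refine setLIntegral_congr_fun measurableSet_strictAnti_pos fun α hα => ?_
  have h : 0 < ∏ i, α i := Finset.prod_pos fun i _ => hα.2 i
  simp only [LinearMap.det_toContinuousLinearMap, LinearMap.det_toLin', det_diagonal,
    Finset.prod_mul_distrib, Finset.prod_const, Finset.card_univ, Fintype.card_fin]
  rw [abs_of_pos (by positivity)]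

theorem svalues_eq {n m : ℕ} (X : Matrix (Fin n) (Fin m) ℝ) :
    svalues X = fun i => √(eigs (Xᵀ * X) i) := by
  unfold svalues
  rw [sortedEigs_eq_eigs]

theorem prod_mul_prod_sq_rpow {n m : ℕ} (hmn : m ≤ n) {α : Fin m → ℝ} (hα : ∀ i, 0 < α i) :
    (∏ i, α i) * (∏ i, α i ^ 2) ^ (((n : ℝ) - m - 1) / 2) = ∏ i, α i ^ (n - m) := by
  have h : 0 < ∏ i, α i := Finset.prod_pos fun i _ => hα i
  rw [Finset.prod_pow, Finset.prod_pow, ← rpow_natCast, ← rpow_natCast, ← rpow_mul h.le]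
  nth_rw 1 [← rpow_one (∏ i, α i)]
  rw [← rpow_add h, Nat.cast_sub hmn]
  congr 1; push_cast; ring

/-- the singular value decomposition integral formula:
`∫ h(σ₁(X),…,σ_m(X)) dX = c ∫_{α₁>⋯>α_m>0} h(α) ∏ α_i^{n-m} ∏_{i<j}(α_i²-α_j²) dα`,
with `c = 2^m π^{(mn+m²)/2} / (Γ_m(n/2) Γ_m(m/2))`. -/
theorem stmt_3 (n m : ℕ) (hm : 1 ≤ m) (hmn : m ≤ n)
    (h : (Fin m → ℝ) → ENNReal) (hh : Measurable h) :
    ∫⁻ X : Matrix (Fin n) (Fin m) ℝ, h (svalues X) =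
      ENNReal.ofReal ((2 : ℝ) ^ m * Real.pi ^ (((m * n + m ^ 2 : ℕ) : ℝ) / 2) /
          (mvGamma m ((n : ℝ) / 2) * mvGamma m ((m : ℝ) / 2))) *
        ∫⁻ α in {α : Fin m → ℝ | StrictAnti α ∧ ∀ i, 0 < α i},
          h α * ENNReal.ofReal ((∏ i : Fin m, α i ^ (n - m)) *
            ∏ i : Fin m, ∏ j ∈ Finset.Ioi i, (α i ^ 2 - α j ^ 2)) := by
  have hsq : Measurable fun (a : Fin m → ℝ) i => √(a i) := by fun_prop
  have h1 : ∀ α ∈ {α : Fin m → ℝ | StrictAnti α ∧ ∀ i, 0 < α i},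
      ENNReal.ofReal (2 ^ m * ∏ i, α i) * (h (fun i => √(α i ^ 2)) * ENNReal.ofReal
        ((∏ i, α i ^ 2) ^ (((n : ℝ) - m - 1) / 2) * vdm fun i => α i ^ 2)) =
      ENNReal.ofReal (2 ^ m) * (h α * ENNReal.ofReal ((∏ i : Fin m, α i ^ (n - m)) *
        ∏ i : Fin m, ∏ j ∈ Finset.Ioi i, (α i ^ 2 - α j ^ 2))) := by
    intro α hα
    have h2 : (fun i => √(α i ^ 2)) = α := funext fun i => sqrt_sq (hα.2 i).le
    have h3 : 0 < ∏ i, α i := Finset.prod_pos fun i _ => hα.2 i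
    rw [h2, mul_left_comm, mul_left_comm _ (h α), ← ENNReal.ofReal_mul (by positivity),
      ← ENNReal.ofReal_mul (by positivity), ← prod_mul_prod_sq_rpow hmn hα.2, vdm]
    congr 2; ring
  simp only [svalues_eq]
  rw [gramFormula hmn (fun a => h fun i => √(a i)) (hh.comp hsq), setLIntegral_strictAnti_pos_sq,
    setLIntegral_congr_fun measurableSet_strictAnti_pos h1,
    lintegral_const_mul' _ _ ENNReal.ofReal_ne_top, ← mul_assoc,
    ← ENNReal.ofReal_mul (gramConst_nonneg hmn), gramConst]
  congr 2; ring
end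

section
/- Let m ≥ 1, let κ = (k₁, …, k_m) ∈ ℝ^m, let A be an m×m real positive definite matrix, and let B be an m×m real upper triangular matrix with nonzero diagonal entries. Then q_κ(Bᵀ A B) = q_κ(Bᵀ B) · q_κ(A). -/
open MeasureTheory Matrix Real

/-- If the columns of `N` selected by `g` are supported on the range of the injection `e`, then
the corresponding submatrix of `M * N` is a product of submatrices of `M` and `N`. -/
theorem Matrix.submatrix_mul_of_support_subset_range {l m n o p q R : Type*}
    [Fintype n] [Fintype p] [NonUnitalNonAssocSemiring R]
    (M : Matrix m n R) (N : Matrix n o R) (f : l → m) (g : q → o) {e : p → n}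
    (he : Function.Injective e) (h : ∀ k ∉ Set.range e, ∀ j, N k (g j) = 0) :
    (M * N).submatrix f g = M.submatrix f e * N.submatrix e g := by
  ext i j
  simp only [submatrix_apply, mul_apply]
  refine (Fintype.sum_of_injective e he _ _ (fun k hk => ?_) fun _ => rfl).symm
  rw [h k hk j, mul_zero]

/-- Right multiplication by an upper triangular matrix multiplies leading principal minors. -/
theorem princMinor_mul_of_blockTriangular {m : ℕ} (M : Matrix (Fin m) (Fin m) ℝ)
    {B : Matrix (Fin m) (Fin m) ℝ} (hB : B.BlockTriangular id) (i : Fin m) :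
    princMinor (M * B) i = princMinor M i * princMinor B i := by
  unfold princMinor
  rw [submatrix_mul_of_support_subset_range M B _ _ (Fin.castLE_injective i.isLt), det_mul]
  intro k hk j
  refine hB (lt_of_not_ge fun hkj => hk ⟨⟨k, ?_⟩, rfl⟩)
  exact lt_of_le_of_lt hkj j.isLt

theorem princMinor_transpose {m : ℕ} (M : Matrix (Fin m) (Fin m) ℝ) (i : Fin m) :
    princMinor Mᵀ i = princMinor M i := by
  unfold princMinor
  rw [← transpose_submatrix, det_transpose]

theorem princMinor_transpose_mul_of_blockTriangular {m : ℕ} (M : Matrix (Fin m) (Fin m) ℝ)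
    {B : Matrix (Fin m) (Fin m) ℝ} (hB : B.BlockTriangular id) (i : Fin m) :
    princMinor (Bᵀ * M) i = princMinor B i * princMinor M i := by
  rw [← princMinor_transpose, transpose_mul, transpose_transpose,
    princMinor_mul_of_blockTriangular _ hB, princMinor_transpose, mul_comm]

theorem Matrix.PosDef.princMinor_pos {m : ℕ} {A : Matrix (Fin m) (Fin m) ℝ} (hA : A.PosDef)
    (i : Fin m) : 0 < princMinor A i :=
  (hA.submatrix (Fin.castLE_injective i.isLt)).det_pos

/-- for `A` positive definite and `B` upper triangular with nonzero
diagonal entries, `q_κ(Bᵀ A B) = q_κ(Bᵀ B) · q_κ(A)`. -/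
theorem stmt_6 (m : ℕ) (hm : 1 ≤ m) (κ : Fin m → ℝ)
    (A : Matrix (Fin m) (Fin m) ℝ) (hA : A.PosDef)
    (B : Matrix (Fin m) (Fin m) ℝ) (hB : B.BlockTriangular id)
    (hBd : ∀ i, B i i ≠ 0) :
    hwv κ (Bᵀ * A * B) = hwv κ (Bᵀ * B) * hwv κ A := by
  unfold hwv
  rw [← Finset.prod_mul_distrib]
  refine Finset.prod_congr rfl fun i _ => ?_
  rw [princMinor_mul_of_blockTriangular _ hB, princMinor_transpose_mul_of_blockTriangular _ hB,
    princMinor_transpose_mul_of_blockTriangular _ hB, mul_right_comm,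
    Real.mul_rpow (mul_self_nonneg _) (hA.princMinor_pos i).le]
end

section
/- Let n ≥ m ≥ 1, let Σ be an m×m real positive definite matrix, Θ an n×n real positive definite matrix, μ an n×m real matrix, ρ > 0, k ∈ ℝ and ν > 0 with ν/2 + k > 0, and τ = (t₁, …, t_m) ∈ ℝ^m with n/2 + t_i − (i−1)/2 > 0 for all i. Let S and Y be independent random variables on a probability space, where S > 0 has density s^{ν/2+k−1} e^{−s/ρ}/(Γ(ν/2+k) ρ^{ν/2+k}) on (0, ∞), and Y has the Kotz-Riesz type I distribution KR^I_{n×m}(τ, 0, Θ, Σ). Then T = S^{−1/2} Y + μ has, with respect to Lebesgue measure on n×m real matrices, the density c · [1 + ρ·tr(Σ^{−1}(T−μ)ᵀ Θ^{−1}(T−μ))]^{−[(ν+mn)/2 + k + Σᵢtᵢ]} · q_τ(u(Σ)^{−ᵀ}(T−μ)ᵀ Θ^{−1}(T−μ) u(Σ)^{−1}), where c = Γ_m(n/2) · Γ((ν+mn)/2 + k + Σᵢtᵢ) · ρ^{mn/2 + Σᵢtᵢ} / (π^{mn/2} Γ_m(n/2, τ) Γ(ν/2+k) (det Σ)^{n/2}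 (det Θ)^{m/2}). This is the matrix multivariate T-Riesz type I density. -/
open MeasureTheory Matrix Real

/-- The Kotz-Riesz type I density `KR^I_{n×m}(τ, μ, Θ, Σ)` (with `U = u(Σ)` the upper
triangular Cholesky factor of `Σ`, supplied explicitly). -/
noncomputable def kotzRieszIDen (n m : ℕ) (τ : Fin m → ℝ) (μ : Matrix (Fin n) (Fin m) ℝ)
    (Θ : Matrix (Fin n) (Fin n) ℝ) (Sig U : Matrix (Fin m) (Fin m) ℝ)
    (y : Matrix (Fin n) (Fin m) ℝ) : ℝ :=
  mvGamma m ((n : ℝ) / 2) /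
      (Real.pi ^ (((m * n : ℕ) : ℝ) / 2) * mvGammaI m ((n : ℝ) / 2) τ *
        Sig.det ^ ((n : ℝ) / 2) * Θ.det ^ ((m : ℝ) / 2)) *
    Real.exp (-(Sig⁻¹ * (y - μ)ᵀ * Θ⁻¹ * (y - μ)).trace) *
    hwv τ ((Uᵀ)⁻¹ * (y - μ)ᵀ * Θ⁻¹ * (y - μ) * U⁻¹)

/-- The Kotz-Riesz type II density `KR^{II}_{n×m}(τ, μ, Θ, Σ)` (with `U = u(Σ)` the upper
triangular Cholesky factor of `Σ`, supplied explicitly). -/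
noncomputable def kotzRieszIIDen (n m : ℕ) (τ : Fin m → ℝ) (μ : Matrix (Fin n) (Fin m) ℝ)
    (Θ : Matrix (Fin n) (Fin n) ℝ) (Sig U : Matrix (Fin m) (Fin m) ℝ)
    (y : Matrix (Fin n) (Fin m) ℝ) : ℝ :=
  mvGamma m ((n : ℝ) / 2) /
      (Real.pi ^ (((m * n : ℕ) : ℝ) / 2) * mvGammaII m ((n : ℝ) / 2) τ *
        Sig.det ^ ((n : ℝ) / 2) * Θ.det ^ ((m : ℝ) / 2)) *
    Real.exp (-(Sig⁻¹ * (y - μ)ᵀ * Θ⁻¹ * (y - μ)).trace) *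
    hwv τ (((Uᵀ)⁻¹ * (y - μ)ᵀ * Θ⁻¹ * (y - μ) * U⁻¹)⁻¹)

/-- The matrix multivariate T-Riesz type I density
`MTR^I(ν, k, τ, ρ, μ, Θ, Σ)` (with `U = u(Σ)` supplied explicitly). -/
noncomputable def tRieszIDen (n m : ℕ) (ν k ρ : ℝ) (τ : Fin m → ℝ)
    (μ : Matrix (Fin n) (Fin m) ℝ) (Θ : Matrix (Fin n) (Fin n) ℝ)
    (Sig U : Matrix (Fin m) (Fin m) ℝ) (t : Matrix (Fin n) (Fin m) ℝ) : ℝ :=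
  mvGamma m ((n : ℝ) / 2) * Real.Gamma ((ν + (m * n : ℕ)) / 2 + k + ∑ i, τ i) *
      ρ ^ (((m * n : ℕ) : ℝ) / 2 + ∑ i, τ i) /
      (Real.pi ^ (((m * n : ℕ) : ℝ) / 2) * mvGammaI m ((n : ℝ) / 2) τ *
        Real.Gamma (ν / 2 + k) * Sig.det ^ ((n : ℝ) / 2) * Θ.det ^ ((m : ℝ) / 2)) *
    (1 + ρ * (Sig⁻¹ * (t - μ)ᵀ * Θ⁻¹ * (t - μ)).trace) ^
      (-((ν + (m * n : ℕ)) / 2 + k + ∑ i, τ i)) *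
    hwv τ ((Uᵀ)⁻¹ * (t - μ)ᵀ * Θ⁻¹ * (t - μ) * U⁻¹)

/-- The matrix multivariate T-Riesz type II density
`MTR^{II}(ν, k, τ, ρ, μ, Θ, Σ)` (with `U = u(Σ)` supplied explicitly). -/
noncomputable def tRieszIIDen (n m : ℕ) (ν k ρ : ℝ) (τ : Fin m → ℝ)
    (μ : Matrix (Fin n) (Fin m) ℝ) (Θ : Matrix (Fin n) (Fin n) ℝ)
    (Sig U : Matrix (Fin m) (Fin m) ℝ) (t : Matrix (Fin n) (Fin m) ℝ) : ℝ :=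
  mvGamma m ((n : ℝ) / 2) * Real.Gamma ((ν + (m * n : ℕ)) / 2 - k - ∑ i, τ i) *
      ρ ^ (((m * n : ℕ) : ℝ) / 2 - ∑ i, τ i) /
      (Real.pi ^ (((m * n : ℕ) : ℝ) / 2) * mvGammaII m ((n : ℝ) / 2) τ *
        Real.Gamma (ν / 2 - k) * Sig.det ^ ((n : ℝ) / 2) * Θ.det ^ ((m : ℝ) / 2)) *
    (1 + ρ * (Sig⁻¹ * (t - μ)ᵀ * Θ⁻¹ * (t - μ)).trace) ^
      (-((ν + (m * n : ℕ)) / 2 - k - ∑ i, τ i)) *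
    hwv τ (((Uᵀ)⁻¹ * (t - μ)ᵀ * Θ⁻¹ * (t - μ) * U⁻¹)⁻¹)

section ScaleMixture

variable {E : Type*} [NormedAddCommGroup E] [NormedSpace ℝ E] [FiniteDimensional ℝ E]
  [MeasurableSpace E] [BorelSpace E]

theorem lintegral_comp_smul_add (vol : Measure E) [vol.IsAddHaarMeasure] {r : ℝ} (hr : 0 < r)
    (c : E) (F : E → ENNReal) (hF : Measurable F) :
    ∫⁻ y, F y ∂vol
      = ENNReal.ofReal (r ^ Module.finrank ℝ E) * ∫⁻ t, F (r • (t - c)) ∂vol := by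
  rw [lintegral_sub_right_eq_self (fun t => F (r • t)) c,
    ← lintegral_map (f := F) (g := fun t => r • t) hF (measurable_const_smul r),
    Measure.map_addHaar_smul vol hr.ne', lintegral_smul_measure, smul_eq_mul, ← mul_assoc,
    ← ENNReal.ofReal_mul (by positivity), abs_of_pos (by positivity),
    mul_inv_cancel₀ (by positivity), ENNReal.ofReal_one, one_mul]

theorem map_prod_withDensity_rpow_smul_add (vol : Measure E) [vol.IsAddHaarMeasure]
    (g : ℝ → ENNReal) (hg : Measurable g) (hg0 : ∀ s ≤ 0, g s = 0)
    (f : E → ENNReal) (hf : Measurable f) (c : E) :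
    Measure.map (fun p : ℝ × E => p.1 ^ (-(1 : ℝ) / 2) • p.2 + c)
        (((volume : Measure ℝ).withDensity g).prod (vol.withDensity f)) =
      vol.withDensity fun t => ∫⁻ s in Set.Ioi (0 : ℝ),
        g s * (ENNReal.ofReal (s ^ ((Module.finrank ℝ E : ℝ) / 2)) *
          f (s ^ ((1 : ℝ) / 2) • (t - c))) := by
  have hΦ : Measurable (fun p : ℝ × E => p.1 ^ (-(1 : ℝ) / 2) • p.2 + c) := by fun_prop
  have hK : Measurable (fun p : E × ℝ => g p.2 * (ENNReal.ofReal
      (p.2 ^ ((Module.finrank ℝ E : ℝ) / 2)) * f (p.2 ^ ((1 : ℝ) / 2) • (p.1 - c)))) := by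
    fun_prop
  refine Measure.ext_of_lintegral _ fun h hh => ?_
  rw [lintegral_map hh hΦ, prod_withDensity hg hf,
    lintegral_withDensity_eq_lintegral_mul _ (by fun_prop) (by fun_prop),
    lintegral_withDensity_eq_lintegral_mul _ hK.lintegral_prod_right' hh,
    lintegral_prod _ (by fun_prop)]
  simp only [Pi.mul_apply]
  have hsub : ∀ s : ℝ, 0 < s → ∀ t : E,
      s ^ (-(1 : ℝ) / 2) • (s ^ ((1 : ℝ) / 2) • (t - c)) + c = t := by
    intro s hs t
    rw [smul_smul, ← Real.rpow_add hs]
    norm_num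
  have hpow : ∀ s : ℝ, 0 < s →
      (s ^ ((1 : ℝ) / 2)) ^ Module.finrank ℝ E = s ^ ((Module.finrank ℝ E : ℝ) / 2) := by
    intro s hs
    rw [← Real.rpow_mul_natCast hs.le]
    congr 1
    ring
  calc ∫⁻ s, ∫⁻ y, g s * f y * h (s ^ (-(1 : ℝ) / 2) • y + c) ∂vol
      = ∫⁻ s in Set.Ioi (0 : ℝ), ∫⁻ y, g s * f y * h (s ^ (-(1 : ℝ) / 2) • y + c) ∂vol := by
        rw [← lintegral_indicator measurableSet_Ioi]
        refine lintegral_congr fun s => ?_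
        by_cases hs : 0 < s
        · rw [Set.indicator_of_mem (Set.mem_Ioi.2 hs)]
        · rw [Set.indicator_of_notMem (by simpa using hs)]
          simp [hg0 s (not_lt.1 hs)]
    _ = ∫⁻ s in Set.Ioi (0 : ℝ), ∫⁻ t, g s * (ENNReal.ofReal
          (s ^ ((Module.finrank ℝ E : ℝ) / 2)) * f (s ^ ((1 : ℝ) / 2) • (t - c))) * h t ∂vol := by
        refine setLIntegral_congr_fun measurableSet_Ioi fun s (hs : 0 < s) => ?_
        rw [lintegral_comp_smul_add vol (Real.rpow_pos_of_pos hs ((1 : ℝ) / 2)) c _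
          (by fun_prop), hpow s hs, ← lintegral_const_mul _ (by fun_prop)]
        refine lintegral_congr fun t => ?_
        rw [hsub s hs t]
        ring
    _ = ∫⁻ t, (∫⁻ s in Set.Ioi (0 : ℝ), g s * (ENNReal.ofReal
          (s ^ ((Module.finrank ℝ E : ℝ) / 2)) * f (s ^ ((1 : ℝ) / 2) • (t - c))) * h t) ∂vol :=
        lintegral_lintegral_swap (by unfold Function.uncurry; fun_prop)
    _ = _ := by
        refine lintegral_congr fun t => ?_
        rw [lintegral_mul_const _ (by fun_prop)]

open ProbabilityTheory in
/-- The law of `S ^ (-1/2) • Y + c` for independent `S > 0` and `Y` with densities. No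
measurability of `Y` is assumed: a non-measurable `Y` has zero law by convention, and then so
does the scale mixture. -/
theorem map_rpow_smul_add_of_indepFun (vol : Measure E) [vol.IsAddHaarMeasure]
    (g : ℝ → ENNReal) (hg : Measurable g) (hg0 : ∀ s ≤ 0, g s = 0) (hg1 : ∀ s, 0 < s → g s ≠ 0)
    (f : E → ENNReal) (hf : Measurable f) (c : E)
    {Ω : Type*} [MeasurableSpace Ω] (P : Measure Ω) [IsProbabilityMeasure P]
    (S : Ω → ℝ) (Y : Ω → E) (hSY : IndepFun S Y P)
    (hS : Measure.map S P = volume.withDensity g) (hY : Measure.map Y P = vol.withDensity f) :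
    Measure.map (fun ω => S ω ^ (-(1 : ℝ) / 2) • Y ω + c) P =
      vol.withDensity fun t => ∫⁻ s in Set.Ioi (0 : ℝ),
        g s * (ENNReal.ofReal (s ^ ((Module.finrank ℝ E : ℝ) / 2)) *
          f (s ^ ((1 : ℝ) / 2) • (t - c))) := by
  rw [← map_prod_withDensity_rpow_smul_add vol g hg hg0 f hf c, ← hS, ← hY]
  have hSm : AEMeasurable S P := by
    refine AEMeasurable.of_map_ne_zero fun h0 => ?_
    have h1 : (volume.withDensity g) (Set.Ioi 0) = 0 := by rw [← hS, h0]; rfl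
    have hsub : Set.Ioi (0 : ℝ) ⊆ {x | g x ≠ 0} := fun s hs => hg1 s hs
    rw [withDensity_apply_eq_zero hg, Set.inter_eq_self_of_subset_right hsub] at h1
    simp at h1
  have hΦ : Measurable (fun p : ℝ × E => p.1 ^ (-(1 : ℝ) / 2) • p.2 + c) := by fun_prop
  by_cases hYm : AEMeasurable Y P
  · rw [← (indepFun_iff_map_prod_eq_prod_map_map hSm hYm).1 hSY,
      AEMeasurable.map_map_of_aemeasurable hΦ.aemeasurable (hSm.prodMk hYm)]
    rfl
  · rw [Measure.map_of_not_aemeasurable hYm, Measure.prod_zero, Measure.map_zero]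
    refine Measure.map_of_not_aemeasurable fun hT => hYm ?_
    have hpos : ∀ᵐ ω ∂P, 0 < S ω := by
      refine ae_of_ae_map (p := fun s => 0 < s) hSm ?_
      rw [hS, ae_withDensity_iff hg]
      refine Filter.Eventually.of_forall fun s hs => ?_
      by_contra hs'
      exact hs (hg0 s (not_lt.1 hs'))
    have hY' : AEMeasurable
        (fun ω => S ω ^ ((1 : ℝ) / 2) • ((S ω ^ (-(1 : ℝ) / 2) • Y ω + c) - c)) P :=
      (hSm.pow_const _).smul (hT.sub_const c)
    refine hY'.congr ?_
    filter_upwards [hpos] with ω hω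
    rw [add_sub_cancel_right, smul_smul, ← Real.rpow_add hω]
    norm_num

end ScaleMixture

section HighestWeight

theorem princMinor_smul {m : ℕ} (a : ℝ) (A : Matrix (Fin m) (Fin m) ℝ) (i : Fin m) :
    princMinor (a • A) i = a ^ (i.1 + 1) * princMinor A i := by
  unfold princMinor
  rw [Matrix.submatrix_smul, Pi.smul_apply, Pi.smul_apply, Matrix.det_smul, Fintype.card_fin]

theorem princMinor_nonneg {m : ℕ} {A : Matrix (Fin m) (Fin m) ℝ} (hA : A.PosSemidef)
    (i : Fin m) : 0 ≤ princMinor A i :=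
  (hA.submatrix _).det_nonneg

theorem sum_succ_mul_hwv_exponent {m : ℕ} (κ : Fin m → ℝ) :
    ∑ i : Fin m, ((i.1 : ℝ) + 1) *
      (if h : i.1 + 1 < m then κ i - κ ⟨i.1 + 1, h⟩ else κ i) = ∑ i, κ i := by
  set T : ℕ → ℝ := fun j => if h : j < m then κ ⟨j, h⟩ else 0 with hT
  have habel : ∀ N : ℕ, ∑ j ∈ Finset.range N, ((j : ℝ) + 1) * (T j - T (j + 1))
      = ∑ j ∈ Finset.range N, T j - N * T N := by
    intro N
    induction N with
    | zero => simp
    | succ N ih =>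
      rw [Finset.sum_range_succ, Finset.sum_range_succ, ih]
      push_cast
      ring
  have hm := habel m
  rw [Finset.sum_range, Finset.sum_range, show T m = 0 by simp [hT], mul_zero, sub_zero] at hm
  have hTκ : ∀ i : Fin m, T i.1 = κ i := fun i => by simp [hT]
  simp only [hTκ] at hm
  rw [← hm]
  refine Finset.sum_congr rfl fun i _ => ?_
  by_cases h : i.1 + 1 < m <;> simp [hT, h]

theorem hwv_smul {m : ℕ} (κ : Fin m → ℝ) {a : ℝ} (ha : 0 < a) {A : Matrix (Fin m) (Fin m) ℝ}
    (hA : A.PosSemidef) : hwv κ (a • A) = a ^ (∑ i, κ i) * hwv κ A := by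
  unfold hwv
  rw [← sum_succ_mul_hwv_exponent κ, Real.rpow_sum_of_pos ha, ← Finset.prod_mul_distrib]
  refine Finset.prod_congr rfl fun i _ => ?_
  rw [princMinor_smul, Real.mul_rpow (by positivity) (princMinor_nonneg hA i),
    ← Real.rpow_natCast, ← Real.rpow_mul ha.le]
  push_cast
  rfl

end HighestWeight

theorem lintegral_rpow_mul_exp_neg_mul_Ioi {a r : ℝ} (ha : 0 < a) (hr : 0 < r) :
    ∫⁻ s in Set.Ioi (0 : ℝ), ENNReal.ofReal (s ^ (a - 1) * Real.exp (-(r * s)))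
      = ENNReal.ofReal ((1 / r) ^ a * Real.Gamma a) := by
  rw [← Real.integral_rpow_mul_exp_neg_mul_Ioi ha hr, ofReal_integral_eq_lintegral_ofReal]
  · simpa [IntegrableOn] using integrableOn_rpow_mul_exp_neg_mul_rpow (s := a - 1) (p := 1) (b := r)
      (by linarith) one_pos hr
  · filter_upwards [self_mem_ae_restrict measurableSet_Ioi] with s (hs : 0 < s)
    positivity

section QuadraticForm

variable {n m : ℕ} {Sig U : Matrix (Fin m) (Fin m) ℝ} {Θ : Matrix (Fin n) (Fin n) ℝ}

theorem posSemidef_whitened_gram (hΘ : Θ.PosDef) (x : Matrix (Fin n) (Fin m) ℝ) :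
    ((Uᵀ)⁻¹ * xᵀ * Θ⁻¹ * x * U⁻¹).PosSemidef := by
  have h := hΘ.inv.posSemidef.conjTranspose_mul_mul_same (x * U⁻¹)
  rw [Matrix.conjTranspose_eq_transpose_of_trivial, Matrix.transpose_mul,
    Matrix.transpose_nonsing_inv] at h
  simpa only [Matrix.mul_assoc] using h

theorem trace_whitened_gram (hUSig : Sig = Uᵀ * U) (x : Matrix (Fin n) (Fin m) ℝ) :
    (Sig⁻¹ * xᵀ * Θ⁻¹ * x).trace = ((Uᵀ)⁻¹ * xᵀ * Θ⁻¹ * x * U⁻¹).trace := by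
  rw [hUSig, Matrix.mul_inv_rev, Matrix.trace_mul_comm _ U⁻¹]
  simp only [Matrix.mul_assoc]

theorem measurable_kotzRieszIDen (τ : Fin m → ℝ) (μ : Matrix (Fin n) (Fin m) ℝ) :
    Measurable (kotzRieszIDen n m τ μ Θ Sig U) := by
  have : BorelSpace (Matrix (Fin n) (Fin m) ℝ) :=
    inferInstanceAs (BorelSpace (Fin n → Fin m → ℝ))
  have hexp : Measurable fun y : Matrix (Fin n) (Fin m) ℝ =>
      Real.exp (-(Sig⁻¹ * (y - μ)ᵀ * Θ⁻¹ * (y - μ)).trace) :=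
    Continuous.measurable (by fun_prop)
  have hhwv : Measurable fun y : Matrix (Fin n) (Fin m) ℝ =>
      hwv τ ((Uᵀ)⁻¹ * (y - μ)ᵀ * Θ⁻¹ * (y - μ) * U⁻¹) := by
    unfold hwv princMinor
    refine Finset.measurable_prod _ fun i _ => Measurable.pow_const ?_ _
    exact Continuous.measurable (by fun_prop)
  exact (hexp.const_mul _).mul hhwv

theorem kotzRieszIDen_rpow_smul (hΘ : Θ.PosDef) (τ : Fin m → ℝ)
    (x : Matrix (Fin n) (Fin m) ℝ) {s : ℝ} (hs : 0 < s) :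
    kotzRieszIDen n m τ 0 Θ Sig U (s ^ ((1 : ℝ) / 2) • x) =
      mvGamma m ((n : ℝ) / 2) /
        (Real.pi ^ (((m * n : ℕ) : ℝ) / 2) * mvGammaI m ((n : ℝ) / 2) τ *
          Sig.det ^ ((n : ℝ) / 2) * Θ.det ^ ((m : ℝ) / 2)) *
      Real.exp (-(s * (Sig⁻¹ * xᵀ * Θ⁻¹ * x).trace)) *
      (s ^ (∑ i, τ i) * hwv τ ((Uᵀ)⁻¹ * xᵀ * Θ⁻¹ * x * U⁻¹)) := by
  have hss : s ^ ((1 : ℝ) / 2) * s ^ ((1 : ℝ) / 2) = s := by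
    rw [← Real.rpow_add hs]
    norm_num
  rw [← hwv_smul τ hs (posSemidef_whitened_gram hΘ x)]
  simp only [kotzRieszIDen, sub_zero, Matrix.transpose_smul, Matrix.mul_smul, Matrix.smul_mul,
    smul_smul, hss, Matrix.trace_smul, smul_eq_mul]

theorem lintegral_gamma_mul_kotzRieszIDen (hΘ : Θ.PosDef) (hUSig : Sig = Uᵀ * U) {ρ k ν : ℝ}
    (hρ : 0 < ρ) (hνk : 0 < ν / 2 + k) {τ : Fin m → ℝ}
    (ha : 0 < (ν + (m * n : ℕ)) / 2 + k + ∑ i, τ i) (μ t : Matrix (Fin n) (Fin m) ℝ) :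
    ∫⁻ s in Set.Ioi (0 : ℝ), (if 0 < s then
        ENNReal.ofReal (s ^ (ν / 2 + k - 1) * Real.exp (-s / ρ) /
          (Real.Gamma (ν / 2 + k) * ρ ^ (ν / 2 + k)))
      else 0) * (ENNReal.ofReal (s ^ (((m * n : ℕ) : ℝ) / 2)) *
        ENNReal.ofReal (kotzRieszIDen n m τ 0 Θ Sig U (s ^ ((1 : ℝ) / 2) • (t - μ)))) =
      ENNReal.ofReal (tRieszIDen n m ν k ρ τ μ Θ Sig U t) := by
  set x := t - μ with hx
  set q := (Sig⁻¹ * xᵀ * Θ⁻¹ * x).trace with hq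
  set h := hwv τ ((Uᵀ)⁻¹ * xᵀ * Θ⁻¹ * x * U⁻¹) with hh
  set a := (ν + (m * n : ℕ)) / 2 + k + ∑ i, τ i with ha_def
  set C := mvGamma m ((n : ℝ) / 2) /
    (Real.pi ^ (((m * n : ℕ) : ℝ) / 2) * mvGammaI m ((n : ℝ) / 2) τ *
      Sig.det ^ ((n : ℝ) / 2) * Θ.det ^ ((m : ℝ) / 2)) with hC
  have hq0 : 0 ≤ q := by
    rw [hq, trace_whitened_gram hUSig]
    exact (posSemidef_whitened_gram hΘ x).trace_nonneg
  have hr : 0 < 1 / ρ + q := by positivity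
  have hΓ := Real.Gamma_pos_of_pos hνk
  have hΓa := Real.Gamma_pos_of_pos ha
  have hintegrand : ∀ s : ℝ, 0 < s →
      (if 0 < s then ENNReal.ofReal (s ^ (ν / 2 + k - 1) * Real.exp (-s / ρ) /
          (Real.Gamma (ν / 2 + k) * ρ ^ (ν / 2 + k))) else 0) *
        (ENNReal.ofReal (s ^ (((m * n : ℕ) : ℝ) / 2)) *
          ENNReal.ofReal (kotzRieszIDen n m τ 0 Θ Sig U (s ^ ((1 : ℝ) / 2) • x))) =
      ENNReal.ofReal (s ^ (a - 1) * Real.exp (-((1 / ρ + q) * s))) *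
        ENNReal.ofReal (C * h / (Real.Gamma (ν / 2 + k) * ρ ^ (ν / 2 + k))) := by
    intro s hs
    rw [if_pos hs, kotzRieszIDen_rpow_smul hΘ τ x hs, ← ENNReal.ofReal_mul (by positivity),
      ← ENNReal.ofReal_mul (by positivity), ← ENNReal.ofReal_mul (by positivity)]
    have hpow : s ^ (a - 1) =
        s ^ (ν / 2 + k - 1) * s ^ (((m * n : ℕ) : ℝ) / 2) * s ^ (∑ i, τ i) := by
      rw [← Real.rpow_add hs, ← Real.rpow_add hs, ha_def]
      congr 1
      ring
    have hexp : Real.exp (-((1 / ρ + q) * s)) = Real.exp (-s / ρ) * Real.exp (-(s * q)) := by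
      rw [← Real.exp_add]
      congr 1
      ring
    rw [hpow, hexp]
    congr 1
    ring
  rw [setLIntegral_congr_fun measurableSet_Ioi fun s hs => hintegrand s hs,
    lintegral_mul_const _ (by fun_prop), lintegral_rpow_mul_exp_neg_mul_Ioi ha hr,
    ← ENNReal.ofReal_mul (by positivity)]
  have hbase : (1 / (1 / ρ + q)) ^ a =
      ρ ^ (ν / 2 + k) * ρ ^ (((m * n : ℕ) : ℝ) / 2 + ∑ i, τ i) * (1 + ρ * q) ^ (-a) := by
    rw [← Real.rpow_add hρ, Real.rpow_neg (by positivity), ← div_eq_mul_inv,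
      show 1 / (1 / ρ + q) = ρ / (1 + ρ * q) by field_simp,
      Real.div_rpow hρ.le (by positivity), ha_def]
    congr 2
    ring
  have hρb : ρ ^ (ν / 2 + k) ≠ 0 := by positivity
  rw [tRieszIDen, ← hx, ← hq, ← hh, ← ha_def, hbase, hC]
  congr 1
  calc _ = (ρ ^ (ν / 2 + k) * (ρ ^ (ν / 2 + k))⁻¹) * (mvGamma m ((n : ℝ) / 2) * Real.Gamma a *
      ρ ^ (((m * n : ℕ) : ℝ) / 2 + ∑ i, τ i) /
      (Real.pi ^ (((m * n : ℕ) : ℝ) / 2) * mvGammaI m ((n : ℝ) / 2) τ *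
        Real.Gamma (ν / 2 + k) * Sig.det ^ ((n : ℝ) / 2) * Θ.det ^ ((m : ℝ) / 2)) *
      (1 + ρ * q) ^ (-a) * h) := by
        simp only [div_eq_mul_inv, mul_inv]
        ring
    _ = _ := by rw [mul_inv_cancel₀ hρb, one_mul]

end QuadraticForm

/-- if `S` has the univariate Riesz (gamma) density with parameters
`ν/2 + k, ρ` and, independently, `Y ~ KR^I_{n×m}(τ, 0, Θ, Σ)`, then
`T = S^{-1/2} Y + μ` has the matrix multivariate T-Riesz type I density. -/
theorem stmt_8 (n m : ℕ) (hm : 1 ≤ m) (hmn : m ≤ n)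
    (Sig : Matrix (Fin m) (Fin m) ℝ) (hSig : Sig.PosDef)
    (Θ : Matrix (Fin n) (Fin n) ℝ) (hΘ : Θ.PosDef)
    (μ : Matrix (Fin n) (Fin m) ℝ) (ρ k ν : ℝ) (hρ : 0 < ρ) (hν : 0 < ν)
    (hνk : 0 < ν / 2 + k) (τ : Fin m → ℝ)
    (hτ : ∀ i : Fin m, 0 < (n : ℝ) / 2 + τ i - (i : ℝ) / 2)
    (U : Matrix (Fin m) (Fin m) ℝ) (hU : U.BlockTriangular id)
    (hUd : ∀ i, 0 < U i i) (hUSig : Sig = Uᵀ * U)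
    {Ω : Type*} [MeasurableSpace Ω] (P : Measure Ω) [IsProbabilityMeasure P]
    (S : Ω → ℝ) (Y : Ω → Matrix (Fin n) (Fin m) ℝ)
    (hSY : ProbabilityTheory.IndepFun S Y P)
    (hS : Measure.map S P = volume.withDensity fun s =>
      if 0 < s then
        ENNReal.ofReal (s ^ (ν / 2 + k - 1) * Real.exp (-s / ρ) /
          (Real.Gamma (ν / 2 + k) * ρ ^ (ν / 2 + k)))
      else 0)
    (hY : Measure.map Y P =
      volume.withDensity fun y => ENNReal.ofReal (kotzRieszIDen n m τ 0 Θ Sig U y)) :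
    Measure.map (fun ω => S ω ^ (-(1 : ℝ) / 2) • Y ω + μ) P =
      volume.withDensity fun t =>
        ENNReal.ofReal (tRieszIDen n m ν k ρ τ μ Θ Sig U t) := by
  have hborel : BorelSpace (Matrix (Fin n) (Fin m) ℝ) :=
    inferInstanceAs (BorelSpace (Fin n → Fin m → ℝ))
  have hrank : Module.finrank ℝ (Fin n → Fin m → ℝ) = m * n := by
    simp [Module.finrank_pi_fintype, mul_comm]
  have ha : 0 < (ν + (m * n : ℕ)) / 2 + k + ∑ i, τ i := by
    have h1 : 0 ≤ ∑ i : Fin m, ((n : ℝ) / 2 + τ i) :=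
      Finset.sum_nonneg fun i _ => by
        have h2 := hτ i
        have h3 : (0 : ℝ) ≤ (i : ℝ) / 2 := by positivity
        linarith
    rw [Finset.sum_add_distrib] at h1
    simp only [Finset.sum_const, Finset.card_univ, Fintype.card_fin, nsmul_eq_mul] at h1
    push_cast
    linarith
  have hΓ := Real.Gamma_pos_of_pos hνk
  refine (map_rpow_smul_add_of_indepFun (E := Fin n → Fin m → ℝ) volume _ ?_ ?_ ?_ _
    (measurable_kotzRieszIDen τ 0).ennreal_ofReal μ P S Y hSY hS hY).trans ?_
  · exact Measurable.ite measurableSet_Ioi (by fun_prop) measurable_const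
  · exact fun s hs => if_neg hs.not_gt
  · intro s hs
    rw [if_pos hs]
    exact (ENNReal.ofReal_pos.2 (by positivity)).ne'
  · rw [hrank]
    exact congrArg (Measure.withDensity volume) (funext fun t =>
      lintegral_gamma_mul_kotzRieszIDen hΘ hUSig hρ hνk ha μ t)
end
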